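/- Let d ≥ 3, let K be a convex body contained in an affine chart of ℝP^d, let H ⊂ ℝP^d be a hyperplane which is not a support hyperplane of K, and let p₁, p₂ be two distinct interior points of K with p₁, p₂ ∉ H. Suppose that for every (d−2)-dimensional projective plane l ⊂ H there exists a harmonic homology Φ_G^τ : ℝP^d → ℝP^d with hyperplane G and center τ such that l ⊂ G, τ ∈ H, and Φ_G^τ(aff{p₁, l} ∩ K) = aff{p₂, l} ∩ K. Then K is an ellipsoid. -/

import Mathlib

noncomputable section

open Set Module

/-- The vector space `ℝ^{d+1}` whose projectivization is `ℝP^d`. -/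
abbrev PV (d : ℕ) : Type := Fin (d + 1) → ℝ

/-- Real projective `d`-space `ℝP^d`. -/
abbrev RP (d : ℕ) : Type := Projectivization ℝ (PV d)

/-- The affine chart embedding of `ℝ^d` into `ℝP^d` determined by a linear
change of coordinates `e` of `ℝ^{d+1}`. -/
def chartMap {d : ℕ} (e : PV d ≃ₗ[ℝ] PV d) (x : Fin d → ℝ) : RP d :=
  Projectivization.mk ℝ (e (Fin.snoc x 1)) <| by
    rw [ne_eq, LinearEquiv.map_eq_zero_iff]
    intro h
    have h1 := congrFun h (Fin.last d)
    simp [Fin.snoc_last] at h1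

/-- The set of points of `ℝP^d` lying in (the projectivization of) a linear subspace `W`. -/
def projSet {d : ℕ} (W : Submodule ℝ (PV d)) : Set (RP d) :=
  {x : RP d | x.submodule ≤ W}

/-- The projective line through two points, as a set of points of `ℝP^d`. -/
def projLine {d : ℕ} (A B : RP d) : Set (RP d) :=
  {x : RP d | x.submodule ≤ A.submodule ⊔ B.submodule}

/-- The projective span `aff {p, l}` of a point `p` and the projective subspace
corresponding to the linear subspace `W`. -/
def projSpan {d : ℕ} (p : RP d) (W : Submodule ℝ (PV d)) : Set (RP d) :=
  {x : RP d | x.submodule ≤ W ⊔ p.submodule}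

/-- Four collinear points of `ℝP^d` are harmonic, `[A,B;P,Q] = -1`:  there are
representatives `a, b` of `A, B` such that `a + b` represents `P` and `a - b`
represents `Q`. -/
def HarmonicQuad {d : ℕ} (A B P Q : RP d) : Prop :=
  ∃ (a b : PV d) (ha : a ≠ 0) (hb : b ≠ 0) (hab : a + b ≠ 0) (hab' : a - b ≠ 0),
    A = Projectivization.mk ℝ a ha ∧ B = Projectivization.mk ℝ b hb ∧
      P = Projectivization.mk ℝ (a + b) hab ∧ Q = Projectivization.mk ℝ (a - b) hab'

/-- `g` is a pole, with polar the set `H`, of a convex body with boundary `bdK`: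
every line through `g` meeting the boundary in two points `A ≠ B` and meeting `H`
in a point `q` satisfies `[A,B;g,q] = -1`. -/
def IsPoleOf {d : ℕ} (bdK : Set (RP d)) (g : RP d) (H : Set (RP d)) : Prop :=
  ∀ A B q : RP d, A ∈ bdK → B ∈ bdK → A ≠ B →
    g ∈ projLine A B → q ∈ projLine A B → q ∈ H → HarmonicQuad A B g q

/-- `Φ` is the harmonic homology of `ℝP^d` with hyperplane `G` and center `τ`:
it is induced by a linear involution which is the identity on a linear hyperplane
representing `G` and is `-1` on the line representing `τ`. -/
def IsHarmonicHomology {d : ℕ} (Φ : RP d → RP d) (G : Set (RP d)) (τ : RP d) : Prop :=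
  ∃ (σ : PV d ≃ₗ[ℝ] PV d) (W : Submodule ℝ (PV d)) (t : PV d) (ht : t ≠ 0),
    Module.finrank ℝ W = d ∧ G = projSet W ∧ τ = Projectivization.mk ℝ t ht ∧ t ∉ W ∧
      (∀ v ∈ W, σ v = v) ∧ σ t = -t ∧
      ∀ (v : PV d) (hv : v ≠ 0), ∃ hv' : σ v ≠ 0,
        Φ (Projectivization.mk ℝ v hv) = Projectivization.mk ℝ (σ v) hv'

/-- The boundary of the convex body `chartMap e '' K₀` of `ℝP^d`, i.e. the image of
the boundary of `K₀ ⊆ ℝ^d` under the affine chart embedding. -/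
def chartFrontier {d : ℕ} (e : PV d ≃ₗ[ℝ] PV d) (K₀ : Set (Fin d → ℝ)) : Set (RP d) :=
  chartMap e '' frontier K₀

/-- The closed Euclidean unit ball of `ℝ^d`. -/
def euclUnitBall (d : ℕ) : Set (Fin d → ℝ) := {x : Fin d → ℝ | ∑ i, x i ^ 2 ≤ 1}

/-- A subset of `ℝ^d` is an ellipsoid if it is the image of the closed Euclidean
unit ball under an invertible affine map. -/
def IsEllipsoidIn (d : ℕ) (S : Set (Fin d → ℝ)) : Prop :=
  ∃ T : (Fin d → ℝ) ≃ᵃ[ℝ] (Fin d → ℝ), S = T '' euclUnitBall d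

/-- A subset of `ℝP^d` is an ellipsoid if, in some affine chart containing it, it is
the image of the closed Euclidean unit ball under an invertible affine map. -/
def IsProjEllipsoid {d : ℕ} (K : Set (RP d)) : Prop :=
  ∃ (e : PV d ≃ₗ[ℝ] PV d) (S : Set (Fin d → ℝ)), IsEllipsoidIn d S ∧ K = chartMap e '' S

/-- `H` is a support hyperplane of the convex body `chartMap e '' K₀`: it meets the
body but misses its interior. -/
def IsSupportHyperplane {d : ℕ} (e : PV d ≃ₗ[ℝ] PV d) (K₀ : Set (Fin d → ℝ))
    (H : Set (RP d)) : Prop :=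
  (H ∩ chartMap e '' K₀).Nonempty ∧ H ∩ chartMap e '' interior K₀ = ∅

/-- The relative boundary of the section of the convex body `chartMap e '' K₀` by the
projective plane corresponding to the linear subspace `W`. -/
def sectionFrontier {d : ℕ} (e : PV d ≃ₗ[ℝ] PV d) (K₀ : Set (Fin d → ℝ))
    (W : Submodule ℝ (PV d)) : Set (RP d) :=
  chartMap e '' intrinsicFrontier ℝ (chartMap e ⁻¹' projSet W ∩ K₀)

/-- `p` is a false pole of the convex body `chartMap e '' K₀` with respect to `H`:
`p` is not a pole with respect to `H`, and for every projective 2-plane `Π` through `p`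
the section `Π ∩ K` has a pole whose corresponding polar is `Π ∩ H`. -/
def IsFalsePole {d : ℕ} (e : PV d ≃ₗ[ℝ] PV d) (K₀ : Set (Fin d → ℝ)) (p : RP d)
    (H : Set (RP d)) : Prop :=
  ¬ IsPoleOf (chartFrontier e K₀) p H ∧
    ∀ W : Submodule ℝ (PV d), Module.finrank ℝ W = 3 → p.submodule ≤ W →
      ∃ q : RP d, q.submodule ≤ W ∧ IsPoleOf (sectionFrontier e K₀ W) q (projSet W ∩ H)

section
open Set Module Filter Topology

/-- quadratic lemma -/
theorem quad_const {φ : ℝ → ℝ} {M : ℝ} (h : ∀ s t, |t - s| ≤ 1 → φ s - M * (t - s) ^ 2 ≤ φ t) :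
    ∀ s t, φ s = φ t := by
  have hd : ∀ s, HasDerivAt φ 0 s := by
    intro s
    rw [hasDerivAt_iff_isLittleO]
    have h1 : (fun x' => φ x' - φ s - (x' - s) • (0:ℝ)) =O[𝓝 s] fun x' => (x' - s) ^ 2 := by
      apply Asymptotics.IsBigO.of_bound |M|
      have : ∀ᶠ x in 𝓝 s, |x - s| ≤ 1 := by
        filter_upwards [Metric.closedBall_mem_nhds s one_pos] with x hx
        simpa [Real.dist_eq] using hx
      filter_upwards [this] with x hx
      have a := h s x hx
      have b := h x s (by rwa [abs_sub_comm])
      simp only [smul_eq_mul, mul_zero, sub_zero, Real.norm_eq_abs, abs_pow, sq_abs]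
      have : M * (x - s)^2 ≤ |M| * (x-s)^2 := by gcongr; exact le_abs_self M
      have e : (s - x)^2 = (x-s)^2 := by ring
      rw [e] at b
      rw [abs_le]; constructor <;> linarith
    refine h1.trans_isLittleO ?_
    have : (fun x' : ℝ => (x' - s) ^ 2) = fun x' => (x' - s) * (x' - s) := by ext; ring
    rw [this]
    have h2 : (fun x' : ℝ => x' - s) =o[𝓝 s] (fun _ => (1:ℝ)) := by
      rw [Asymptotics.isLittleO_one_iff]
      have : Tendsto (fun x' : ℝ => x' - s) (𝓝 s) (𝓝 (s - s)) := by
        exact (continuous_id.sub continuous_const).tendsto s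
      simpa using this
    simpa using (h2.mul_isBigO (Asymptotics.isBigO_refl (fun x' : ℝ => x' - s) (𝓝 s)))
  exact is_const_of_deriv_eq_zero (fun s => (hd s).differentiableAt) (fun s => (hd s).deriv)

/-- Lipschitz sublinear function. -/
structure SubL {V : Type*} [NormedAddCommGroup V] [NormedSpace ℝ V] (f : V → ℝ) : Prop where
  add : ∀ x y, f (x + y) ≤ f x + f y
  smul : ∀ (a : ℝ) x, 0 ≤ a → f (a • x) = a * f x
  lip : ∃ K : ℝ, ∀ x y, |f x - f y| ≤ K * ‖x - y‖

noncomputable def DD {V : Type*} [NormedAddCommGroup V] [NormedSpace ℝ V] (f : V → ℝ) (X v : V) : ℝ :=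
  ⨅ l : ℝ, (f (l • X + v) - l * f X)

section
variable {V : Type*} [NormedAddCommGroup V] [NormedSpace ℝ V] {f : V → ℝ}

theorem SubL.zero (hf : SubL f) : f 0 = 0 := by
  have := hf.smul 0 0 le_rfl; simpa using this

theorem SubL.anti (hf : SubL f) (X v : V) : Antitone (fun l : ℝ => f (l • X + v) - l * f X) := by
  intro l l' h
  have h1 : l' • X + v = (l • X + v) + (l' - l) • X := by module
  have h2 := hf.add (l • X + v) ((l' - l) • X)
  rw [← h1, hf.smul _ _ (sub_nonneg.2 h)] at h2
  simp only
  linarith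

theorem SubL.lb (hf : SubL f) (X v : V) (l : ℝ) : - f (-v) ≤ f (l • X + v) - l * f X := by
  have h0 : -f (-v) ≤ f ((max l 0) • X + v) - (max l 0) * f X := by
    have := hf.add (max l 0 • X + v) (-v)
    rw [add_neg_cancel_right, hf.smul _ _ (le_max_right _ _)] at this
    linarith
  exact h0.trans (hf.anti X v (le_max_left l 0))

theorem SubL.bdd (hf : SubL f) (X v : V) : BddBelow (range fun l : ℝ => f (l • X + v) - l * f X) :=
  ⟨- f (-v), by rintro _ ⟨l, rfl⟩; exact hf.lb X v l⟩

theorem SubL.tendsto (hf : SubL f) (X v : V) :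
    Tendsto (fun l : ℝ => f (l • X + v) - l * f X) atTop (𝓝 (DD f X v)) :=
  tendsto_atTop_ciInf (hf.anti X v) (hf.bdd X v)

theorem SubL.tendsto' (hf : SubL f) (X v : V) {l : ℕ → ℝ} {w : ℕ → V} (hl : Tendsto l atTop atTop)
    (hw : Tendsto w atTop (𝓝 v)) :
    Tendsto (fun k => f (l k • X + w k) - l k * f X) atTop (𝓝 (DD f X v)) := by
  obtain ⟨K, hK⟩ := hf.lip
  have h1 := (hf.tendsto X v).comp hl
  have h2 : Tendsto (fun k => (f (l k • X + w k) - l k * f X) - (f (l k • X + v) - l k * f X)) atTop (𝓝 0) := by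
    apply squeeze_zero_norm (a := fun k => K * ‖w k - v‖)
    · intro k
      have := hK (l k • X + w k) (l k • X + v)
      rw [Real.norm_eq_abs]
      convert this using 2
      · ring
      · congr 1; abel_nf
    · have : Tendsto (fun k => K * ‖w k - v‖) atTop (𝓝 (K * ‖v - v‖)) :=
        ((hw.sub tendsto_const_nhds).norm).const_mul K
      simpa using this
  have := h2.add h1
  simpa using this

theorem SubL.DD_le (hf : SubL f) (X v : V) (l : ℝ) : DD f X v ≤ f (l • X + v) - l * f X :=
  ciInf_le (hf.bdd X v) l

theorem SubL.DD_le0 (hf : SubL f) (X v : V) : DD f X v ≤ f v := by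
  simpa using hf.DD_le X v 0

theorem SubL.DD_le1 (hf : SubL f) (X v : V) : DD f X v ≤ f (X + v) - f X := by
  simpa using hf.DD_le X v 1

theorem SubL.DD_add (hf : SubL f) (X v w : V) : DD f X (v + w) ≤ DD f X v + DD f X w := by
  have h1 := hf.tendsto X v
  have h2 := hf.tendsto X w
  have h3 : Tendsto (fun l : ℝ => 2 * l) atTop atTop := tendsto_id.const_mul_atTop two_pos
  have h4 := (hf.tendsto X (v + w)).comp h3
  refine le_of_tendsto_of_tendsto' h4 (h1.add h2) ?_
  intro l
  have := hf.add (l • X + v) (l • X + w)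
  have e : (2 * l) • X + (v + w) = (l • X + v) + (l • X + w) := by module
  simp only [Function.comp, e]
  linarith

theorem SubL.DD_smul (hf : SubL f) (X v : V) {a : ℝ} (ha : 0 ≤ a) : DD f X (a • v) = a * DD f X v := by
  rcases ha.eq_or_lt with rfl | ha
  · have : ∀ l : ℝ, 0 ≤ l → f (l • X + 0) - l * f X = 0 := by
      intro l hl; rw [add_zero, hf.smul _ _ hl]; ring
    have h2 : Tendsto (fun l : ℝ => f (l • X + 0) - l * f X) atTop (𝓝 0) := by
      apply tendsto_const_nhds.congr'
      filter_upwards [eventually_ge_atTop 0] with l hl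
      exact (this l hl).symm
    simpa using tendsto_nhds_unique (hf.tendsto X 0) h2
  · have h1 := (hf.tendsto X v).const_mul a
    have h3 : Tendsto (fun l : ℝ => a * l) atTop atTop := tendsto_id.const_mul_atTop ha
    have h4 := (hf.tendsto X (a • v)).comp h3
    refine tendsto_nhds_unique h4 (h1.congr ?_)
    intro l
    have e : (a * l) • X + a • v = a • (l • X + v) := by module
    simp only [Function.comp, e, hf.smul _ _ ha.le]
    ring

theorem SubL.DD_zero (hf : SubL f) (X : V) : DD f X 0 = 0 := by
  simpa using hf.DD_smul X 0 le_rfl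

theorem SubL.DD_self (hf : SubL f) (X : V) : DD f X X = f X := by
  refine tendsto_nhds_unique (hf.tendsto X X) ?_
  apply tendsto_const_nhds.congr'
  filter_upwards [eventually_ge_atTop 0] with l hl
  have e : l • X + X = (l + 1) • X := by module
  rw [e, hf.smul _ _ (by linarith)]; ring

theorem SubL.DD_neg_self (hf : SubL f) (X : V) : DD f X (-X) = - f X := by
  refine tendsto_nhds_unique (hf.tendsto X (-X)) ?_
  apply tendsto_const_nhds.congr'
  filter_upwards [eventually_ge_atTop 1] with l hl
  have e : l • X + -X = (l - 1) • X := by module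
  rw [e, hf.smul _ _ (by linarith)]; ring

theorem SubL.le_DD (hf : SubL f) {X v : V} {b : ℝ} (h : ∀ l : ℝ, 0 ≤ l → b ≤ f (l • X + v) - l * f X) :
    b ≤ DD f X v := by
  refine ge_of_tendsto (hf.tendsto X v) ?_
  filter_upwards [eventually_ge_atTop 0] with l hl using h l hl

/-- if linear minorants of `DD f X` are unique, it is linear -/
theorem SubL.linear (hf : SubL f) (X : V)
    (hu : ∀ ν ν' : V →ₗ[ℝ] ℝ, (∀ v, ν v ≤ DD f X v) → (∀ v, ν' v ≤ DD f X v) → ν = ν') :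
    ∃ ν : V →ₗ[ℝ] ℝ, ∀ v, ν v = DD f X v := by
  have key : ∀ v : V, ∃ ν : V →ₗ[ℝ] ℝ, (∀ w, ν w ≤ DD f X w) ∧ ν v = DD f X v := by
    intro v
    by_cases hv : v = 0
    · obtain ⟨g, hg1, hg2⟩ := exists_extension_of_le_sublinear (⟨⊥, 0⟩ : V →ₗ.[ℝ] ℝ) (DD f X)
        (fun c hc x => hf.DD_smul X x hc.le) (hf.DD_add X) (by
          rintro ⟨x, hx⟩
          have : x = 0 := by simpa using hx
          subst this; simp [hf.DD_zero])
      exact ⟨g, hg2, by rw [hv, hf.DD_zero]; simp⟩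
    · obtain ⟨g, hg1, hg2⟩ := exists_extension_of_le_sublinear
        (LinearPMap.mkSpanSingleton v (DD f X v) hv) (DD f X)
        (fun c hc x => hf.DD_smul X x hc.le) (hf.DD_add X) (by
          rintro ⟨x, hx⟩
          obtain ⟨t, rfl⟩ := Submodule.mem_span_singleton.1 hx
          rw [LinearPMap.mkSpanSingleton'_apply, smul_eq_mul, RingHom.id_apply]
          show _ ≤ DD f X (t • v)
          rcases le_total 0 t with ht | ht
          · rw [hf.DD_smul X v ht]
          · have h1 := hf.DD_smul X v (neg_nonneg.2 ht)
            have h2 := hf.DD_add X (t • v) ((-t) • v)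
            have e : t • v + (-t) • v = 0 := by module
            rw [e, hf.DD_zero, h1] at h2
            linarith)
      refine ⟨g, hg2, ?_⟩
      have := hg1 ⟨v, Submodule.mem_span_singleton_self v⟩
      rw [LinearPMap.mkSpanSingleton_apply] at this
      exact this
  obtain ⟨ν, h1, -⟩ := key 0
  refine ⟨ν, fun v => ?_⟩
  obtain ⟨ν', h1', h2'⟩ := key v
  rw [hu ν ν' h1 h1', h2']

/-- the gauge of a neighbourhood is SubL -/
theorem subL_gauge {s : Set V} (hc : Convex ℝ s) (h0 : s ∈ 𝓝 (0 : V)) : SubL (gauge s) := by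
  refine ⟨fun x y => gauge_add_le hc (absorbent_nhds_zero h0) x y, fun a x ha => ?_, ?_⟩
  · rw [gauge_smul_of_nonneg ha]; rfl
  · obtain ⟨K, this⟩ := hc.lipschitz_gauge h0
    refine ⟨K, fun x y => ?_⟩
    have h2 := this.dist_le_mul x y
    rw [Real.dist_eq, dist_eq_norm] at h2
    exact h2

theorem mem_iff_gauge {s : Set V} (hc : Convex ℝ s) (hcl : IsClosed s) (h0 : s ∈ 𝓝 (0 : V)) (x : V) :
    x ∈ s ↔ gauge s x ≤ 1 := by
  rw [gauge_le_one_iff_mem_closure hc h0, hcl.closure_eq]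

end
end

section
open Set Module Filter Topology

section
variable {E : Type*} [NormedAddCommGroup E] [InnerProductSpace ℝ E] [FiniteDimensional ℝ E]

/-- circle lemma -/
theorem circle_const {φ : ℝ → ℝ} {α : ℝ} (hper : ∀ t, φ (t + 2 * Real.pi) = φ t)
    (hpos : ∀ t, 0 < φ t) (hbd : ∃ C, ∀ t, φ t ≤ C)
    (h : ∀ s t, φ s * (Real.cos (t - s) + α * Real.sin (t - s)) ≤ φ t) : ∀ s t, φ s = φ t := by
  -- step 1 : α ≤ 0 for all such, apply twice
  have key : ∀ β : ℝ, ∀ ψ : ℝ → ℝ, (∀ t, ψ (t + 2 * Real.pi) = ψ t) → (∀ t, 0 < ψ t) →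
      (∀ s t, ψ s * (Real.cos (t - s) + β * Real.sin (t - s)) ≤ ψ t) → β ≤ 0 := by
    intro β ψ hp hpos h
    by_contra hβ
    push Not at hβ
    -- N large
    have h1 : ∀ᶠ x in 𝓝[>] (0:ℝ), 1 < Real.cos x + β * Real.sin x := by
      have hd : HasDerivAt (fun x => Real.cos x + β * Real.sin x) (-Real.sin 0 + β * Real.cos 0) 0 :=
        (Real.hasDerivAt_cos 0).add ((Real.hasDerivAt_sin 0).const_mul β)
      have hd' : HasDerivAt (fun x => Real.cos x + β * Real.sin x) β 0 := by simpa using hd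
      rw [hasDerivAt_iff_tendsto_slope] at hd'
      have h2 := hd'.eventually (lt_mem_nhds hβ)
      have h3 : ∀ᶠ x in 𝓝[>] (0:ℝ), 0 < slope (fun x => Real.cos x + β * Real.sin x) 0 x :=
        h2.filter_mono (nhdsWithin_mono _ (fun x hx => ne_of_gt hx))
      filter_upwards [h3, self_mem_nhdsWithin] with x hx hx0
      rw [slope_def_field] at hx
      have hx0' : 0 < x := hx0
      have := (div_pos_iff_of_pos_right (by linarith : 0 < x - 0)).1 hx
      simp at this
      linarith
    have h2 : Tendsto (fun N : ℕ => 2 * Real.pi / ((N:ℝ) + 1)) atTop (𝓝[>] 0) := by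
      refine tendsto_nhdsWithin_iff.2 ⟨?_, ?_⟩
      · have := tendsto_one_div_add_atTop_nhds_zero_nat (𝕜 := ℝ)
        have := this.const_mul (2 * Real.pi)
        simpa [div_eq_mul_inv] using this
      · exact Eventually.of_forall fun N => by
          have := Real.pi_pos
          simp only [mem_Ioi]; positivity
    obtain ⟨N, hN⟩ := (h2.eventually h1).exists
    set Δ := 2 * Real.pi / ((N:ℝ) + 1) with hΔ
    have step : ∀ k : ℕ, ψ 0 * (Real.cos Δ + β * Real.sin Δ) ^ k ≤ ψ (k * Δ) := by
      intro k
      induction k with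
      | zero => simp
      | succ k ih =>
        have := h (k * Δ) ((k + 1 : ℕ) * Δ)
        have e : ((k + 1 : ℕ) * Δ : ℝ) - k * Δ = Δ := by push_cast; ring
        rw [e] at this
        refine le_trans ?_ this
        rw [pow_succ, ← mul_assoc]
        exact mul_le_mul_of_nonneg_right ih (by linarith)
    have s := step (N + 1)
    have e : ((N + 1 : ℕ) * Δ : ℝ) = 0 + 2 * Real.pi := by
      rw [hΔ]; push_cast; field_simp; ring
    rw [e, hp] at s
    have : 1 < (Real.cos Δ + β * Real.sin Δ) ^ (N + 1) := one_lt_pow₀ hN (by omega)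
    nlinarith [hpos 0]
  have a1 : α ≤ 0 := key α φ hper hpos h
  have a2 : -α ≤ 0 := by
    refine key (-α) (fun t => φ (-t)) ?_ (fun t => hpos _) ?_
    · intro t
      have := hper (-(t + 2 * Real.pi))
      rw [← this]; congr 1; ring
    · intro s t
      have := h (-s) (-t)
      have e : -t - -s = -(t - s) := by ring
      rw [e, Real.cos_neg, Real.sin_neg] at this
      convert this using 2; ring
  have a0 : α = 0 := by linarith
  obtain ⟨C, hC⟩ := hbd
  refine quad_const (M := C / 2) ?_
  intro s t _
  have h1 := h s t
  rw [a0] at h1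
  have h2 := Real.one_sub_sq_div_two_le_cos (x := t - s)
  have h3 : φ s * (1 - (t - s)^2 / 2) ≤ φ s * Real.cos (t - s) := mul_le_mul_of_nonneg_left h2 (hpos s).le
  have h4 : φ s * ((t-s)^2/2) ≤ C * ((t-s)^2/2) := mul_le_mul_of_nonneg_right (hC s) (by positivity)
  nlinarith

/-- algebraic end of ELL -/
theorem ell_alg {g : E → ℝ} (hE : 2 ≤ finrank ℝ E) (hg : SubL g) (hpos : ∀ x, x ≠ 0 → 0 < g x)
    (B : E →ₗ[ℝ] E →ₗ[ℝ] ℝ) (hB : ∀ x, x ≠ 0 → 0 < B x x)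
    (h : ∀ x y, g x * B x y ≤ g y * B x x) :
    ∃ L : E ≃ₗ[ℝ] E, ∀ x, g x ^ 2 = ‖L x‖ ^ 2 := by
  -- symmetric part
  let Bs : LinearMap.BilinForm ℝ E := (1/2 : ℝ) • (B + B.flip)
  have hBs : ∀ x y, Bs x y = (B x y + B y x) / 2 := by
    intro x y; simp [Bs]; ring
  have hBsx : ∀ x, Bs x x = B x x := by intro x; rw [hBs]; ring
  have hsym : LinearMap.IsSymm Bs := ⟨fun x y => by simp only [hBs, RingHom.id_apply]; ring⟩
  -- two vectors
  have pair : ∀ a b : E, Bs a a = 1 → Bs b b = 1 → Bs a b = 0 → ∀ s t : ℝ,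
      g (Real.cos s • a + Real.sin s • b) = g (Real.cos t • a + Real.sin t • b) := by
    intro a b ha hb hab
    have hba : Bs b a = 0 := by rw [hBs] at hab ⊢; linarith
    have hne : ∀ t : ℝ, Bs (Real.cos t • a + Real.sin t • b) (Real.cos t • a + Real.sin t • b) = 1 := by
      intro t
      simp only [map_add, LinearMap.add_apply, map_smul, LinearMap.smul_apply, smul_eq_mul, ha, hb, hab, hba]
      nlinarith [Real.cos_sq_add_sin_sq t]
    have hx0 : ∀ t : ℝ, Real.cos t • a + Real.sin t • b ≠ 0 := by
      intro t h0; have := hne t; rw [h0] at this; simp at this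
    refine circle_const (α := B a b) (φ := fun t => g (Real.cos t • a + Real.sin t • b)) ?_ ?_ ?_ ?_
    · intro t; simp
    · intro t; exact hpos _ (hx0 t)
    · have hgc : Continuous g := by
        obtain ⟨K, hK⟩ := hg.lip
        have : LipschitzWith (Real.toNNReal K) g := LipschitzWith.of_dist_le' (fun x y => by
          rw [Real.dist_eq, dist_eq_norm]; exact hK x y)
        exact this.continuous
      refine ⟨g a + g (-a) + g b + g (-b), fun t => ?_⟩
      have gn : ∀ x, 0 ≤ g x := fun x => by
        by_cases hx : x = 0
        · rw [hx, hg.zero]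
        · exact (hpos x hx).le
      have hh : ∀ (c : ℝ) (x : E), |c| ≤ 1 → g (c • x) ≤ g x + g (-x) := by
        intro c x hc
        rw [abs_le] at hc
        rcases le_total 0 c with h0 | h0
        · rw [hg.smul _ _ h0]; nlinarith [gn x, gn (-x)]
        · have : c • x = (-c) • (-x) := by module
          rw [this, hg.smul _ _ (by linarith)]; nlinarith [gn x, gn (-x)]
      have h1 := hg.add (Real.cos t • a) (Real.sin t • b)
      have h2 := hh _ a (Real.abs_cos_le_one t)
      have h3 := hh _ b (Real.abs_sin_le_one t)
      show g _ ≤ _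
      linarith
    · intro s t
      have h1 := h (Real.cos s • a + Real.sin s • b) (Real.cos t • a + Real.sin t • b)
      rw [← hBsx, hne, mul_one] at h1
      refine le_trans (le_of_eq ?_) h1
      show g (Real.cos s • a + Real.sin s • b) * _ = _
      congr 1
      have e1 : B a a = 1 := by rw [← hBsx]; exact ha
      have e2 : B b b = 1 := by rw [← hBsx]; exact hb
      have e3 : B b a = - B a b := by rw [hBs] at hab; linarith
      simp only [map_add, LinearMap.add_apply, map_smul, LinearMap.smul_apply, smul_eq_mul, e1, e2, e3,
        Real.cos_sub, Real.sin_sub]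
      ring
  -- equality on unit vectors
  have hBs1 : ∀ x, x ≠ 0 → 0 < Bs x x := fun x hx => by rw [hBsx]; exact hB x hx
  have orth : ∀ a b : E, Bs a a = 1 → Bs b b = 1 → Bs a b = 0 → g a = g b := by
    intro a b ha hb hab
    have := pair a b ha hb hab 0 (Real.pi / 2)
    simpa using this
  -- orthogonal basis
  obtain ⟨v, hv⟩ := LinearMap.BilinForm.exists_orthogonal_basis (B := Bs) hsym
  have hv0 : ∀ i, 0 < Bs (v i) (v i) := fun i => hBs1 _ (v.ne_zero i)
  have hvij : ∀ i j, i ≠ j → Bs (v i) (v j) = 0 := fun i j hij => hv hij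
  let i0 : Fin (finrank ℝ E) := ⟨0, by omega⟩
  let i1 : Fin (finrank ℝ E) := ⟨1, by omega⟩
  -- general claim: any a b unit gives equal g
  have unit : ∀ a b : E, Bs a a = 1 → Bs b b = 1 → g a = g b := by
    intro a b ha hb
    -- vector z independent of a
    by_cases hz : ∃ t : ℝ, b = t • a
    · obtain ⟨t, rfl⟩ := hz
      have ht : t * t = 1 := by simpa [ha, mul_assoc] using hb
      -- find c orthogonal to a
      obtain ⟨c, hc, hac⟩ : ∃ c : E, c ≠ 0 ∧ Bs a c = 0 := by
        have hk : 0 < finrank ℝ (LinearMap.ker (Bs a)) := by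
          have h1 := LinearMap.finrank_range_add_finrank_ker (Bs a)
          have h2 : finrank ℝ (LinearMap.range (Bs a)) ≤ 1 := by
            have := Submodule.finrank_le (LinearMap.range (Bs a)); simpa using this
          omega
        obtain ⟨x, hx⟩ := Module.finrank_pos_iff_exists_ne_zero.1 hk
        exact ⟨x, by simpa using hx, x.2⟩
      have hcc := hBs1 c hc
      set c' := (1 / Real.sqrt (Bs c c)) • c
      have hc1 : Bs c' c' = 1 := by
        simp only [c', map_smul, LinearMap.smul_apply, smul_eq_mul]
        have := Real.mul_self_sqrt hcc.le
        have h3 : Real.sqrt (Bs c c) ≠ 0 := (Real.sqrt_pos.2 hcc).ne'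
        field_simp
        rw [sq, this]
      have hac' : Bs a c' = 0 := by simp [c', hac]
      rw [orth a c' ha hc1 hac']
      exact (orth (t • a) c' hb hc1 (by simp [hac'])).symm
    · push Not at hz
      set c := b - (Bs a b) • a with hc
      have hc0 : c ≠ 0 := fun h0 => hz (Bs a b) (sub_eq_zero.1 h0)
      have hcc := hBs1 c hc0
      have hac : Bs a c = 0 := by simp [hc, ha]
      set r := Real.sqrt (Bs c c) with hr
      have hr0 : 0 < r := Real.sqrt_pos.2 hcc
      have hrr : r * r = Bs c c := Real.mul_self_sqrt hcc.le
      have hc1 : Bs ((1/r) • c) ((1/r) • c) = 1 := by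
        simp only [map_smul, LinearMap.smul_apply, smul_eq_mul]
        rw [← hrr]; field_simp
      have hcos : (Bs a b)^2 + r^2 = 1 := by
        have e : b = c + (Bs a b) • a := by rw [hc]; module
        have hca : Bs c a = 0 := by rw [← hsym.eq]; simpa using hac
        have := hb
        have e2 : Bs b b = Bs (c + (Bs a b) • a) (c + (Bs a b) • a) := by rw [← e]
        rw [e2] at this
        simp only [map_add, LinearMap.add_apply, map_smul, LinearMap.smul_apply, smul_eq_mul, ha, hac, hca] at this
        rw [← hrr] at this
        nlinarith
      obtain ⟨θ, h1, h2⟩ : ∃ θ : ℝ, Real.cos θ = Bs a b ∧ Real.sin θ = r := by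
        refine ⟨Real.arccos (Bs a b), Real.cos_arccos (by nlinarith) (by nlinarith), ?_⟩
        rw [Real.sin_arccos, ← hcos]
        rw [add_sub_cancel_left, Real.sqrt_sq hr0.le]
      have := pair a ((1/r) • c) ha hc1 (by simp [hac]) 0 θ
      rw [h1, h2] at this
      have e : (Bs a b) • a + r • (1 / r) • c = b := by
        rw [smul_smul, mul_one_div_cancel hr0.ne', hc]; module
      rw [e] at this
      simpa using this
  -- constant
  let n0 : E := (1 / Real.sqrt (Bs (v i0) (v i0))) • v i0
  have normalize : ∀ c : E, c ≠ 0 → Bs ((1 / Real.sqrt (Bs c c)) • c) ((1 / Real.sqrt (Bs c c)) • c) = 1 := by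
    intro c hc
    have hcc := hBs1 c hc
    simp only [map_smul, LinearMap.smul_apply, smul_eq_mul]
    have := Real.mul_self_sqrt hcc.le
    have h3 : Real.sqrt (Bs c c) ≠ 0 := (Real.sqrt_pos.2 hcc).ne'
    field_simp
    rw [sq, this]
  have hn0 : Bs n0 n0 = 1 := normalize _ (v.ne_zero i0)
  set κ := g n0
  have hκ : 0 < κ := hpos _ (fun h0 => by rw [h0] at hn0; simp at hn0)
  have gx : ∀ x, g x = κ * Real.sqrt (Bs x x) := by
    intro x
    by_cases hx : x = 0
    · rw [hx, hg.zero]; simp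
    · have hs := Real.sqrt_pos.2 (hBs1 x hx)
      have h1 := unit _ n0 (normalize x hx) hn0
      rw [hg.smul _ _ (by positivity)] at h1
      show g x = g n0 * _
      rw [← h1]; field_simp
  -- L
  let w : Basis (Fin (finrank ℝ E)) ℝ E := (stdOrthonormalBasis ℝ E).toBasis
  let v' : Basis (Fin (finrank ℝ E)) ℝ E := v.isUnitSMul (w := fun i => 1 / (κ * Real.sqrt (Bs (v i) (v i))))
    (fun i => by
      have := Real.sqrt_pos.2 (hv0 i)
      exact isUnit_iff_ne_zero.2 (by positivity))
  have hv' : ∀ i, v' i = (1 / (κ * Real.sqrt (Bs (v i) (v i)))) • v i := fun i => by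
    simp [v', Basis.isUnitSMul_apply]
  have hv'1 : ∀ i, κ^2 * Bs (v' i) (v' i) = 1 := by
    intro i
    rw [hv']
    have hs := Real.sqrt_pos.2 (hv0 i)
    simp only [map_smul, LinearMap.smul_apply, smul_eq_mul]
    have := Real.mul_self_sqrt (hv0 i).le
    field_simp
    rw [sq, this]
  have hv'2 : ∀ i j, i ≠ j → Bs (v' i) (v' j) = 0 := by
    intro i j hij
    rw [hv', hv']; simp [hvij i j hij]
  let L : E ≃ₗ[ℝ] E := v'.equiv w (Equiv.refl _)
  refine ⟨L, fun x => ?_⟩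
  rw [gx, mul_pow, Real.sq_sqrt (by
    by_cases hx : x = 0
    · rw [hx]; simp
    · exact (hBs1 x hx).le)]
  have e1 : L x = ∑ i, v'.repr x i • w i := by
    conv_lhs => rw [← v'.sum_repr x]
    rw [map_sum]
    apply Finset.sum_congr rfl
    intro i _
    rw [map_smul]
    simp only [L, Basis.equiv_apply, Equiv.refl_apply]
  have e2 : ‖L x‖^2 = ∑ i, (v'.repr x i)^2 := by
    rw [(stdOrthonormalBasis ℝ E).sum_sq_norm_inner_right (x := L x) |>.symm]
    apply Finset.sum_congr rfl
    intro i _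
    rw [e1, inner_sum]
    simp [w, inner_smul_right, OrthonormalBasis.inner_eq_ite]
  rw [e2]
  conv_lhs => rw [← v'.sum_repr x]
  simp only [map_sum, LinearMap.sum_apply, map_smul, LinearMap.smul_apply, smul_eq_mul]
  rw [Finset.mul_sum]
  apply Finset.sum_congr rfl
  intro i _
  rw [Finset.sum_eq_single i]
  · have := hv'1 i
    calc _ = (v'.repr x i)^2 * (κ^2 * Bs (v' i) (v' i)) := by ring
      _ = _ := by rw [this, mul_one]
  · intro j _ hji
    first | rw [hv'2 j i hji] | rw [hv'2 i j hji.symm]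
    simp
  · simp

end
end

section
open Set Module Filter Topology
set_option linter.unusedSectionVars false

section
variable {E : Type*} [NormedAddCommGroup E] [InnerProductSpace ℝ E] [FiniteDimensional ℝ E]

theorem subL_slice {f : E × ℝ → ℝ} (hf : SubL f) : SubL (fun x : E => f (x, 0)) := by
  refine ⟨fun x y => ?_, fun a x ha => ?_, ?_⟩
  · have := hf.add (x, 0) (y, 0); simpa using this
  · have := hf.smul a (x, 0) ha; simpa using this
  · obtain ⟨K, hK⟩ := hf.lip
    refine ⟨K, fun x y => ?_⟩
    have := hK (x, 0) (y, 0)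
    simpa [Prod.norm_def] using this

theorem DD_slice (f : E × ℝ → ℝ) (x v : E) :
    DD f (x, 0) (v, 0) = DD (fun x : E => f (x, 0)) x v := by
  simp [DD]

theorem exists_dual_two {x y : E} (h : LinearIndependent ℝ ![x, y]) (a b : ℝ) :
    ∃ η : E →ₗ[ℝ] ℝ, η x = a ∧ η y = b := by
  have h' := h
  let bs := Basis.extend h.linearIndepOn_id
  let φ : E →ₗ[ℝ] ℝ := (Basis.span h).constr ℝ ![a, b] |>.exists_extend.choose
  have hφ := ((Basis.span h).constr ℝ ![a, b]).exists_extend.choose_spec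
  refine ⟨φ, ?_, ?_⟩
  · have h1 : φ x = ((Basis.span h).constr ℝ ![a, b]) (Basis.span h 0) := by
      rw [← hφ]; simp [φ, Basis.span_apply]
    rw [h1, Basis.constr_basis]; rfl
  · have h1 : φ y = ((Basis.span h).constr ℝ ![a, b]) (Basis.span h 1) := by
      rw [← hφ]; simp [φ, Basis.span_apply]
    rw [h1, Basis.constr_basis]; rfl

theorem ell_core {gA gB : E × ℝ → ℝ} (hE : 2 ≤ finrank ℝ E) (hA : SubL gA) (hB : SubL gB)
    (hAB : ∀ x, gA (x, 0) = gB (x, 0)) (hpos : ∀ x : E, x ≠ 0 → 0 < gA (x, 0))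
    (sA : ∀ x : E, ∀ t : ℝ, x ≠ 0 → 0 ≤ t → DD gA (x, 0) (0, t) ≤ 0)
    (sB : ∀ x : E, ∀ t : ℝ, x ≠ 0 → t ≤ 0 → DD gB (x, 0) (0, t) ≤ 0)
    (H : ∀ η : E →ₗ[ℝ] ℝ, ∃ γ : E, (∀ x, x ≠ 0 → DD gB (x, 0) (gA (x, 0) • γ, η x) = DD gA (x, 0) (0, η x)) ∧
      (∀ x, x ≠ 0 → DD gA (x, 0) (gA (x, 0) • (-γ), η x) = DD gB (x, 0) (0, η x)))
    (hcyl : ∀ η : E →ₗ[ℝ] ℝ, η ≠ 0 →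
      ¬ ∀ x, x ≠ 0 → DD gA (x, 0) (0, η x) = 0 ∧ DD gB (x, 0) (0, η x) = 0) :
    ∃ L : E ≃ₗ[ℝ] E, ∀ x, gA (x, 0) ^ 2 = ‖L x‖ ^ 2 := by
  choose γ hγ1 hγ2 using H
  set g : E → ℝ := fun x => gA (x, 0) with hg
  have gS : SubL g := subL_slice hA
  have gB' : (fun x : E => gB (x, 0)) = g := by ext x; exact (hAB x).symm
  have DgA : ∀ x v, DD gA (x, 0) (v, 0) = DD g x v := fun x v => DD_slice gA x v
  have DgB : ∀ x v, DD gB (x, 0) (v, 0) = DD g x v := fun x v => by rw [DD_slice, gB']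
  have gpos : ∀ x, x ≠ 0 → 0 < g x := hpos
  -- opposite signs
  have nonnegOf : ∀ (f : E × ℝ → ℝ), SubL f → ∀ x t, DD f (x, 0) (0, t) ≤ 0 → 0 ≤ DD f (x, 0) (0, -t) := by
    intro f hf x t h
    have := hf.DD_add (x, 0) (0, t) (0, -t)
    have e : ((0 : E), t) + (0, -t) = 0 := by ext <;> simp
    rw [e, hf.DD_zero] at this
    linarith
  have hγ0 : ∀ η : E →ₗ[ℝ] ℝ, η ≠ 0 → γ η ≠ 0 := by
    intro η hη h0
    refine hcyl η hη fun x hx => ?_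
    have h1 := hγ1 η x hx
    rw [h0, smul_zero] at h1
    rcases le_total 0 (η x) with h | h
    · have a1 := sA x (η x) hx h
      have a2 := nonnegOf gB hB x (-(η x)) (sB x _ hx (by linarith))
      rw [neg_neg] at a2
      constructor <;> linarith
    · have a1 := sB x (η x) hx h
      have a2 := nonnegOf gA hA x (-(η x)) (sA x _ hx (by linarith))
      rw [neg_neg] at a2
      constructor <;> linarith
  have hflat1 : ∀ η x, x ≠ 0 → η x = 0 → DD g x (γ η) = 0 := by
    intro η x hx h0
    have := hγ1 η x hx
    have z : DD gA (x, 0) (0, 0) = 0 := hA.DD_zero _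
    rw [h0, DgB, gS.DD_smul _ _ (gpos x hx).le, z] at this
    exact (mul_eq_zero.1 this).resolve_left (gpos x hx).ne'
  have hflat2 : ∀ η x, x ≠ 0 → η x = 0 → DD g x (-γ η) = 0 := by
    intro η x hx h0
    have := hγ2 η x hx
    have z : DD gB (x, 0) (0, 0) = 0 := hB.DD_zero _
    rw [h0, DgA, gS.DD_smul _ _ (gpos x hx).le, z] at this
    exact (mul_eq_zero.1 this).resolve_left (gpos x hx).ne'
  have hηγ : ∀ η : E →ₗ[ℝ] ℝ, η ≠ 0 → η (γ η) ≠ 0 := by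
    intro η hη h0
    have h1 := hflat1 η (γ η) (hγ0 η hη) h0
    rw [gS.DD_self] at h1
    exact (gpos _ (hγ0 η hη)).ne' h1
  -- smoothness
  have smooth : ∀ x, x ≠ 0 → ∃ ν : E →ₗ[ℝ] ℝ, ∀ v, ν v = DD g x v := by
    intro x hx
    refine gS.linear x fun ν ν' h h' => ?_
    by_contra hne
    have hxx : ∀ ν : E →ₗ[ℝ] ℝ, (∀ v, ν v ≤ DD g x v) → ν x = g x := by
      intro ν h
      have h1 := h x
      have h2 := h (-x)
      rw [gS.DD_self] at h1
      rw [gS.DD_neg_self, map_neg] at h2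
      linarith
    have hη : ν - ν' ≠ 0 := sub_ne_zero.2 hne
    have hηx : (ν - ν') x = 0 := by simp [hxx ν h, hxx ν' h']
    have f1 := hflat1 _ x hx hηx
    have f2 := hflat2 _ x hx hηx
    have z : ∀ ν : E →ₗ[ℝ] ℝ, (∀ v, ν v ≤ DD g x v) → ∀ y, DD g x y = 0 → DD g x (-y) = 0 → ν y = 0 := by
      intro ν h y a b
      have h1 := h y
      have h2 := h (-y)
      rw [map_neg] at h2
      linarith
    apply hηγ _ hη
    rw [LinearMap.sub_apply, z ν h _ f1 f2, z ν' h' _ f1 f2, sub_zero]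
  choose! ν hν using smooth
  have νle : ∀ x, x ≠ 0 → ∀ y, ν x y ≤ g y := fun x hx y => by rw [hν x hx]; exact gS.DD_le0 x y
  have νself : ∀ x, x ≠ 0 → ν x x = g x := fun x hx => by rw [hν x hx, gS.DD_self]
  have νuniq : ∀ x, x ≠ 0 → ∀ m : E →ₗ[ℝ] ℝ, (∀ v, m v ≤ g v) → m x = g x → m = ν x := by
    intro x hx m h1 h2
    have h3 : ∀ v, m v ≤ ν x v := by
      intro v
      rw [hν x hx]
      apply gS.le_DD
      intro l hl
      have := h1 (l • x + v)
      rw [map_add, map_smul, smul_eq_mul, h2] at this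
      linarith
    ext v
    have a := h3 v
    have b := h3 (-v)
    rw [map_neg, map_neg] at b
    linarith
  -- k
  let k : E → ℝ → ℝ := fun x t => (DD gB (x, 0) (0, t) - DD gA (x, 0) (0, t)) / g x
  have hk : ∀ η x, x ≠ 0 → ν x (γ η) = - k x (η x) := by
    intro η x hx
    have h1 := hγ1 η x hx
    change DD gB (x, 0) (g x • γ η, η x) = _ at h1
    have e1 : (g x • (γ η), η x) = (g x • γ η, (0:ℝ)) + ((0 : E), η x) := by ext <;> simp
    have e2 : ((0 : E), η x) = (g x • γ η, η x) + (-(g x • γ η), (0:ℝ)) := by ext <;> simp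
    have a := hB.DD_add (x, 0) (g x • γ η, (0:ℝ)) ((0 : E), η x)
    have b := hB.DD_add (x, 0) (g x • γ η, η x) (-(g x • γ η), (0:ℝ))
    rw [← e1, DgB, ← hν x hx, map_smul, smul_eq_mul] at a
    rw [← e2, DgB, ← hν x hx, map_neg, map_smul, smul_eq_mul] at b
    have gx := gpos x hx
    simp only [k]
    rw [eq_neg_iff_add_eq_zero, ← mul_right_inj' gx.ne', mul_add, mul_div_cancel₀ _ gx.ne']
    linarith
  have ksmul : ∀ x (a t : ℝ), 0 ≤ a → k x (a * t) = a * k x t := by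
    intro x a t ha
    have e : ((0 : E), a * t) = a • ((0 : E), t) := by simp
    simp only [k]
    rw [e, hA.DD_smul _ _ ha, hB.DD_smul _ _ ha]; ring
  have kne : ∀ x t, x ≠ 0 → t ≠ 0 → k x t ≠ 0 := by
    intro x t hx ht h0
    have gx := gpos x hx
    let η : E →ₗ[ℝ] ℝ := (t / g x) • ν x
    have hηx : η x = t := by simp [η, νself x hx, gx.ne']
    have hη : η ≠ 0 := fun h => ht (by rw [← hηx, h]; rfl)
    have := hk η x hx
    rw [hηx, h0, neg_zero] at this
    exact hηγ η hη (by simp [η, this])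
  have kpos : ∀ x, x ≠ 0 → 0 < k x 1 := by
    intro x hx
    refine lt_of_le_of_ne ?_ (kne x 1 hx one_ne_zero).symm
    have a1 := sA x 1 hx zero_le_one
    have a2 := nonnegOf gB hB x (-1) (sB x _ hx (by norm_num))
    rw [neg_neg] at a2
    simp only [k]
    exact div_nonneg (by linarith) (gpos x hx).le
  -- additivity
  have gcont : Continuous g := by
    obtain ⟨K, hK⟩ := gS.lip
    have : LipschitzWith (Real.toNNReal K) g := LipschitzWith.of_dist_le' (fun x y => by
      rw [Real.dist_eq, dist_eq_norm]; exact hK x y)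
    exact this.continuous
  have addl : ∀ (η₁ η₂ : E →ₗ[ℝ] ℝ) (x : E), 0 < η₁ x → 0 < η₂ x → γ (η₁ + η₂) = γ η₁ + γ η₂ := by
    intro η₁ η₂ x h1 h2
    by_contra hne
    set e := γ (η₁ + η₂) - (γ η₁ + γ η₂) with he
    have he0 : e ≠ 0 := sub_ne_zero.2 hne
    have hflat : ∀ y, 0 < η₁ y → 0 < η₂ y → ν y e = 0 := by
      intro y h1 h2
      have hy : y ≠ 0 := by rintro rfl; simp at h1
      rw [he, map_sub, map_add, hk _ y hy, hk _ y hy, hk _ y hy]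
      have c1 := ksmul y (η₁ y) 1 h1.le
      have c2 := ksmul y (η₂ y) 1 h2.le
      have c3 := ksmul y (η₁ y + η₂ y) 1 (by linarith)
      rw [mul_one] at c1 c2 c3
      rw [LinearMap.add_apply, c1, c2, c3]; ring
    obtain ⟨u, hu0, hu1, hu2⟩ : ∃ u : ℝ, 0 < u ∧ 0 < η₁ (x + u • e) ∧ 0 < η₂ (x + u • e) := by
      have t1 : Tendsto (fun u : ℝ => η₁ (x + u • e)) (𝓝 0) (𝓝 (η₁ (x + (0:ℝ) • e))) := by
        have : Continuous (fun u : ℝ => η₁ (x + u • e)) := by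
          simp only [map_add, map_smul]; fun_prop
        exact this.tendsto 0
      have t2 : Tendsto (fun u : ℝ => η₂ (x + u • e)) (𝓝 0) (𝓝 (η₂ (x + (0:ℝ) • e))) := by
        have : Continuous (fun u : ℝ => η₂ (x + u • e)) := by
          simp only [map_add, map_smul]; fun_prop
        exact this.tendsto 0
      have e1 := t1.eventually (lt_mem_nhds (by simpa using h1 : (0:ℝ) < _))
      have e2 := t2.eventually (lt_mem_nhds (by simpa using h2 : (0:ℝ) < _))
      have e3 : ∀ᶠ u in 𝓝[>] (0:ℝ), 0 < η₁ (x + u • e) ∧ 0 < η₂ (x + u • e) ∧ 0 < u := by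
        filter_upwards [e1.filter_mono nhdsWithin_le_nhds, e2.filter_mono nhdsWithin_le_nhds,
          self_mem_nhdsWithin] with u a b c using ⟨a, b, c⟩
      obtain ⟨u, a, b, c⟩ := e3.exists
      exact ⟨u, c, a, b⟩
    have hx : x ≠ 0 := by rintro rfl; simp at h1
    set y := x + u • e with hy
    have hy0 : y ≠ 0 := by intro h; rw [h] at hu1; simp at hu1
    have fx := hflat x h1 h2
    have fy := hflat y hu1 hu2
    have gxy : g x ≤ g y := by
      have := νle x hx y
      rw [hy, map_add, map_smul, fx, νself x hx] at this
      simpa using this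
    have gyx : g y ≤ g x := by
      have := νle y hy0 x
      have e : x = y - u • e := by rw [hy]; abel
      rw [e, map_sub, map_smul, fy, νself y hy0, ← e] at this
      simpa using this
    have hxy : ν x = ν y := by
      refine νuniq y hy0 (ν x) (νle x hx) ?_
      rw [hy, map_add, map_smul, fx, νself x hx]
      simp only [smul_zero, add_zero]
      exact le_antisymm gxy gyx
    have hind : LinearIndependent ℝ ![x, y] := by
      rw [LinearIndependent.pair_iff' hx]
      intro a ha
      have h1 : a * g x = g x := by
        have := congrArg (ν x) ha
        rw [map_smul, νself x hx, hy, map_add, map_smul, fx, νself x hx] at this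
        simpa using this
      have h2 : a = 1 := by
        have := gpos x hx
        field_simp at h1; exact h1
      rw [h2, one_smul, hy] at ha
      have : u • e = 0 := by simpa using ha
      exact he0 ((smul_eq_zero.1 this).resolve_left hu0.ne')
    obtain ⟨η, ex, ey⟩ := exists_dual_two hind 0 1
    have a := hk η x hx
    have b := hk η y hy0
    rw [ex] at a
    rw [ey, ← hxy, a] at b
    have : k x 0 = 0 := by have := ksmul x 0 0 le_rfl; simpa using this
    rw [this] at b
    exact kne y 1 hy0 one_ne_zero (by linarith)
  -- k odd
  have kodd : ∀ x, x ≠ 0 → k x (-1) = - k x 1 := by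
    intro x hx
    obtain ⟨y, hy⟩ : ∃ y, LinearIndependent ℝ ![x, y] := by
      have h1 : (Submodule.span ℝ {x}) ≠ ⊤ := by
        intro h
        have := finrank_span_singleton (K := ℝ) hx
        rw [h, finrank_top] at this
        omega
      obtain ⟨y, hy⟩ := SetLike.exists_not_mem_of_ne_top _ h1
      refine ⟨y, (LinearIndependent.pair_iff' hx).2 fun a ha => hy ?_⟩
      exact Submodule.mem_span_singleton.2 ⟨a, ha⟩
    obtain ⟨η₁, a1, a2⟩ := exists_dual_two hy 2 1
    obtain ⟨η₂, b1, b2⟩ := exists_dual_two hy (-1) 1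
    have := addl η₁ η₂ y (by rw [a2]; norm_num) (by rw [b2]; norm_num)
    have h1 := congrArg (ν x) this
    rw [map_add, hk _ x hx, hk _ x hx, hk _ x hx, LinearMap.add_apply, a1, b1] at h1
    have h2 := ksmul x 2 1 (by norm_num)
    rw [mul_one] at h2
    norm_num at h1
    linarith
  have klin : ∀ x t, x ≠ 0 → k x t = t * k x 1 := by
    intro x t hx
    rcases le_total 0 t with h | h
    · have := ksmul x t 1 h; simpa using this
    · have := ksmul x (-t) (-1) (by linarith)
      rw [kodd x hx] at this
      have e : -t * -1 = t := by ring
      rw [e] at this; linarith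
  have νγ : ∀ η x, x ≠ 0 → ν x (γ η) = - (η x * k x 1) := fun η x hx => by rw [hk η x hx, klin x _ hx]
  have zeroOf : ∀ y : E, (∀ x, x ≠ 0 → ν x y = 0) → y = 0 := by
    intro y h
    by_contra hy
    have := h y hy
    rw [νself y hy] at this
    exact (gpos y hy).ne' this
  let Γ : (E →ₗ[ℝ] ℝ) →ₗ[ℝ] E :=
    { toFun := γ
      map_add' := fun η₁ η₂ => by
        refine sub_eq_zero.1 (zeroOf _ fun x hx => ?_)
        rw [map_sub, map_add, νγ _ x hx, νγ _ x hx, νγ _ x hx, LinearMap.add_apply]; ring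
      map_smul' := fun a η => by
        refine sub_eq_zero.1 (zeroOf _ fun x hx => ?_)
        simp only [RingHom.id_apply]
        rw [map_sub, map_smul, νγ _ x hx, νγ _ x hx, LinearMap.smul_apply, smul_eq_mul, smul_eq_mul]; ring }
  have Γinj : Function.Injective Γ := by
    rw [← LinearMap.ker_eq_bot, LinearMap.ker_eq_bot']
    intro η h
    by_contra hη
    exact hγ0 η hη h
  have hfr : finrank ℝ (E →ₗ[ℝ] ℝ) = finrank ℝ E := Subspace.dual_finrank_eq
  let Γe : (E →ₗ[ℝ] ℝ) ≃ₗ[ℝ] E := LinearEquiv.ofInjectiveOfFinrankEq Γ Γinj hfr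
  have hΓe : ∀ η, Γe η = γ η := fun η => rfl
  let Bf : E →ₗ[ℝ] E →ₗ[ℝ] ℝ := (-(Γe.symm : E →ₗ[ℝ] (E →ₗ[ℝ] ℝ))).flip
  have hBf : ∀ x y, Bf x y = - (Γe.symm y) x := fun x y => by simp [Bf]
  have νB : ∀ x y, x ≠ 0 → ν x y = k x 1 * Bf x y := by
    intro x y hx
    have := νγ (Γe.symm y) x hx
    rw [← hΓe, LinearEquiv.apply_symm_apply] at this
    rw [this, hBf]; ring
  have Bpos : ∀ x, x ≠ 0 → 0 < Bf x x := by
    intro x hx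
    have := νB x x hx
    rw [νself x hx] at this
    have h1 := gpos x hx
    rw [this] at h1
    exact (pos_iff_pos_of_mul_pos h1).1 (kpos x hx)
  refine ell_alg hE gS gpos Bf Bpos ?_
  intro x y
  show g x * Bf x y ≤ g y * Bf x x
  by_cases hx : x = 0
  · rw [hx, gS.zero]; simp
  · have h1 := νle x hx y
    have h2 := νB x x hx
    rw [νself x hx] at h2
    rw [νB x y hx] at h1
    rw [h2]
    have := mul_le_mul_of_nonneg_right h1 (Bpos x hx).le
    linarith

end
end

section
open Set Module Filter Topology
set_option linter.unusedSectionVars false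

section
variable {E : Type*} [NormedAddCommGroup E] [InnerProductSpace ℝ E] [FiniteDimensional ℝ E]

theorem one_div_mul_le_iff' {b x y : ℝ} (hb : 0 < b) : 1 / b * x ≤ y ↔ x ≤ y * b := by
  rw [one_div_mul_eq_div, div_le_iff₀ hb]

theorem SubL.continuous {V : Type*} [NormedAddCommGroup V] [NormedSpace ℝ V] {f : V → ℝ}
    (hf : SubL f) : Continuous f := by
  obtain ⟨K, hK⟩ := hf.lip
  have : LipschitzWith (Real.toNNReal K) f := LipschitzWith.of_dist_le' (fun x y => by
    rw [Real.dist_eq, dist_eq_norm]; exact hK x y)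
  exact this.continuous

theorem ell_pt {A B : Set (E × ℝ)} (Ac : Convex ℝ A) (Acl : IsClosed A) (A0 : A ∈ 𝓝 0)
    (Bc : Convex ℝ B) (Bcl : IsClosed B) (B0 : B ∈ 𝓝 0) (η : E →ₗ[ℝ] ℝ) {ε : ℝ} {c : E}
    (h : ∀ w, (w, ε * η w) ∈ A ↔ (w + c, ε * η (w + c)) ∈ B) {w : E} (hw : gauge A (w, ε * η w) = 1) :
    gauge B (w + c, ε * η (w + c)) = 1 := by
  have h1 : gauge B (w + c, ε * η (w + c)) ≤ 1 := by
    rw [← mem_iff_gauge Bc Bcl B0, ← h, mem_iff_gauge Ac Acl A0, hw]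
  refine le_antisymm h1 ?_
  by_contra hlt
  push Not at hlt
  have hη : Continuous η := η.continuous_of_finiteDimensional
  have hcont : Continuous (fun θ : ℝ => gauge B ((1 + θ) • w + c, ε * η ((1 + θ) • w + c))) :=
    (subL_gauge Bc B0).continuous.comp (by fun_prop)
  have ht := hcont.tendsto 0
  simp only [add_zero, one_smul] at ht
  have h2 := (ht.eventually (gt_mem_nhds hlt)).filter_mono (nhdsWithin_le_nhds (s := Ioi 0))
  obtain ⟨θ, h3, h4⟩ := (h2.and self_mem_nhdsWithin).exists
  have h5 : (((1 + θ) • w), ε * η ((1 + θ) • w)) ∈ A := by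
    rw [h, mem_iff_gauge Bc Bcl B0]; exact h3.le
  rw [mem_iff_gauge Ac Acl A0] at h5
  have e : (((1 + θ) • w), ε * η ((1 + θ) • w)) = (1 + θ) • (w, ε * η w) := by
    ext <;> simp; ring
  have h4' : (0:ℝ) < θ := h4
  rw [e, (subL_gauge Ac A0).smul _ _ (by linarith), hw] at h5
  linarith

theorem ell_transfer {A B : Set (E × ℝ)} (Ac : Convex ℝ A) (Acl : IsClosed A) (A0 : A ∈ 𝓝 0)
    (Bc : Convex ℝ B) (Bcl : IsClosed B) (B0 : B ∈ 𝓝 0) (η : E →ₗ[ℝ] ℝ) {ε : ℕ → ℝ} {c : ℕ → E} {γ : E}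
    (hε : ∀ k, 0 < ε k) (hε0 : Tendsto ε atTop (𝓝 0))
    (h : ∀ k w, (w, ε k * η w) ∈ A ↔ (w + c k, ε k * η (w + c k)) ∈ B)
    (hc : Tendsto (fun k => (1 / ε k) • c k) atTop (𝓝 γ)) {x : E}
    (hx : 0 < gauge A (x, 0)) (hAB : gauge A (x, 0) = gauge B (x, 0)) :
    DD (gauge B) (x, 0) (gauge A (x, 0) • γ, η x) = DD (gauge A) (x, 0) (0, η x) := by
  have sA := subL_gauge Ac A0
  have sB := subL_gauge Bc B0
  have hη : Continuous η := η.continuous_of_finiteDimensional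
  set a : ℕ → ℝ := fun k => gauge A (x, ε k * η x) with ha
  have hat : Tendsto a atTop (𝓝 (gauge A (x, 0))) := by
    have h1 : Tendsto (fun k => (x, ε k * η x)) atTop (𝓝 (x, 0)) := by
      refine tendsto_const_nhds.prodMk_nhds ?_
      simpa using hε0.mul_const (η x)
    exact (sA.continuous.tendsto _).comp h1
  have hl : Tendsto (fun k => 1 / ε k) atTop atTop := by
    simp only [one_div]
    exact tendsto_inv_nhdsGT_zero.comp (tendsto_nhdsWithin_iff.2 ⟨hε0, Eventually.of_forall hε⟩)
  have hc0 : Tendsto c atTop (𝓝 0) := by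
    have := hε0.smul hc
    rw [zero_smul] at this
    refine this.congr fun k => ?_
    rw [smul_smul, mul_one_div_cancel (hε k).ne', one_smul]
  have hw : Tendsto (fun k => (a k • (1 / ε k) • c k, η x + a k * η (c k))) atTop
      (𝓝 (gauge A (x, 0) • γ, η x)) := by
    refine (hat.smul hc).prodMk_nhds ?_
    have h1 : Tendsto (fun k => η (c k)) atTop (𝓝 0) := by
      have := (hη.tendsto 0).comp hc0; simpa [Function.comp_def] using this
    have := (tendsto_const_nhds (x := η x)).add (hat.mul h1)
    simpa using this
  have t1 := sB.tendsto' (x, 0) _ hl hw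
  have t2 := sA.tendsto' (x, 0) (0, η x) hl tendsto_const_nhds
  refine tendsto_nhds_unique_of_eventuallyEq t1 t2 ?_
  filter_upwards [hat.eventually (lt_mem_nhds hx)] with k hk
  have h1 : gauge A ((1 / a k) • x, ε k * η ((1 / a k) • x)) = 1 := by
    have e : ((1 / a k) • x, ε k * η ((1 / a k) • x)) = (1 / a k) • (x, ε k * η x) := by
      ext <;> simp; ring
    rw [e, sA.smul _ _ (by positivity)]
    exact one_div_mul_cancel hk.ne'
  have h2 := ell_pt Ac Acl A0 Bc Bcl B0 η (h k) h1
  have hεk := hε k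
  have e1 : (1 / ε k) • (x, (0:ℝ)) + (a k • (1 / ε k) • c k, η x + a k * η (c k)) =
      (a k / ε k) • ((1 / a k) • x + c k, ε k * η ((1 / a k) • x + c k)) := by
    ext
    · simp only [Prod.smul_mk, Prod.mk_add_mk]
      rw [smul_add, smul_smul, smul_smul]
      congr 2
      · field_simp
      · ring
    · simp only [Prod.smul_mk, Prod.mk_add_mk, map_add, map_smul, smul_eq_mul]
      field_simp
      ring
  have e2 : (1 / ε k) • (x, (0:ℝ)) + ((0 : E), η x) = (1 / ε k) • (x, ε k * η x) := by
    ext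
    · simp
    · simp; field_simp
  rw [e1, e2, sB.smul _ _ (by positivity), h2, sA.smul _ _ (by positivity), hAB]
  show a k / ε k * 1 - _ = 1 / ε k * a k - _
  ring

theorem ELL {A B : Set (E × ℝ)} (hE : 2 ≤ finrank ℝ E) (Ac : Convex ℝ A) (Acl : IsClosed A) (A0 : A ∈ 𝓝 0)
    (Bc : Convex ℝ B) (Bcl : IsClosed B) (B0 : B ∈ 𝓝 0)
    (hS : ∀ x : E, (x, (0:ℝ)) ∈ A ↔ (x, (0:ℝ)) ∈ B) {R : ℝ} (hR : ∀ x : E, (x, (0:ℝ)) ∈ A → ‖x‖ ≤ R)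
    {T : ℝ} (hT : 0 < T) (hAT : ∀ x : E, (x, (0:ℝ)) ∈ A → (x, T) ∈ A)
    (hBT : ∀ x : E, (x, (0:ℝ)) ∈ B → (x, -T) ∈ B)
    (H : ∀ η : E →ₗ[ℝ] ℝ, ∃ ε0 > 0, ∀ ε, 0 < ε → ε < ε0 → ∃ c, ∀ w,
      (w, ε * η w) ∈ A ↔ (w + c, ε * η (w + c)) ∈ B)
    (hcyl : ∀ η : E →ₗ[ℝ] ℝ, η ≠ 0 → ¬ ((∀ x : E, ∀ t : ℝ, 0 ≤ t → 0 < η x → (x, t) ∈ A → (x, (0:ℝ)) ∈ A) ∧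
      (∀ x : E, ∀ t : ℝ, 0 ≤ t → η x < 0 → (x, -t) ∈ B → (x, (0:ℝ)) ∈ B))) :
    ∃ L : E ≃ₗ[ℝ] E, ∀ x : E, (x, (0:ℝ)) ∈ A ↔ ‖L x‖ ≤ 1 := by
  have sA := subL_gauge Ac A0
  have sB := subL_gauge Bc B0
  have mA := mem_iff_gauge Ac Acl A0
  have mB := mem_iff_gauge Bc Bcl B0
  have gnA : ∀ x, 0 ≤ gauge A x := fun x => gauge_nonneg x
  have gnB : ∀ x, 0 ≤ gauge B x := fun x => gauge_nonneg x
  -- slices agree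
  have hAB' : ∀ (A B : Set (E × ℝ)), Convex ℝ A → IsClosed A → A ∈ 𝓝 0 → Convex ℝ B → IsClosed B → B ∈ 𝓝 0 →
      (∀ x : E, (x, (0:ℝ)) ∈ A ↔ (x, (0:ℝ)) ∈ B) → ∀ x : E, gauge A (x, 0) ≤ gauge B (x, 0) := by
    intro A B Ac Acl A0 Bc Bcl B0 hS x
    have sA := subL_gauge Ac A0
    have sB := subL_gauge Bc B0
    refine le_of_forall_pos_le_add fun ε hε => ?_
    set b := gauge B (x, 0) + ε with hb
    have hb0 : 0 < b := by have := gauge_nonneg (s := B) (x, (0:ℝ)); linarith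
    have h1 : ((1 / b) • x, (0:ℝ)) ∈ B := by
      rw [mem_iff_gauge Bc Bcl B0]
      have e : ((1 / b) • x, (0:ℝ)) = (1 / b) • (x, (0:ℝ)) := by ext <;> simp
      rw [e, sB.smul _ _ (by positivity), one_div_mul_le_iff' hb0]
      linarith
    rw [← hS, mem_iff_gauge Ac Acl A0] at h1
    have e : ((1 / b) • x, (0:ℝ)) = (1 / b) • (x, (0:ℝ)) := by ext <;> simp
    rw [e, sA.smul _ _ (by positivity), one_div_mul_le_iff' hb0] at h1
    linarith
  have hAB : ∀ x : E, gauge A (x, 0) = gauge B (x, 0) := fun x => le_antisymm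
    (hAB' A B Ac Acl A0 Bc Bcl B0 hS x) (hAB' B A Bc Bcl B0 Ac Acl A0 (fun x => (hS x).symm) x)
  have R0 : 0 ≤ R := (norm_nonneg (0:E)).trans (hR 0 (mem_of_mem_nhds A0))
  have hnorm : ∀ x : E, ‖x‖ ≤ (R + 1) * gauge A (x, 0) := by
    intro x
    refine le_of_forall_pos_le_add fun ε hε => ?_
    set b := gauge A (x, 0) + ε / (R + 1) with hb
    have hb0 : 0 < b := by have := gnA (x, (0:ℝ)); positivity
    have h1 : ((1 / b) • x, (0:ℝ)) ∈ A := by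
      rw [mA]
      have e : ((1 / b) • x, (0:ℝ)) = (1 / b) • (x, (0:ℝ)) := by ext <;> simp
      rw [e, sA.smul _ _ (by positivity), one_div_mul_le_iff' hb0]
      have : 0 < ε / (R + 1) := by positivity
      linarith
    have h2 := hR _ h1
    rw [norm_smul, Real.norm_of_nonneg (by positivity), one_div_mul_le_iff' hb0] at h2
    have : (R + 1) * b = (R + 1) * gauge A (x, 0) + ε := by rw [hb]; field_simp
    nlinarith
  have hpos : ∀ x : E, x ≠ 0 → 0 < gauge A (x, 0) := by
    intro x hx
    have := hnorm x
    have h2 := norm_pos_iff.2 hx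
    by_contra h
    have : gauge A (x, 0) = 0 := le_antisymm (not_lt.1 h) (gnA _)
    have h3 := hnorm x
    rw [this] at h3
    nlinarith
  have unitS : ∀ x : E, x ≠ 0 → ((1 / gauge A (x, 0)) • x, (0:ℝ)) ∈ A := by
    intro x hx
    have e : ((1 / gauge A (x, 0)) • x, (0:ℝ)) = (1 / gauge A (x, 0)) • (x, (0:ℝ)) := by ext <;> simp
    rw [mA, e, sA.smul _ _ (by have := hpos x hx; positivity), one_div_mul_cancel (hpos x hx).ne']
  -- sign lemma
  have sgn : ∀ (C : Set (E × ℝ)) (_ : Convex ℝ C) (_ : IsClosed C) (_ : C ∈ 𝓝 0) (τ : ℝ) (x : E), x ≠ 0 →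
      gauge C (x, 0) = gauge A (x, 0) →
      ((1 / gauge A (x, 0)) • x, τ) ∈ C → DD (gauge C) (x, 0) (0, τ) ≤ 0 := by
    intro C Cc Ccl C0 τ x hx hg hm
    have sC := subL_gauge Cc C0
    have hp := hpos x hx
    rw [mem_iff_gauge Cc Ccl C0] at hm
    have h1 := sC.DD_le (x, 0) (0, τ) (1 / gauge A (x, 0))
    have e : (1 / gauge A (x, 0)) • (x, (0:ℝ)) + ((0:E), τ) = ((1 / gauge A (x, 0)) • x, τ) := by
      ext <;> simp
    rw [e, hg, one_div_mul_cancel hp.ne'] at h1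
    linarith
  have scale : ∀ (C : Set (E × ℝ)) (_ : Convex ℝ C) (_ : C ∈ 𝓝 0) (x : E) (τ t : ℝ), 0 ≤ t →
      DD (gauge C) (x, 0) (0, t * τ) = t * DD (gauge C) (x, 0) (0, τ) := by
    intro C Cc C0 x τ t ht
    have := (subL_gauge Cc C0).DD_smul (x, 0) (0, τ) ht
    rw [← this]; simp
  have hsA : ∀ x : E, ∀ t : ℝ, x ≠ 0 → 0 ≤ t → DD (gauge A) (x, 0) (0, t) ≤ 0 := by
    intro x t hx ht
    have h1 := sgn A Ac Acl A0 T x hx rfl (hAT _ (unitS x hx))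
    have h2 := scale A Ac A0 x T (t / T) (by positivity)
    rw [div_mul_cancel₀ _ hT.ne'] at h2
    rw [h2]
    exact mul_nonpos_of_nonneg_of_nonpos (by positivity) h1
  have hsB : ∀ x : E, ∀ t : ℝ, x ≠ 0 → t ≤ 0 → DD (gauge B) (x, 0) (0, t) ≤ 0 := by
    intro x t hx ht
    have h1 := sgn B Bc Bcl B0 (-T) x hx (hAB x).symm (hBT _ ((hS _).1 (unitS x hx)))
    have h2 := scale B Bc B0 x (-T) (-t / T) (div_nonneg (by linarith) hT.le)
    have e : -t / T * -T = t := by field_simp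
    rw [e] at h2
    rw [h2]
    exact mul_nonpos_of_nonneg_of_nonpos (div_nonneg (by linarith) hT.le) h1
  -- main
  have main := ell_core hE sA sB hAB hpos hsA hsB ?_ ?_
  · obtain ⟨L, hL⟩ := main
    refine ⟨L, fun x => ?_⟩
    rw [mA, ← abs_of_nonneg (gnA _), ← abs_norm (L x), ← sq_le_sq₀ (abs_nonneg _) zero_le_one,
      ← sq_le_sq₀ (abs_nonneg _) zero_le_one, sq_abs, sq_abs, hL]
  · intro η
    have hη : Continuous η := η.continuous_of_finiteDimensional
    obtain ⟨ε0, hε0, Hε⟩ := H η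
    obtain ⟨K1, hK1⟩ := sA.lip
    obtain ⟨K2, hK2⟩ := sB.lip
    set K := |K1| + |K2| with hK
    have Kn : 0 ≤ K := by positivity
    obtain ⟨N, hN0, hN⟩ : ∃ N : ℝ, 0 ≤ N ∧ ∀ x, |η x| ≤ N * ‖x‖ := by
      refine ⟨‖LinearMap.toContinuousLinearMap η‖, norm_nonneg _, fun x => ?_⟩
      exact (LinearMap.toContinuousLinearMap η).le_opNorm x
    have lipA : ∀ (x : E) (t : ℝ), |gauge A (x, t) - gauge A (x, 0)| ≤ K * |t| := by
      intro x t
      have := hK1 (x, t) (x, 0)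
      simp [Prod.norm_def] at this
      refine this.trans (mul_le_mul_of_nonneg_right ?_ (abs_nonneg t))
      have := le_abs_self K1; have := abs_nonneg K2; linarith
    have lipB : ∀ (x : E) (t : ℝ), |gauge B (x, t) - gauge A (x, 0)| ≤ K * |t| := by
      intro x t
      have := hK2 (x, t) (x, 0)
      rw [hAB]
      simp [Prod.norm_def] at this
      refine this.trans (mul_le_mul_of_nonneg_right ?_ (abs_nonneg t))
      have := le_abs_self K2; have := abs_nonneg K1; linarith
    set Q := K * N * (R + 1) with hQ
    have Q0 : 0 ≤ Q := by positivity
    have bound : ∀ ε c, 0 < ε → ε * Q ≤ 1 / 2 →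
        (∀ w, (w, ε * η w) ∈ A ↔ (w + c, ε * η (w + c)) ∈ B) → ‖c‖ ≤ (R + 1) * (8 * Q * ε) := by
      intro ε c hε hεQ h
      by_cases hc : c = 0
      · rw [hc, norm_zero]; positivity
      have gc := hpos c hc
      set g := gauge A (c, 0) with hg
      set a := gauge A (c, ε * η c) with ha
      set b := gauge B (c, ε * η c) with hb
      have hh : K * |ε * η c| ≤ ε * Q * g := by
        rw [abs_mul, abs_of_pos hε]
        have h1 := (hN c).trans (mul_le_mul_of_nonneg_left (hnorm c) hN0)
        have h2 := mul_le_mul_of_nonneg_left h1 (mul_nonneg Kn hε.le)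
        rw [hQ]
        calc _ = K * ε * |η c| := by ring
          _ ≤ _ := h2
          _ = _ := by ring
      have a1 := abs_le.1 ((lipA c (ε * η c)).trans hh)
      have b1 := abs_le.1 ((lipB c (ε * η c)).trans hh)
      have hεg : ε * Q * g ≤ g / 2 := by nlinarith
      have apos : g / 2 ≤ a := by linarith [a1.1]
      have bpos : g / 2 ≤ b := by linarith [b1.1]
      have a0 : 0 < a := by linarith
      have b0 : 0 < b := by linarith
      have h1 : gauge A ((1 / a) • c, ε * η ((1 / a) • c)) = 1 := by
        have e : ((1 / a) • c, ε * η ((1 / a) • c)) = (1 / a) • (c, ε * η c) := by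
          ext <;> simp; ring
        rw [e, sA.smul _ _ (by positivity)]
        exact one_div_mul_cancel a0.ne'
      have h2 := ell_pt Ac Acl A0 Bc Bcl B0 η h h1
      have e : ((1 / a) • c + c, ε * η ((1 / a) • c + c)) = (1 / a + 1) • (c, ε * η c) := by
        ext
        · simp [add_smul]
        · simp; ring
      rw [e, sB.smul _ _ (by positivity)] at h2
      change (1 / a + 1) * b = 1 at h2
      have h3 : b + a * b = a := by field_simp at h2; linarith
      have h4 : a * b ≤ 2 * (ε * Q * g) := by linarith [a1.2, b1.1]
      have h5 : g / 2 * (g / 2) ≤ a * b := mul_le_mul apos bpos (by linarith) (by linarith)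
      have h6 : g ≤ 8 * Q * ε := by
        by_contra hcon
        push Not at hcon
        nlinarith
      exact (hnorm c).trans (mul_le_mul_of_nonneg_left h6 (by linarith))
    -- sequences
    set ε1 := min (ε0 / 2) (1 / (2 * (Q + 1))) with hε1
    have hεpos : 0 < ε1 := by positivity
    set ε : ℕ → ℝ := fun k => ε1 / (k + 1) with hεd
    have εpos : ∀ k, 0 < ε k := fun k => by simp only [hεd]; positivity
    have εle : ∀ k, ε k ≤ ε1 := fun k => by
      simp only [hεd]
      exact div_le_self hεpos.le (by linarith [Nat.cast_nonneg (α := ℝ) k])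
    have εt : Tendsto ε atTop (𝓝 0) := by
      have := (tendsto_one_div_add_atTop_nhds_zero_nat (𝕜 := ℝ)).const_mul ε1
      simpa [hεd, div_eq_mul_inv] using this
    have εQ : ∀ k, ε k * Q ≤ 1 / 2 := by
      intro k
      have h1 : ε k ≤ 1 / (2 * (Q + 1)) := (εle k).trans (min_le_right _ _)
      calc ε k * Q ≤ 1 / (2 * (Q + 1)) * Q := mul_le_mul_of_nonneg_right h1 Q0
        _ ≤ 1 / 2 := by
          rw [div_mul_eq_mul_div, one_mul, div_le_div_iff₀ (by positivity) (by norm_num)]; linarith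
    have hex : ∀ k, ∃ c, ∀ w, (w, ε k * η w) ∈ A ↔ (w + c, ε k * η (w + c)) ∈ B := by
      intro k
      refine Hε (ε k) (εpos k) (lt_of_le_of_lt ((εle k).trans (min_le_left _ _)) (by linarith))
    choose c hc using hex
    have hbd : ∀ k, (1 / ε k) • c k ∈ Metric.closedBall (0:E) ((R + 1) * (8 * Q)) := by
      intro k
      have h1 := bound (ε k) (c k) (εpos k) (εQ k) (hc k)
      have h2 := εpos k
      rw [mem_closedBall_zero_iff, norm_smul, Real.norm_of_nonneg (by positivity), one_div_mul_le_iff' h2]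
      linarith
    obtain ⟨γ, -, φ, hφ, hlim⟩ := (isCompact_closedBall (0:E) _).tendsto_subseq hbd
    refine ⟨γ, fun x hx => ?_, fun x hx => ?_⟩
    · exact ell_transfer Ac Acl A0 Bc Bcl B0 η (fun k => εpos (φ k)) (εt.comp hφ.tendsto_atTop)
        (fun k => hc (φ k)) hlim (hpos x hx) (hAB x)
    · rw [hAB]
      refine ell_transfer Bc Bcl B0 Ac Acl A0 η (c := fun k => - c (φ k)) (fun k => εpos (φ k)) (εt.comp hφ.tendsto_atTop)
        (fun k w => ?_) ?_ (hAB x ▸ hpos x hx) (hAB x).symm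
      · rw [hc (φ k)]; simp
      · have := hlim.neg
        refine this.congr fun k => ?_
        simp
  · intro η hη hall
    refine hcyl η hη ⟨?_, ?_⟩
    · intro x t ht hx hm
      have hx0 : x ≠ 0 := by rintro rfl; simp at hx
      have h1 := scale A Ac A0 x (η x) (t / η x) (by positivity)
      rw [div_mul_cancel₀ _ hx.ne', (hall x hx0).1, mul_zero] at h1
      have h2 := sA.DD_le1 (x, 0) (0, t)
      rw [h1] at h2
      rw [mA] at hm ⊢
      simp at h2
      linarith
    · intro x t ht hx hm
      have hx0 : x ≠ 0 := by rintro rfl; simp at hx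
      have h1 := scale B Bc B0 x (η x) (-t / η x) (div_nonneg_of_nonpos (by linarith) hx.le)
      rw [div_mul_cancel₀ _ hx.ne, (hall x hx0).2, mul_zero] at h1
      have h2 := sB.DD_le1 (x, 0) (0, -t)
      rw [h1] at h2
      rw [mB] at hm ⊢
      simp at h2
      linarith

end
end

section
open Set Module Filter Topology MeasureTheory
set_option linter.unusedSectionVars false

/-- one-dimensional length function -/
theorem len_lip {S : Set ℝ} (hS : MeasurableSet S) {M t t' : ℝ} (hM : ∀ z ∈ S, z < t → -M ≤ z)
    (hM' : ∀ z ∈ S, z < t' → -M ≤ z) :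
    |(volume (S ∩ Iio t)).toReal - (volume (S ∩ Iio t')).toReal| ≤ |t - t'| := by
  wlog h : t ≤ t' generalizing t t'
  · rw [abs_sub_comm, abs_sub_comm t]; exact this hM' hM (le_of_not_ge h)
  have fin : ∀ u, (∀ z ∈ S, z < u → -M ≤ z) → volume (S ∩ Iio u) ≠ ⊤ := by
    intro u hu
    refine ne_top_of_le_ne_top (b := volume (Icc (-M) u)) (by simp) (measure_mono ?_)
    rintro z ⟨h1, h2⟩
    exact ⟨hu z h1 h2, le_of_lt h2⟩
  have h1 : volume (S ∩ Iio t') ≤ volume (S ∩ Iio t) + ENNReal.ofReal (t' - t) := by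
    rw [← Real.volume_Ico]
    refine (measure_mono ?_).trans (measure_union_le _ _)
    rintro z ⟨a, b⟩
    by_cases hz : z < t
    · exact Or.inl ⟨a, hz⟩
    · exact Or.inr ⟨not_lt.1 hz, b⟩
  have h2 : volume (S ∩ Iio t) ≤ volume (S ∩ Iio t') :=
    measure_mono (fun z hz => ⟨hz.1, lt_of_lt_of_le hz.2 h⟩)
  have h3 := ENNReal.toReal_mono (fin t' hM') h2
  have h4 := ENNReal.toReal_mono (by simp [fin t hM]) h1
  rw [ENNReal.toReal_add (fin t hM) (by simp), ENNReal.toReal_ofReal (by linarith)] at h4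
  rw [abs_sub_comm, abs_of_nonneg (by linarith), abs_sub_comm, abs_of_nonneg (by linarith)]
  linarith

theorem len_deriv_in {S : Set ℝ} (hS : MeasurableSet S) {M t r : ℝ} (hr : 0 < r)
    (hM : ∀ z ∈ S, z < t + r → -M ≤ z) (hin : Ioo (t - r) (t + r) ⊆ S) :
    HasDerivAt (fun u => (volume (S ∩ Iio u)).toReal) 1 t := by
  have fin : ∀ u, u ≤ t + r → volume (S ∩ Iio u) ≠ ⊤ := by
    intro u hu
    refine ne_top_of_le_ne_top (b := volume (Icc (-M) u)) (by simp) (measure_mono ?_)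
    rintro z ⟨h1, h2⟩
    exact ⟨hM z h1 (lt_of_lt_of_le h2 hu), le_of_lt h2⟩
  have key : ∀ u v, t - r < u → u ≤ v → v < t + r →
      (volume (S ∩ Iio v)).toReal = (volume (S ∩ Iio u)).toReal + (v - u) := by
    intro u v hu huv hv
    have e : S ∩ Iio v = (S ∩ Iio u) ∪ Ico u v := by
      ext z; constructor
      · rintro ⟨a, b⟩
        by_cases hz : z < u
        · exact Or.inl ⟨a, hz⟩
        · exact Or.inr ⟨not_lt.1 hz, b⟩
      · rintro (⟨a, b⟩ | ⟨a, b⟩)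
        · exact ⟨a, lt_of_lt_of_le b huv⟩
        · exact ⟨hin ⟨by linarith, by linarith⟩, b⟩
    have d : Disjoint (S ∩ Iio u) (Ico u v) := by
      rw [Set.disjoint_left]; rintro z ⟨_, a⟩ ⟨b, _⟩
      exact absurd a (not_lt.2 b)
    rw [e, measure_union d measurableSet_Ico, ENNReal.toReal_add (fin u (by linarith)) (by simp),
      Real.volume_Ico, ENNReal.toReal_ofReal (by linarith)]
  have h : (fun u => (volume (S ∩ Iio u)).toReal) =ᶠ[𝓝 t] fun u => (volume (S ∩ Iio t)).toReal + (u - t) := by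
    filter_upwards [Ioo_mem_nhds (by linarith : t - r < t) (by linarith : t < t + r)] with u hu
    rcases le_total u t with h | h
    · have := key u t hu.1 h (by linarith); linarith
    · have := key t u (by linarith) h hu.2; linarith
  refine HasDerivAt.congr_of_eventuallyEq ?_ h
  simpa using ((hasDerivAt_id t).sub_const t).const_add ((volume (S ∩ Iio t)).toReal)

theorem len_deriv_out {S : Set ℝ} {t r : ℝ} (hr : 0 < r)
    (hout : Disjoint (Ioo (t - r) (t + r)) S) :
    HasDerivAt (fun u => (volume (S ∩ Iio u)).toReal) 0 t := by
  have h : (fun u => (volume (S ∩ Iio u)).toReal) =ᶠ[𝓝 t] fun u => (volume (S ∩ Iio t)).toReal := by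
    filter_upwards [Ioo_mem_nhds (by linarith : t - r < t) (by linarith : t < t + r)] with u hu
    congr 2
    ext z
    constructor
    · rintro ⟨a, b⟩
      refine ⟨a, ?_⟩
      by_contra hz
      exact Set.disjoint_left.1 hout ⟨by simp at hz; linarith, lt_trans b hu.2⟩ a
    · rintro ⟨a, b⟩
      refine ⟨a, ?_⟩
      by_contra hz
      exact Set.disjoint_left.1 hout ⟨by simp at hz; linarith [hu.1], by have : z < t := b; linarith⟩ a
  exact (hasDerivAt_const t _).congr_of_eventuallyEq h

section
variable {E : Type*} [NormedAddCommGroup E] [InnerProductSpace ℝ E] [FiniteDimensional ℝ E]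
  [MeasurableSpace E] [BorelSpace E]

/-- the slanted section -/
def sec (X : Set (E × ℝ)) (η : E →ₗ[ℝ] ℝ) (s : ℝ) : Set E := {w | (w, η w + s) ∈ X}

theorem sec_convex {X : Set (E × ℝ)} (hX : Convex ℝ X) (η : E →ₗ[ℝ] ℝ) (s : ℝ) : Convex ℝ (sec X η s) := by
  intro x hx y hy a b ha hb hab
  have := hX hx hy ha hb hab
  simp only [sec, mem_ofPred_eq, map_add, map_smul] at this ⊢
  convert this using 1
  ext
  · simp
  · simp
    have : s = (a + b) * s := by rw [hab, one_mul]
    linear_combination this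

theorem sec_closed {X : Set (E × ℝ)} (hX : IsClosed X) (η : E →ₗ[ℝ] ℝ) (s : ℝ) : IsClosed (sec X η s) := by
  have hη : Continuous η := η.continuous_of_finiteDimensional
  exact hX.preimage (by fun_prop : Continuous fun w : E => (w, η w + s))

theorem sec_interior {X : Set (E × ℝ)} (hX : Convex ℝ X) (η : E →ₗ[ℝ] ℝ) {s : ℝ}
    (h0 : ((0:E), s) ∈ interior X) {w : E} (hw : w ∈ interior (sec X η s)) : (w, η w + s) ∈ interior X := by
  have hc : Tendsto (fun θ : ℝ => (1 + θ) • w) (𝓝[>] 0) (𝓝 w) := by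
    have : Continuous (fun θ : ℝ => (1 + θ) • w) := by fun_prop
    have h := this.tendsto 0
    simp only [add_zero, one_smul] at h
    exact h.mono_left nhdsWithin_le_nhds
  obtain ⟨θ, h1, h2⟩ := ((hc.eventually (mem_interior_iff_mem_nhds.1 hw)).and self_mem_nhdsWithin).exists
  have h2' : (0:ℝ) < θ := h2
  have h3 : (((1 + θ) • w), η ((1 + θ) • w) + s) ∈ X := h1
  have := hX.combo_interior_self_mem_interior h0 h3 (a := θ / (1 + θ)) (b := 1 / (1 + θ)) (by positivity)
    (by positivity) (by field_simp; ring)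
  convert this using 1
  ext
  · simp [smul_smul, (by positivity : (1 + θ) ≠ 0)]
  · simp; field_simp; ring

theorem cap_deriv {X : Set (E × ℝ)} (hX : Convex ℝ X) (hcl : IsClosed X) (η ψ : E →ₗ[ℝ] ℝ) {s : ℝ}
    (h0 : ((0:E), s) ∈ interior X) {M ε0 : ℝ} (hε0 : 0 < ε0)
    (hM : ∀ ε, |ε| < ε0 → ∀ w Z, (w, Z) ∈ X → Z ≤ (η + ε • ψ) w + s → ‖(w, Z)‖ ≤ M) :
    HasDerivAt (fun ε : ℝ => (volume (X ∩ {p : E × ℝ | p.2 < (η + ε • ψ) p.1 + s})).toReal)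
      (∫ w in sec X η s, ψ w) 0 := by
  have hη : Continuous η := η.continuous_of_finiteDimensional
  have hψ : Continuous ψ := ψ.continuous_of_finiteDimensional
  obtain ⟨N, hN0, hN⟩ : ∃ N : ℝ, 0 ≤ N ∧ ∀ x, |ψ x| ≤ N * ‖x‖ :=
    ⟨‖LinearMap.toContinuousLinearMap ψ‖, norm_nonneg _, fun x => (LinearMap.toContinuousLinearMap ψ).le_opNorm x⟩
  let Xw : E → Set ℝ := fun w => {Z | (w, Z) ∈ X}
  have hXw : ∀ w, MeasurableSet (Xw w) := fun w =>
    (hcl.preimage (by fun_prop : Continuous fun Z : ℝ => (w, Z))).measurableSet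
  let F : ℝ → E → ℝ := fun ε w => (volume (Xw w ∩ Iio ((η + ε • ψ) w + s))).toReal
  have hmeasS : ∀ ε : ℝ, MeasurableSet (X ∩ {p : E × ℝ | p.2 < (η + ε • ψ) p.1 + s}) := by
    intro ε
    refine hcl.measurableSet.inter (measurableSet_lt measurable_snd ?_)
    have : Continuous (fun p : E × ℝ => (η + ε • ψ) p.1 + s) := by
      simp only [LinearMap.add_apply, LinearMap.smul_apply]; fun_prop
    exact this.measurable
  have hFm : ∀ ε, Measurable (F ε) := fun ε =>
    (measurable_measure_prodMk_left (ν := (volume : Measure ℝ)) (hmeasS ε)).ennreal_toReal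
  have hM0 : 0 ≤ M := (norm_nonneg _).trans (hM 0 (by simpa using hε0) 0 s (interior_subset h0) (by simp))
  have hlow : ∀ ε, |ε| < ε0 → ∀ w, ∀ z ∈ Xw w, z < (η + ε • ψ) w + s → -M ≤ z := by
    intro ε hε w z hz hlt
    have h1 := hM ε hε w z hz hlt.le
    have h2 := (norm_snd_le (w, z)).trans h1
    exact (abs_le.1 h2).1
  have hemp : ∀ ε, |ε| < ε0 → ∀ w, M < ‖w‖ → Xw w ∩ Iio ((η + ε • ψ) w + s) = ∅ := by
    intro ε hε w hw
    rw [Set.eq_empty_iff_forall_notMem]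
    rintro z ⟨hz, hlt⟩
    have h1 := hM ε hε w z hz (le_of_lt hlt)
    have h2 := (norm_fst_le (w, z)).trans h1
    exact absurd hw (not_lt.2 h2)
  have hfin : ∀ ε, |ε| < ε0 → ∀ w, volume (Xw w ∩ Iio ((η + ε • ψ) w + s)) ≤
      (Metric.closedBall (0:E) M).indicator (fun _ => ENNReal.ofReal (2 * M)) w := by
    intro ε hε w
    by_cases hw : M < ‖w‖
    · rw [hemp ε hε w hw]; simp
    · rw [indicator_of_mem (by simpa using hw)]
      refine (measure_mono (t := Icc (-M) M) ?_).trans (by rw [Real.volume_Icc]; apply le_of_eq; congr 1; ring)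
      rintro z ⟨hz, hlt⟩
      have h1 := hM ε hε w z hz (le_of_lt hlt)
      have h2 := (norm_snd_le (w, z)).trans h1
      exact abs_le.1 h2
  have hVF : ∀ ε, |ε| < ε0 → (volume (X ∩ {p : E × ℝ | p.2 < (η + ε • ψ) p.1 + s})).toReal = ∫ w, F ε w := by
    intro ε hε
    rw [show (volume : Measure (E × ℝ)) = (volume : Measure E).prod volume from rfl,
      Measure.prod_apply (hmeasS ε), ← integral_toReal]
    · rfl
    · exact (measurable_measure_prodMk_left (hmeasS ε)).aemeasurable
    · refine Eventually.of_forall fun w => lt_of_le_of_lt (hfin ε hε w) ?_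
      exact lt_of_le_of_lt (indicator_le_self' (fun _ _ => zero_le) w) ENNReal.ofReal_lt_top
  have hball : MeasurableSet (Metric.closedBall (0:E) M) := measurableSet_closedBall
  have hbfin : volume (Metric.closedBall (0:E) M) ≠ ⊤ := (isCompact_closedBall _ _).measure_lt_top.ne
  have res := hasDerivAt_integral_of_dominated_loc_of_lip (μ := (volume : Measure E)) (𝕜 := ℝ)
    (bound := (Metric.closedBall (0:E) M).indicator (fun _ => N * M)) (F := F) (x₀ := 0)
    (s := Ioo (-ε0) ε0) (F' := (sec X η s).indicator (fun w => ψ w)) (Ioo_mem_nhds (by linarith) hε0)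
    (Eventually.of_forall fun ε => (hFm ε).aestronglyMeasurable) ?_ ?_ ?_ ?_ ?_
  · have h2 := res.2
    rw [integral_indicator (sec_closed hcl η s).measurableSet] at h2
    refine h2.congr_of_eventuallyEq ?_
    filter_upwards [Ioo_mem_nhds (by linarith : -ε0 < 0) hε0] with ε hε
    exact hVF ε (abs_lt.2 hε)
  · -- integrable F 0
    refine Integrable.mono' (g := (Metric.closedBall (0:E) M).indicator (fun _ => 2 * M)) ?_
      (hFm 0).aestronglyMeasurable (Eventually.of_forall fun w => ?_)
    · rw [integrable_indicator_iff hball]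
      exact integrableOn_const hbfin
    · have := hfin 0 (by simpa using hε0) w
      rw [Real.norm_of_nonneg ENNReal.toReal_nonneg]
      by_cases hw : w ∈ Metric.closedBall (0:E) M
      · rw [indicator_of_mem hw] at this ⊢
        exact ENNReal.toReal_le_of_le_ofReal (by positivity) this
      · rw [indicator_of_notMem hw] at this ⊢
        have this' := le_antisymm this zero_le
        change (volume (Xw w ∩ Iio ((η + (0:ℝ) • ψ) w + s))).toReal ≤ _
        rw [this']; simp
  · exact (hψ.measurable.indicator (sec_closed hcl η s).measurableSet).aestronglyMeasurable
  · refine Eventually.of_forall fun w => ?_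
    rw [lipschitzOnWith_iff_dist_le_mul]
    intro ε hε ε' hε'
    have a1 := hlow ε (abs_lt.2 hε) w
    have a2 := hlow ε' (abs_lt.2 hε') w
    by_cases hw : M < ‖w‖
    · simp only [F]
      rw [hemp ε (abs_lt.2 hε) w hw, hemp ε' (abs_lt.2 hε') w hw]
      simp; positivity
    · have hw' : w ∈ Metric.closedBall (0:E) M := by simpa using hw
      rw [indicator_of_mem hw', Real.dist_eq, Real.dist_eq]
      have h1 := len_lip (hXw w) a1 a2
      refine h1.trans ?_
      have e : (η + ε • ψ) w + s - ((η + ε' • ψ) w + s) = (ε - ε') * ψ w := by simp; ring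
      rw [e, abs_mul, mul_comm |ε - ε'|]
      refine mul_le_mul_of_nonneg_right ?_ (abs_nonneg _)
      rw [Real.coe_nnabs, abs_of_nonneg (mul_nonneg hN0 hM0)]
      exact (hN w).trans (mul_le_mul_of_nonneg_left (not_lt.1 hw) hN0)
  · rw [integrable_indicator_iff hball]
    exact integrableOn_const hbfin
  · have hfr : ∀ᵐ w, w ∉ frontier (sec X η s) := by
      rw [ae_iff]; simpa using (sec_convex hX η s).addHaar_frontier volume
    filter_upwards [hfr] with w hw
    have inner : HasDerivAt (fun ε : ℝ => (η + ε • ψ) w + s) (ψ w) 0 := by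
      have : (fun ε : ℝ => (η + ε • ψ) w + s) = fun ε : ℝ => (η w + s) + ε * ψ w := by
        ext ε; simp; ring
      rw [this]
      simpa using ((hasDerivAt_id (0:ℝ)).mul_const (ψ w)).const_add (η w + s)
    have e0 : (η + (0:ℝ) • ψ) w + s = η w + s := by simp
    by_cases hin : w ∈ sec X η s
    · have hint : w ∈ interior (sec X η s) := by
        by_contra h
        exact hw ⟨subset_closure hin, h⟩
      rw [indicator_of_mem hin]
      have h1 := sec_interior hX η h0 hint
      obtain ⟨r, hr, hsub⟩ := Metric.isOpen_iff.1 isOpen_interior _ h1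
      have hin2 : Ioo (η w + s - r) (η w + s + r) ⊆ Xw w := by
        intro z hz
        apply interior_subset (s := X)
        apply hsub
        rw [Metric.mem_ball, Prod.dist_eq]
        simp only [dist_self]
        rw [max_lt_iff, Real.dist_eq, abs_lt]
        exact ⟨hr, by linarith [hz.1], by linarith [hz.2]⟩
      have hd : HasDerivAt (fun u => (volume (Xw w ∩ Iio u)).toReal) 1 (η w + s) := by
        refine len_deriv_in (hXw w) hr (M := max M (r - (η w + s))) ?_ hin2
        intro z hz hlt
        by_cases hz' : z < η w + s
        · have := hlow 0 (by simpa using hε0) w z hz (by simpa using hz')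
          exact le_trans (neg_le_neg (le_max_left _ _)) this
        · have := le_max_right M (r - (η w + s))
          push Not at hz'
          linarith
      have := HasDerivAt.comp (h₂ := fun u => (volume (Xw w ∩ Iio u)).toReal)
        (h := fun ε : ℝ => (η + ε • ψ) w + s) (0:ℝ) (by rw [e0]; exact hd) inner
      rw [one_mul] at this
      exact this
    · rw [indicator_of_notMem hin]
      have hop : IsOpen Xᶜ := hcl.isOpen_compl
      obtain ⟨r, hr, hsub⟩ := Metric.isOpen_iff.1 hop (w, η w + s) hin
      have hd : HasDerivAt (fun u => (volume (Xw w ∩ Iio u)).toReal) 0 (η w + s) := by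
        refine len_deriv_out hr ?_
        rw [Set.disjoint_left]
        intro z hz hzX
        refine hsub (a := (w, z)) ?_ hzX
        rw [Metric.mem_ball, Prod.dist_eq]
        simp only [dist_self]
        rw [max_lt_iff, Real.dist_eq, abs_lt]
        exact ⟨hr, by linarith [hz.1], by linarith [hz.2]⟩
      have := HasDerivAt.comp (h₂ := fun u => (volume (Xw w ∩ Iio u)).toReal)
        (h := fun ε : ℝ => (η + ε • ψ) w + s) (0:ℝ) (by rw [e0]; exact hd) inner
      rw [zero_mul] at this
      exact this

end
end

section
open Set Module Filter Topology MeasureTheory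
set_option linter.unusedSectionVars false

section
variable {E : Type*} [NormedAddCommGroup E] [InnerProductSpace ℝ E] [FiniteDimensional ℝ E]
  [MeasurableSpace E] [BorelSpace E]

theorem volHaar : (volume : Measure (E × ℝ)).IsAddHaarMeasure :=
  inferInstanceAs ((volume : Measure E).prod (volume : Measure ℝ)).IsAddHaarMeasure

/-- the flip of the last coordinate -/
def flipE (p : E × ℝ) : E × ℝ := (p.1, -p.2)

theorem flip_mp : MeasurePreserving (flipE : E × ℝ → E × ℝ) volume volume :=
  (MeasurePreserving.id (volume : Measure E)).prod (Measure.measurePreserving_neg (volume : Measure ℝ))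

theorem flip_cont : Continuous (flipE : E × ℝ → E × ℝ) := by
  unfold flipE; fun_prop

theorem flipE_flipE (p : E × ℝ) : flipE (flipE p) = p := by simp [flipE]

theorem flip_interior {Y : Set (E × ℝ)} {p : E × ℝ} (h : flipE p ∈ interior Y) :
    p ∈ interior (flipE ⁻¹' Y) :=
  preimage_interior_subset_interior_preimage flip_cont h

theorem flip_convex {Y : Set (E × ℝ)} (h : Convex ℝ Y) : Convex ℝ (flipE ⁻¹' Y) := by
  intro x hx y hy a b ha hb hab
  have := h hx hy ha hb hab
  rw [mem_preimage]
  convert this using 1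
  simp only [flipE]
  ext
  · simp
  · simp; ring

theorem cap_deriv_up {Y : Set (E × ℝ)} (hY : Convex ℝ Y) (hcl : IsClosed Y) (η ψ : E →ₗ[ℝ] ℝ) {s : ℝ}
    (h0 : ((0:E), s) ∈ interior Y) {M ε0 : ℝ} (hε0 : 0 < ε0)
    (hM : ∀ ε, |ε| < ε0 → ∀ w Z, (w, Z) ∈ Y → (η + ε • ψ) w + s ≤ Z → ‖(w, Z)‖ ≤ M) :
    HasDerivAt (fun ε : ℝ => (volume (Y ∩ {p : E × ℝ | (η + ε • ψ) p.1 + s < p.2})).toReal)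
      (-∫ w in sec Y η s, ψ w) 0 := by
  have h := cap_deriv (flip_convex hY) (hcl.preimage flip_cont) (-η) (-ψ) (s := -s)
    (flip_interior (by simpa [flipE] using h0)) hε0 (M := M) ?_
  · have e1 : sec (flipE ⁻¹' Y) (-η) (-s) = sec Y η s := by
      ext w; simp [sec, flipE, add_comm]
    rw [e1] at h
    have e2 : ∫ w in sec Y η s, (-ψ) w = -∫ w in sec Y η s, ψ w := by
      simp only [LinearMap.neg_apply]; exact integral_neg _
    rw [e2] at h
    convert h using 1
    funext ε
    have hm : MeasurableSet (Y ∩ {p : E × ℝ | (η + ε • ψ) p.1 + s < p.2}) := by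
      refine hcl.measurableSet.inter (measurableSet_lt ?_ measurable_snd)
      have hη : Continuous η := η.continuous_of_finiteDimensional
      have hψ : Continuous ψ := ψ.continuous_of_finiteDimensional
      have : Continuous (fun p : E × ℝ => (η + ε • ψ) p.1 + s) := by
        simp only [LinearMap.add_apply, LinearMap.smul_apply]; fun_prop
      exact this.measurable
    rw [← (flip_mp (E := E)).measure_preimage hm.nullMeasurableSet]
    congr 2
    ext p
    simp only [flipE, mem_preimage, mem_inter_iff, mem_ofPred_eq, LinearMap.add_apply, LinearMap.neg_apply,
      LinearMap.smul_apply, smul_eq_mul]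
    refine and_congr Iff.rfl ⟨fun h => by linarith, fun h => by linarith⟩
  · intro ε hε w Z hw hZ
    have := hM ε hε w (-Z) hw (by simp at hZ ⊢; linarith)
    simpa [Prod.norm_def] using this

theorem min_lemma {X Y : Set (E × ℝ)} (hX : Convex ℝ X) (hXcl : IsClosed X) (hY : Convex ℝ Y) (hYcl : IsClosed Y)
    (η : E →ₗ[ℝ] ℝ) {s s' : ℝ} (hX0 : ((0:E), s) ∈ interior X) (hY0 : ((0:E), s') ∈ interior Y)
    (c : E) (hc : ∀ w, w ∈ sec Y η s' ↔ w + c ∈ sec X η s) {M ε0 : ℝ} (hε0 : 0 < ε0)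
    (hMX : ∀ ε, |ε| < ε0 → ∀ w Z, (w, Z) ∈ X → Z ≤ (η + ε • (innerₛₗ ℝ c)) w + s → ‖(w, Z)‖ ≤ M)
    (hMY : ∀ ε, |ε| < ε0 → ∀ w Z, (w, Z) ∈ Y → (η + ε • (innerₛₗ ℝ c)) w + s' ≤ Z → ‖(w, Z)‖ ≤ M)
    (hmin : ∀ ε : ℝ, |ε| < ε0 →
      volume (X ∩ {p : E × ℝ | p.2 < η p.1 + s}) + volume (Y ∩ {p : E × ℝ | η p.1 + s' < p.2}) ≤
      volume (X ∩ {p : E × ℝ | p.2 < (η + ε • (innerₛₗ ℝ c)) p.1 + s}) +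
      volume (Y ∩ {p : E × ℝ | (η + ε • (innerₛₗ ℝ c)) p.1 + s' < p.2})) : c = 0 := by
  set ψ : E →ₗ[ℝ] ℝ := innerₛₗ ℝ c with hψd
  have hψ : Continuous ψ := ψ.continuous_of_finiteDimensional
  have d1 := cap_deriv hX hXcl η ψ hX0 hε0 hMX
  have d2 := cap_deriv_up hY hYcl η ψ hY0 hε0 hMY
  have d := d1.add d2
  have finX : ∀ ε : ℝ, |ε| < ε0 → volume (X ∩ {p : E × ℝ | p.2 < (η + ε • ψ) p.1 + s}) ≠ ⊤ := by
    intro ε hε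
    refine ne_top_of_le_ne_top (b := volume (Metric.closedBall (0 : E × ℝ) M)) (isCompact_closedBall _ _).measure_lt_top.ne
      (measure_mono ?_)
    rintro ⟨w, Z⟩ ⟨h1, h2⟩
    simpa using hMX ε hε w Z h1 (le_of_lt h2)
  have finY : ∀ ε : ℝ, |ε| < ε0 → volume (Y ∩ {p : E × ℝ | (η + ε • ψ) p.1 + s' < p.2}) ≠ ⊤ := by
    intro ε hε
    refine ne_top_of_le_ne_top (b := volume (Metric.closedBall (0 : E × ℝ) M)) (isCompact_closedBall _ _).measure_lt_top.ne
      (measure_mono ?_)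
    rintro ⟨w, Z⟩ ⟨h1, h2⟩
    simpa using hMY ε hε w Z h1 (le_of_lt h2)
  have h00 : |(0:ℝ)| < ε0 := by simpa using hε0
  have loc : IsLocalMin (fun ε : ℝ => (volume (X ∩ {p : E × ℝ | p.2 < (η + ε • ψ) p.1 + s})).toReal +
      (volume (Y ∩ {p : E × ℝ | (η + ε • ψ) p.1 + s' < p.2})).toReal) 0 := by
    filter_upwards [Ioo_mem_nhds (by linarith : -ε0 < 0) hε0] with ε hε
    have hε' := abs_lt.2 hε
    rw [← ENNReal.toReal_add (finX ε hε') (finY ε hε'), ← ENNReal.toReal_add (finX 0 h00) (finY 0 h00)]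
    refine ENNReal.toReal_mono (ENNReal.add_ne_top.2 ⟨finX ε hε', finY ε hε'⟩) ?_
    have := hmin ε hε'
    simpa using this
  have z := loc.hasDerivAt_eq_zero d
  set SY := sec Y η s'
  have hSYb : SY ⊆ Metric.closedBall 0 M := by
    intro w hw
    have := hMY 0 h00 w (η w + s') hw (by simp)
    simpa using (norm_fst_le _).trans this
  have hSYfin : volume SY ≠ ⊤ := ne_top_of_le_ne_top (isCompact_closedBall (0:E) M).measure_lt_top.ne (measure_mono hSYb)
  have hSYm : MeasurableSet SY := (sec_closed hYcl η s').measurableSet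
  have hSXm : MeasurableSet (sec X η s) := (sec_closed hXcl η s).measurableSet
  have e1 : ∫ w in sec X η s, ψ w = ∫ w in SY, (ψ w + ψ c) := by
    rw [← integral_indicator hSXm, ← integral_indicator hSYm,
      ← integral_add_right_eq_self (μ := volume) _ c]
    congr 1
    ext w
    by_cases h : w ∈ SY
    · rw [indicator_of_mem h, indicator_of_mem ((hc w).1 h), map_add]
    · rw [indicator_of_notMem h, indicator_of_notMem (fun h' => h ((hc w).2 h'))]
  have hi : IntegrableOn (fun w => ψ w) SY volume :=
    (hψ.continuousOn.integrableOn_compact (isCompact_closedBall (0:E) M)).mono_set hSYb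
  rw [e1, integral_add hi (integrableOn_const hSYfin)] at z
  have z2 : (volume.real SY) * ψ c = 0 := by
    have : ∫ (_ : E) in SY, ψ c = (volume.real SY) * ψ c := by simp
    rw [this] at z; linarith
  have hpos : 0 < volume.real SY := by
    rw [measureReal_def]
    refine ENNReal.toReal_pos ?_ hSYfin
    have : SY ∈ 𝓝 (0:E) := by
      have hη : Continuous η := η.continuous_of_finiteDimensional
      have hc : Continuous (fun w : E => (w, η w + s')) := by fun_prop
      exact hc.continuousAt.preimage_mem_nhds (by simpa using mem_interior_iff_mem_nhds.1 hY0)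
    exact (Measure.measure_pos_of_mem_nhds volume this).ne'
  have := (mul_eq_zero.1 z2).resolve_left hpos.ne'
  rw [hψd] at this
  simpa using this

theorem lsc_meas {P X : Type*} [TopologicalSpace P] [TopologicalSpace X] [MeasurableSpace X] [BorelSpace X]
    [T2Space X] (μ : Measure X) [μ.InnerRegular] {S : Set X} (hS : MeasurableSet S) (f : P → X → ℝ)
    (hf : Continuous (fun q : P × X => f q.1 q.2)) : LowerSemicontinuous (fun y => μ (S ∩ {x | 0 < f y x})) := by
  intro y0 r hr
  have hm : MeasurableSet (S ∩ {x | 0 < f y0 x}) := hS.inter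
    (isOpen_lt continuous_const (by fun_prop : Continuous fun x => f y0 x)).measurableSet
  obtain ⟨C, hC, hCc, hrC⟩ := hm.exists_lt_isCompact hr
  have : ∀ᶠ y in 𝓝 y0, ∀ x ∈ C, 0 < f y x := by
    apply hCc.eventually_forall_of_forall_eventually
    intro x hx
    exact (isOpen_lt continuous_const hf).mem_nhds (hC hx).2
  filter_upwards [this] with y hy
  exact lt_of_lt_of_le hrC (measure_mono fun x hx => ⟨(hC hx).1, hy x hx⟩)

theorem vol_top {S : Set (E × ℝ)} {x v : E × ℝ} {δ : ℝ} (hδ : 0 < δ) (hv : v ≠ 0)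
    (h : ∀ t : ℝ, 0 ≤ t → ∀ y ∈ Metric.ball x δ, y + t • v ∈ S) : volume S = ⊤ := by
  haveI := volHaar (E := E)
  have hv' : 0 < ‖v‖ := norm_pos_iff.2 hv
  set T := 2 * δ / ‖v‖ with hT
  have hT0 : 0 < T := by positivity
  let b : ℕ → Set (E × ℝ) := fun k => Metric.ball (x + (k * T) • v) δ
  have hb : ∀ k, b k ⊆ S := by
    intro k y hy
    have := h (k * T) (by positivity) (y - ((k:ℝ) * T) • v) (by
      simp only [b, Metric.mem_ball, dist_eq_norm] at hy ⊢
      convert hy using 2; abel)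
    simpa using this
  have hd : Pairwise (Function.onFun Disjoint b) := by
    intro i j hij
    apply Metric.ball_disjoint_ball
    rw [dist_eq_norm]
    have : x + ((i:ℝ) * T) • v - (x + ((j:ℝ) * T) • v) = (((i:ℝ) - j) * T) • v := by
      rw [sub_mul, sub_smul]; abel
    rw [this, norm_smul, Real.norm_eq_abs, abs_mul, abs_of_pos hT0]
    have h1 : (1:ℝ) ≤ |(i:ℝ) - j| := by
      have : (1:ℤ) ≤ |(i:ℤ) - j| := Int.one_le_abs (sub_ne_zero.2 (by exact_mod_cast hij))
      exact_mod_cast this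
    have h2 : T * ‖v‖ = 2 * δ := by rw [hT]; field_simp
    calc δ + δ = 1 * (T * ‖v‖) := by rw [h2]; ring
      _ ≤ |(i:ℝ) - j| * (T * ‖v‖) := by gcongr
      _ = _ := by ring
  have : volume (⋃ k, b k) = ⊤ := by
    rw [measure_iUnion hd (fun k => measurableSet_ball)]
    have : ∀ k, volume (b k) = volume (Metric.ball (0 : E × ℝ) δ) := fun k => Measure.addHaar_ball_center _ _ _
    simp_rw [this]
    exact ENNReal.tsum_const_eq_top_of_ne_zero (Metric.measure_ball_pos _ _ hδ).ne'
  exact top_le_iff.1 (this ▸ measure_mono (iUnion_subset hb))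

end
end

section
open Set Module Filter Topology MeasureTheory
open scoped RealInnerProductSpace
set_option linter.unusedSectionVars false

section
variable {E : Type*} [NormedAddCommGroup E] [InnerProductSpace ℝ E] [FiniteDimensional ℝ E]

theorem step_noncut' [MeasurableSpace E] [BorelSpace E]
    {K : Set (E × ℝ)} (hc : Convex ℝ K) (hK : IsCompact K) (h1 : ((0:E), (1:ℝ)) ∈ interior K)
    (h2 : ((0:E), (-1:ℝ)) ∈ interior K) :
    ∃ η : E →ₗ[ℝ] ℝ, ∀ c, (∀ w, (w, η w + 1) ∈ K ↔ (w + c, η (w + c) - 1) ∈ K) → c = 0 := by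
  haveI := volHaar (E := E)
  have hKm := hK.isClosed.measurableSet
  let f : E × ℝ → E × ℝ → ℝ := fun q p => |q.2 * p.2 - ⟪q.1, p.1⟫| - |q.2|
  have hf : Continuous (fun q : (E × ℝ) × (E × ℝ) => f q.1 q.2) := by
    simp only [f]; fun_prop
  let D : E × ℝ → ENNReal := fun q => volume (K ∩ {x | 0 < f q x})
  have hD : LowerSemicontinuous D := lsc_meas volume hKm f hf
  have hscale : ∀ (t : ℝ) (q : E × ℝ), t ≠ 0 → D (t • q) = D q := by
    intro t q ht
    simp only [D]
    congr 2
    ext x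
    have : f (t • q) x = |t| * f q x := by
      simp only [f, Prod.smul_fst, Prod.smul_snd, smul_eq_mul, real_inner_smul_left]
      rw [mul_sub, ← abs_mul, ← abs_mul]; congr 2; ring
    simp only [mem_ofPred_eq, this]
    exact mul_pos_iff_of_pos_left (abs_pos.2 ht)
  obtain ⟨q, hq, hqmin⟩ := (hD.lowerSemicontinuousOn (Metric.sphere 0 1)).exists_isMinOn
    ⟨((0:E), (1:ℝ)), by simp [Prod.norm_def]⟩ (isCompact_sphere _ _)
  have hq0 : q ≠ 0 := by rintro rfl; simp at hq
  have hall : ∀ q', q' ≠ 0 → D q ≤ D q' := by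
    intro q' h
    rw [← hscale (‖q'‖⁻¹) q' (inv_ne_zero (norm_ne_zero_iff.2 h))]
    refine hqmin ?_
    simp [norm_smul, h]
  have h0 : ((0:E), (0:ℝ)) ∈ interior K := by
    have := hc.interior h1 h2 (a := 1/2) (b := 1/2) (by norm_num) (by norm_num) (by norm_num)
    simpa using this
  have hKfin : volume K ≠ ⊤ := hK.measure_lt_top.ne
  have hlt : D ((0:E), (1:ℝ)) < volume K := by
    have hpos : 0 < volume (K ∩ {x : E × ℝ | |x.2| < 1}) := by
      apply Measure.measure_pos_of_mem_nhds volume (x := ((0:E), (0:ℝ)))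
      refine inter_mem (mem_interior_iff_mem_nhds.1 h0) ?_
      exact (isOpen_lt (by fun_prop) continuous_const).mem_nhds (by simp)
    have hm : MeasurableSet (K ∩ {x : E × ℝ | |x.2| < 1}) :=
      hKm.inter (isOpen_lt (by fun_prop) continuous_const).measurableSet
    have hdj : Disjoint (K ∩ {x | 0 < f ((0:E), (1:ℝ)) x}) (K ∩ {x : E × ℝ | |x.2| < 1}) := by
      rw [Set.disjoint_left]
      rintro x ⟨_, a⟩ ⟨_, b⟩
      simp [f] at a b
      linarith
    have hle := measure_mono (μ := (volume : Measure (E × ℝ)))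
      (union_subset inter_subset_left inter_subset_left :
      (K ∩ {x | 0 < f ((0:E), (1:ℝ)) x}) ∪ (K ∩ {x : E × ℝ | |x.2| < 1}) ⊆ K)
    rw [measure_union hdj hm] at hle
    refine lt_of_lt_of_le (ENNReal.lt_add_right ?_ hpos.ne') hle
    exact ne_top_of_le_ne_top hKfin (measure_mono inter_subset_left)
  have hq2 : q.2 ≠ 0 := by
    intro hz
    have hq1 : q.1 ≠ 0 := fun h => hq0 (Prod.ext h hz)
    let Wn : Submodule ℝ (E × ℝ) := LinearMap.ker ((innerₛₗ ℝ q.1).comp (LinearMap.fst ℝ E ℝ))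
    have hWn : volume (Wn : Set (E × ℝ)) = 0 := by
      apply Measure.addHaar_submodule
      intro h
      have : ((q.1, 0) : E × ℝ) ∈ Wn := h ▸ Submodule.mem_top
      simp [Wn] at this
      exact hq1 this
    have h3 : volume K ≤ D q := by
      have : K ⊆ (K ∩ {x | 0 < f q x}) ∪ (Wn : Set (E × ℝ)) := by
        intro x hx
        by_cases h : x ∈ Wn
        · exact Or.inr h
        · left
          refine ⟨hx, ?_⟩
          have h' : ⟪q.1, x.1⟫ ≠ 0 := by simpa [Wn] using h
          simp [f, hz, h']
      refine (measure_mono this).trans ((measure_union_le _ _).trans ?_)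
      rw [hWn, add_zero]
    exact absurd (h3.trans (hall ((0:E), (1:ℝ)) (by simp))) (not_le.2 hlt)
  set y := q.2⁻¹ • q.1 with hy
  have hDy : D (y, 1) = D q := by
    rw [← hscale q.2⁻¹ q (inv_ne_zero hq2)]
    congr 1
    ext <;> simp [hy, hq2]
  have hsum : ∀ y' : E, D (y', 1) = volume (K ∩ {p : E × ℝ | p.2 < (innerₛₗ ℝ y') p.1 + (-1)}) +
      volume (K ∩ {p : E × ℝ | (innerₛₗ ℝ y') p.1 + 1 < p.2}) := by
    intro y'
    have hm : MeasurableSet (K ∩ {p : E × ℝ | (innerₛₗ ℝ y') p.1 + 1 < p.2}) := by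
      refine hKm.inter (isOpen_lt ?_ (by fun_prop)).measurableSet
      simp only [innerₛₗ_apply_apply]; fun_prop
    rw [← measure_union ?_ hm]
    · simp only [D]
      congr 1
      ext p
      simp only [f, mem_inter_iff, mem_union, mem_ofPred_eq, innerₛₗ_apply_apply, abs_one, sub_pos, one_mul,
        ← and_or_left, lt_abs]
      refine and_congr Iff.rfl ?_
      constructor
      · rintro (h | h)
        · right; linarith
        · left; linarith
      · rintro (h | h)
        · right; linarith
        · left; linarith
    · rw [Set.disjoint_left]
      rintro x ⟨_, a⟩ ⟨_, b⟩
      simp only [mem_ofPred_eq] at a b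
      linarith
  refine ⟨innerₛₗ ℝ y, fun c hcc => ?_⟩
  obtain ⟨M, hM⟩ := hK.isBounded.exists_norm_le
  refine min_lemma hc hK.isClosed hc hK.isClosed (innerₛₗ ℝ y) (s := -1) (s' := 1) h2 h1 c hcc (M := M) one_pos ?_ ?_ ?_
  · intro ε _ w Z h _; exact hM _ h
  · intro ε _ w Z h _; exact hM _ h
  · intro ε _
    have e : innerₛₗ ℝ y + ε • innerₛₗ ℝ c = innerₛₗ ℝ (y + ε • c) := by
      ext x; simp [inner_add_left, real_inner_smul_left]
    rw [e, ← hsum, ← hsum, hDy]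
    exact hall _ (by simp)

theorem step_noncut 
    {K : Set (E × ℝ)} (hc : Convex ℝ K) (hK : IsCompact K) (h1 : ((0:E), (1:ℝ)) ∈ interior K)
    (h2 : ((0:E), (-1:ℝ)) ∈ interior K) :
    ∃ η : E →ₗ[ℝ] ℝ, ∀ c, (∀ w, (w, η w + 1) ∈ K ↔ (w + c, η (w + c) - 1) ∈ K) → c = 0 := by
  borelize E
  exact step_noncut' hc hK h1 h2

theorem cone_bound {R : Set (E × ℝ)} (hR : IsClosed R) (hRs : ∀ r ∈ R, ∀ t : ℝ, 0 ≤ t → t • r ∈ R)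
    {u : E × ℝ → ℝ} (hu : Continuous u) (hus : ∀ (t : ℝ) r, u (t • r) = t * u r)
    (hp : ∀ r ∈ R, r ≠ 0 → 0 < u r) :
    ∃ ρ > 0, ∀ r ∈ R, ρ * ‖r‖ ≤ u r := by
  by_cases hne : (R ∩ Metric.sphere 0 1).Nonempty
  · obtain ⟨r0, hr0, hmin⟩ := ((isCompact_sphere (0 : E × ℝ) 1).inter_left hR).exists_isMinOn hne hu.continuousOn
    have hr00 : r0 ≠ 0 := by rintro rfl; simp at hr0
    refine ⟨u r0, hp r0 hr0.1 hr00, fun r hr => ?_⟩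
    by_cases h : r = 0
    · subst h
      have := hus 0 (0 : E × ℝ)
      simp at this; simp [this]
    have hn : 0 < ‖r‖ := norm_pos_iff.2 h
    have := hmin (a := ‖r‖⁻¹ • r) ⟨hRs r hr _ (by positivity), by simp [norm_smul, h]⟩
    simp only [mem_ofPred_eq, hus] at this
    rw [inv_mul_eq_div, le_div_iff₀ hn] at this
    exact this
  · refine ⟨1, one_pos, fun r hr => ?_⟩
    by_cases h : r = 0
    · subst h
      have := hus 0 (0 : E × ℝ)
      simp at this; simp [this]
    · exact absurd ⟨‖r‖⁻¹ • r, hRs r hr _ (by positivity), by simp [norm_smul, h]⟩ hne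

theorem step_cut' [MeasurableSpace E] [BorelSpace E]
    {A B R : Set (E × ℝ)} (hA : Convex ℝ A) (hAcl : IsClosed A) (hB : Convex ℝ B) (hBcl : IsClosed B)
    (hR : IsClosed R) (hRs : ∀ r ∈ R, ∀ t : ℝ, 0 ≤ t → t • r ∈ R) (hRp : ∀ r ∈ R, r ≠ 0 → 0 < r.2)
    (hR1 : ((0:E), (1:ℝ)) ∈ R) (hBR : ∀ b ∈ B, ∀ r ∈ R, b + r ∈ B) (hAR : ∀ a ∈ A, ∀ r ∈ R, a - r ∈ A)
    (hAB : ∀ a ∈ A, ∀ b ∈ B, b - a ∈ R)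
    (h1 : ((0:E), (1:ℝ)) ∈ interior B) (h2 : ((0:E), (-1:ℝ)) ∈ interior A) :
    ∃ η : E →ₗ[ℝ] ℝ, (∀ r ∈ R, r ≠ 0 → η r.1 < r.2) ∧
      ∀ c, (∀ w, (w, η w - 1) ∈ A ↔ (w + c, η (w + c) + 1) ∈ B) → c = 0 := by
  haveI := volHaar (E := E)
  have h1' := interior_subset h1
  have h2' := interior_subset h2
  let fA : E × ℝ → E × ℝ → ℝ := fun q p => q.2 * p.2 - ⟪q.1, p.1⟫ + q.2
  let fB : E × ℝ → E × ℝ → ℝ := fun q p => q.2 - (q.2 * p.2 - ⟪q.1, p.1⟫)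
  have hfA : Continuous (fun q : (E × ℝ) × (E × ℝ) => fA q.1 q.2) := by
    simp only [fA]; fun_prop
  have hfB : Continuous (fun q : (E × ℝ) × (E × ℝ) => fB q.1 q.2) := by
    simp only [fB]; fun_prop
  let D : E × ℝ → ENNReal := fun q => volume (A ∩ {x | 0 < fA q x}) + volume (B ∩ {x | 0 < fB q x})
  have hD : LowerSemicontinuous D := (lsc_meas volume hAcl.measurableSet fA hfA).add
    (lsc_meas volume hBcl.measurableSet fB hfB)
  have hscale : ∀ (t : ℝ) (q : E × ℝ), 0 < t → D (t • q) = D q := by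
    intro t q ht
    simp only [D]
    congr 3
    · ext x
      have : fA (t • q) x = t * fA q x := by
        simp only [fA, Prod.smul_fst, Prod.smul_snd, smul_eq_mul, real_inner_smul_left]; ring
      simp only [mem_ofPred_eq, this]
      exact mul_pos_iff_of_pos_left ht
    · ext x
      have : fB (t • q) x = t * fB q x := by
        simp only [fB, Prod.smul_fst, Prod.smul_snd, smul_eq_mul, real_inner_smul_left]; ring
      simp only [mem_ofPred_eq, this]
      exact mul_pos_iff_of_pos_left ht
  obtain ⟨q, hq, hqmin⟩ := (hD.lowerSemicontinuousOn (Metric.sphere 0 1)).exists_isMinOn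
    ⟨((0:E), (1:ℝ)), by simp [Prod.norm_def]⟩ (isCompact_sphere _ _)
  have hq0 : q ≠ 0 := by rintro rfl; simp at hq
  have hall : ∀ q', q' ≠ 0 → D q ≤ D q' := by
    intro q' h
    rw [← hscale (‖q'‖⁻¹) q' (inv_pos.2 (norm_pos_iff.2 h))]
    refine hqmin ?_
    simp [norm_smul, h]
  -- bounded caps
  have caps : ∀ (η : E →ₗ[ℝ] ℝ) (ρ : ℝ), 0 < ρ → (∀ r ∈ R, ρ * ‖r‖ ≤ r.2 - η r.1) →
      (∀ w Z, (w, Z) ∈ B → Z ≤ η w + 1 → ‖(w, Z)‖ ≤ 2 / ρ + 1) ∧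
      (∀ w Z, (w, Z) ∈ A → η w + (-1) ≤ Z → ‖(w, Z)‖ ≤ 2 / ρ + 1) := by
    intro η ρ hρ h
    constructor
    · intro w Z hw hZ
      have := h _ (hAB _ h2' _ hw)
      simp only [Prod.mk_sub_mk, sub_zero, sub_neg_eq_add, zero_sub, map_neg] at this
      have h3 : ‖((w, Z + 1) : E × ℝ)‖ ≤ 2 / ρ := by
        rw [le_div_iff₀ hρ]; linarith
      have h4 : ((w, Z) : E × ℝ) = (w, Z + 1) - (0, 1) := by simp
      rw [h4]
      refine (norm_sub_le _ _).trans ?_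
      have : ‖((0, 1) : E × ℝ)‖ = 1 := by simp [Prod.norm_def]
      linarith
    · intro w Z hw hZ
      have := h _ (hAB _ hw _ h1')
      simp only [Prod.mk_sub_mk, sub_zero, sub_neg_eq_add, zero_sub, map_neg] at this
      have h3 : ‖((-w, 1 - Z) : E × ℝ)‖ ≤ 2 / ρ := by
        rw [le_div_iff₀ hρ]; linarith
      have h4 : ((w, Z) : E × ℝ) = (0, 1) - (-w, 1 - Z) := by simp
      rw [h4]
      refine (norm_sub_le _ _).trans ?_
      have : ‖((0, 1) : E × ℝ)‖ = 1 := by simp [Prod.norm_def]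
      linarith
  have hsum : ∀ y' : E, D (y', 1) = volume (B ∩ {p : E × ℝ | p.2 < (innerₛₗ ℝ y') p.1 + 1}) +
      volume (A ∩ {p : E × ℝ | (innerₛₗ ℝ y') p.1 + (-1) < p.2}) := by
    intro y'
    rw [add_comm]
    simp only [D]
    congr 3
    · ext p
      simp only [fA, mem_ofPred_eq, innerₛₗ_apply_apply]
      constructor <;> intro h <;> linarith
    · ext p
      simp only [fB, mem_ofPred_eq, innerₛₗ_apply_apply]
      constructor <;> intro h <;> linarith
  have hfin1 : D ((0:E), (1:ℝ)) ≠ ⊤ := by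
    rw [hsum]
    obtain ⟨ρ, hρ, hρR⟩ := cone_bound hR hRs (u := fun r => r.2) (by fun_prop) (by simp) hRp
    obtain ⟨cB, cA⟩ := caps 0 ρ hρ (by simpa using hρR)
    rw [ENNReal.add_ne_top]
    constructor
    · refine ne_top_of_le_ne_top (b := volume (Metric.closedBall (0 : E × ℝ) (2 / ρ + 1)))
        (isCompact_closedBall _ _).measure_lt_top.ne (measure_mono ?_)
      rintro ⟨w, Z⟩ ⟨h1, h2⟩
      have := cB w Z h1 (by simp at h2 ⊢; linarith)
      simpa using this
    · refine ne_top_of_le_ne_top (b := volume (Metric.closedBall (0 : E × ℝ) (2 / ρ + 1)))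
        (isCompact_closedBall _ _).measure_lt_top.ne (measure_mono ?_)
      rintro ⟨w, Z⟩ ⟨h1, h2⟩
      have := cA w Z h1 (by simp at h2 ⊢; linarith)
      simpa using this
  have hfin : D q ≠ ⊤ := ne_top_of_le_ne_top hfin1 (hall _ (by simp))
  let u : E × ℝ → ℝ := fun r => q.2 * r.2 - ⟪q.1, r.1⟫
  have hucont : Continuous u := by simp only [u]; fun_prop
  have hadd : ∀ x y, u (x + y) = u x + u y := by
    intro x y; simp only [u, Prod.fst_add, Prod.snd_add, inner_add_right]; ring
  have husm : ∀ (t : ℝ) x, u (t • x) = t * u x := by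
    intro t x; simp only [u, Prod.smul_fst, Prod.smul_snd, smul_eq_mul, real_inner_smul_right]; ring
  have hup : ∀ r ∈ R, r ≠ 0 → 0 < u r := by
    intro r hr hr0
    by_contra hle
    push Not at hle
    -- a direction where u is negative
    obtain ⟨v, hv⟩ : ∃ v, u v < 0 := by
      refine ⟨(q.1, -q.2), ?_⟩
      simp only [u, real_inner_self_eq_norm_sq]
      by_contra h
      push Not at h
      have h3 : ‖q.1‖ ^ 2 = 0 := by nlinarith [sq_nonneg ‖q.1‖, sq_nonneg q.2]
      have h4 : q.2 ^ 2 = 0 := by nlinarith [sq_nonneg ‖q.1‖, sq_nonneg q.2]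
      exact hq0 (Prod.ext (by simpa using h3) (by simpa using h4))
    have hcv : Tendsto (fun t : ℝ => ((0:E), (1:ℝ)) + t • v) (𝓝[>] 0) (𝓝 ((0:E), (1:ℝ))) := by
      have : Continuous (fun t : ℝ => ((0:E), (1:ℝ)) + t • v) := by fun_prop
      have h := this.tendsto 0
      simp only [zero_smul, add_zero] at h
      exact h.mono_left nhdsWithin_le_nhds
    obtain ⟨t, ht, ht0⟩ := ((hcv.eventually (mem_interior_iff_mem_nhds.1 (by rwa [interior_interior] :
      ((0:E), (1:ℝ)) ∈ interior (interior B)))).and self_mem_nhdsWithin).exists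
    have ht0' : (0:ℝ) < t := ht0
    have hop : IsOpen (interior B ∩ {x | 0 < fB q x}) := by
      refine isOpen_interior.inter (isOpen_lt continuous_const ?_)
      simp only [fB]; fun_prop
    have hfu : ∀ x, fB q x = q.2 - u x := fun x => rfl
    have hmem : ((0:E), (1:ℝ)) + t • v ∈ interior B ∩ {x | 0 < fB q x} := by
      refine ⟨ht, ?_⟩
      simp only [mem_ofPred_eq, hfu, hadd, husm]
      have : u ((0:E), (1:ℝ)) = q.2 := by simp [u]
      nlinarith
    obtain ⟨δ, hδ, hsub⟩ := Metric.isOpen_iff.1 hop _ hmem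
    have htop : volume (B ∩ {x | 0 < fB q x}) = ⊤ := by
      refine vol_top (x := ((0:E), (1:ℝ)) + t • v) hδ hr0 (fun s hs y hy => ?_)
      obtain ⟨a, b⟩ := hsub hy
      refine ⟨hBR _ (interior_subset a) _ (hRs r hr s hs), ?_⟩
      simp only [mem_ofPred_eq, hfu, hadd, husm] at b ⊢
      nlinarith
    exact hfin (by simp only [D]; rw [htop]; simp)
  have hq2 : 0 < q.2 := by
    have := hup _ hR1 (by simp)
    simpa [u] using this
  set y := q.2⁻¹ • q.1 with hy
  have hDy : D (y, 1) = D q := by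
    rw [← hscale q.2⁻¹ q (inv_pos.2 hq2)]
    congr 1
    ext
    · simp [hy]
    · simp [hq2.ne']
  have hηu : ∀ r : E × ℝ, r.2 - innerₛₗ ℝ y r.1 = q.2⁻¹ * u r := by
    intro r
    simp only [innerₛₗ_apply_apply, u, hy, real_inner_smul_left]
    field_simp
  have hRη : ∀ r ∈ R, r ≠ 0 → 0 < r.2 - innerₛₗ ℝ y r.1 := by
    intro r hr h0
    rw [hηu]
    have := hup r hr h0
    positivity
  refine ⟨innerₛₗ ℝ y, fun r hr h0 => by linarith [hRη r hr h0], fun c hcc => ?_⟩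
  obtain ⟨ρ, hρ, hρR⟩ := cone_bound hR hRs (u := fun r => r.2 - innerₛₗ ℝ y r.1)
    (by simp only [innerₛₗ_apply_apply]; fun_prop) (by intro t r; simp; ring) hRη
  set ε0 := ρ / (2 * (‖c‖ + 1)) with hε0
  have hcpos : 0 < ‖c‖ + 1 := by positivity
  have hcaps : ∀ ε, |ε| < ε0 → ∀ r ∈ R, (ρ / 2) * ‖r‖ ≤ r.2 - (innerₛₗ ℝ y + ε • innerₛₗ ℝ c) r.1 := by
    intro ε hε r hr
    have h3 := hρR r hr
    have h4 : |⟪c, r.1⟫| ≤ ‖c‖ * ‖r‖ := (abs_real_inner_le_norm _ _).trans (by gcongr; exact norm_fst_le r)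
    have h5 : |ε * ⟪c, r.1⟫| ≤ ρ / 2 * ‖r‖ := by
      rw [abs_mul]
      calc |ε| * |⟪c, r.1⟫| ≤ ε0 * ((‖c‖ + 1) * ‖r‖) := by
            refine mul_le_mul hε.le (h4.trans ?_) (abs_nonneg _) (by positivity)
            gcongr; linarith
        _ = ρ / 2 * ‖r‖ := by rw [hε0]; field_simp
    have h6 := (abs_le.1 h5).2
    simp only [LinearMap.add_apply, LinearMap.smul_apply, innerₛₗ_apply_apply, smul_eq_mul] at h3 ⊢
    linarith
  refine min_lemma hB hBcl hA hAcl (innerₛₗ ℝ y) (s := 1) (s' := -1) h1 h2 c hcc (M := 2 / (ρ / 2) + 1)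
    (ε0 := ε0) (by positivity) ?_ ?_ ?_
  · intro ε hε
    exact (caps _ (ρ / 2) (by positivity) (hcaps ε hε)).1
  · intro ε hε
    exact (caps _ (ρ / 2) (by positivity) (hcaps ε hε)).2
  · intro ε _
    have e : innerₛₗ ℝ y + ε • innerₛₗ ℝ c = innerₛₗ ℝ (y + ε • c) := by
      ext x; simp [inner_add_left, real_inner_smul_left]
    rw [e, ← hsum, ← hsum, hDy]
    exact hall _ (by simp)

theorem step_cut
    {A B R : Set (E × ℝ)} (hA : Convex ℝ A) (hAcl : IsClosed A) (hB : Convex ℝ B) (hBcl : IsClosed B)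
    (hR : IsClosed R) (hRs : ∀ r ∈ R, ∀ t : ℝ, 0 ≤ t → t • r ∈ R) (hRp : ∀ r ∈ R, r ≠ 0 → 0 < r.2)
    (hR1 : ((0:E), (1:ℝ)) ∈ R) (hBR : ∀ b ∈ B, ∀ r ∈ R, b + r ∈ B) (hAR : ∀ a ∈ A, ∀ r ∈ R, a - r ∈ A)
    (hAB : ∀ a ∈ A, ∀ b ∈ B, b - a ∈ R)
    (h1 : ((0:E), (1:ℝ)) ∈ interior B) (h2 : ((0:E), (-1:ℝ)) ∈ interior A) :
    ∃ η : E →ₗ[ℝ] ℝ, (∀ r ∈ R, r ≠ 0 → η r.1 < r.2) ∧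
      ∀ c, (∀ w, (w, η w - 1) ∈ A ↔ (w + c, η (w + c) + 1) ∈ B) → c = 0 := by
  borelize E
  exact step_cut' hA hAcl hB hBcl hR hRs hRp hR1 hBR hAR hAB h1 h2

end
end

section
open Set Module Filter Topology
open scoped RealInnerProductSpace
set_option linter.unusedSectionVars false

section
variable {E : Type*} [NormedAddCommGroup E] [InnerProductSpace ℝ E] [FiniteDimensional ℝ E]

/-- standing assumptions on a closed convex set -/
structure Good (T : Set (E × ℝ)) (M : ℝ) : Prop where
  cl : IsClosed T
  conv : Convex ℝ T
  o_int : ((0:E), (1:ℝ)) ∈ interior T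
  Mpos : 0 < M
  bd : ∀ p ∈ T, ‖p.1‖ ≤ M * (p.2 + M)

/-- translation property for the plane pair of slope `m` in direction `n` -/
def Tr (T : Set (E × ℝ)) (n : E) (m : ℝ) (t : E × ℝ) : Prop :=
  t.2 = 2 + m * ⟪n, t.1⟫ ∧ ∀ p : E × ℝ, p.2 = m * ⟪n, p.1⟫ - 1 → (p ∈ T ↔ p + t ∈ T)

theorem Tr.back {T : Set (E × ℝ)} {n : E} {m : ℝ} {t : E × ℝ} (h : Tr T n m t) (p : E × ℝ)
    (hp : p.2 = m * ⟪n, p.1⟫ + 1) : p ∈ T ↔ p + (-t) ∈ T := by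
  have := h.2 (p - t) (by
    simp only [Prod.snd_sub, Prod.fst_sub, inner_sub_right, h.1, hp]; ring)
  rw [sub_add_cancel] at this
  rw [← this, sub_eq_add_neg]

theorem Tr.ne {T : Set (E × ℝ)} {n : E} {m : ℝ} {t : E × ℝ} (h : Tr T n m t) : t ≠ 0 := by
  rintro rfl
  have := h.1
  simp at this

theorem tend_inv {m : ℕ → ℝ} (hm : Tendsto (fun j => |m j|) atTop atTop) (a : ℝ) :
    Tendsto (fun j => a / m j) atTop (𝓝 0) := by
  rw [tendsto_zero_iff_abs_tendsto_zero]
  have : (abs ∘ fun j => a / m j) = fun j => |a| / |m j| := by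
    ext j; simp [abs_div]
  rw [this]
  exact hm.const_div_atTop _

theorem ev_ne {m : ℕ → ℝ} (hm : Tendsto (fun j => |m j|) atTop atTop) : ∀ᶠ j in atTop, m j ≠ 0 := by
  filter_upwards [hm.eventually (eventually_gt_atTop 0)] with j hj
  exact abs_pos.1 hj

theorem tend_shift {m : ℕ → ℝ} (hm : Tendsto (fun j => |m j|) atTop atTop) (n : E) (x : E × ℝ) (a : ℝ) :
    Tendsto (fun j => x + ((a / m j) • n, (0:ℝ))) atTop (𝓝 x) := by
  have h1 := (tend_inv hm a).smul_const n
  have h2 : Tendsto (fun j => ((a / m j) • n, (0:ℝ))) atTop (𝓝 ((0:ℝ) • n, (0:ℝ))) :=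
    h1.prodMk_nhds tendsto_const_nhds
  have := h2.const_add x
  rw [zero_smul, Prod.mk_zero_zero, add_zero] at this
  exact this

theorem conv_to_o {T : Set (E × ℝ)} {M : ℝ} (hT : Good T M) {x : E × ℝ} (hx : x ∈ T) {θ : ℝ} (h0 : 0 < θ) (h1 : θ ≤ 1) :
    (1 - θ) • x + θ • ((0:E), (1:ℝ)) ∈ interior T :=
  hT.conv.combo_self_interior_mem_interior hx hT.o_int (by linarith) h0 (by ring)

theorem lim_step {T : Set (E × ℝ)} {M : ℝ} (hT : Good T M) {n : E} (hn : ‖n‖ = 1) {m : ℕ → ℝ}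
    (hm : Tendsto (fun j => |m j|) atTop atTop) {t : ℕ → E × ℝ} {t0 : E × ℝ} (ht : Tendsto t atTop (𝓝 t0)) {s : ℝ}
    (hs : ∀ j, ∀ p : E × ℝ, p.2 = m j * ⟪n, p.1⟫ + s → p ∈ T → p + t j ∈ T) {x : E × ℝ} (hx : x ∈ T)
    (hxn : ⟪n, x.1⟫ = 0) : x + t0 ∈ T := by
  have key : ∀ x ∈ interior T, ⟪n, x.1⟫ = 0 → x + t0 ∈ T := by
    intro x hx hxn
    have h1 := tend_shift hm n x (x.2 - s)
    refine hT.cl.mem_of_tendsto (h1.add ht) ?_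
    filter_upwards [h1.eventually (mem_interior_iff_mem_nhds.1 hx), ev_ne hm] with j hj hmj
    refine hs j _ ?_ hj
    simp only [Prod.snd_add, Prod.fst_add, inner_add_right, real_inner_smul_right, hxn,
      real_inner_self_eq_norm_sq, hn]
    field_simp; ring
  have hc : Tendsto (fun θ : ℝ => (1 - θ) • x + θ • ((0:E), (1:ℝ)) + t0) (𝓝[>] 0) (𝓝 (x + t0)) := by
    have : Continuous (fun θ : ℝ => (1 - θ) • x + θ • ((0:E), (1:ℝ)) + t0) := by fun_prop
    have h := this.tendsto 0
    simp only [sub_zero, one_smul, zero_smul, add_zero] at h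
    exact h.mono_left nhdsWithin_le_nhds
  refine hT.cl.mem_of_tendsto hc ?_
  filter_upwards [Ioo_mem_nhdsGT (zero_lt_one : (0:ℝ) < 1)] with θ hθ
  refine key _ (conv_to_o hT hx hθ.1 hθ.2.le) ?_
  simp [real_inner_smul_right, hxn]

theorem no_line {T : Set (E × ℝ)} {M : ℝ} (hT : Good T M) {x v : E × ℝ} (h : ∀ k : ℕ, x + (k:ℝ) • v ∈ T)
    (h' : ∀ k : ℕ, x - (k:ℝ) • v ∈ T) : v = 0 := by
  have hM := hT.Mpos
  have b1 : ∀ k : ℕ, k * ‖v.1‖ ≤ ‖x.1‖ + M * (x.2 + k * v.2 + M) := by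
    intro k
    have := hT.bd _ (h k)
    simp only [Prod.fst_add, Prod.smul_fst, Prod.snd_add, Prod.smul_snd, smul_eq_mul] at this
    have h2 : ‖(k:ℝ) • v.1‖ ≤ ‖x.1 + (k:ℝ) • v.1‖ + ‖x.1‖ := by
      have := norm_sub_le (x.1 + (k:ℝ) • v.1) x.1
      simpa using this
    rw [norm_smul, Real.norm_natCast] at h2
    linarith
  have b2 : ∀ k : ℕ, k * ‖v.1‖ ≤ ‖x.1‖ + M * (x.2 - k * v.2 + M) := by
    intro k
    have := hT.bd _ (h' k)
    simp only [Prod.fst_sub, Prod.smul_fst, Prod.snd_sub, Prod.smul_snd, smul_eq_mul] at this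
    have h2 : ‖(k:ℝ) • v.1‖ ≤ ‖x.1 - (k:ℝ) • v.1‖ + ‖x.1‖ := by
      have := norm_sub_le (x.1 - (k:ℝ) • v.1) x.1
      simpa using this
    rw [norm_smul, Real.norm_natCast] at h2
    linarith
  have arch : ∀ a b : ℝ, (∀ k : ℕ, k * a ≤ b) → a ≤ 0 := by
    intro a b hab
    by_contra h
    push Not at h
    obtain ⟨k, hk⟩ := exists_nat_gt (b / a)
    rw [div_lt_iff₀ h] at hk
    linarith [hab k]
  have v1 : ‖v.1‖ ≤ 0 := arch _ (‖x.1‖ + M * (x.2 + M)) (fun k => by nlinarith [b1 k, b2 k])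
  have nn : ∀ k : ℕ, 0 ≤ k * ‖v.1‖ := fun k => by positivity
  have v2 : M * v.2 ≤ 0 := arch _ (‖x.1‖ + M * (x.2 + M)) (fun k => by nlinarith [b2 k, nn k])
  have v3 : -(M * v.2) ≤ 0 := arch _ (‖x.1‖ + M * (x.2 + M)) (fun k => by nlinarith [b1 k, nn k])
  refine Prod.ext (norm_le_zero_iff.1 v1) ?_
  have : M * v.2 = 0 := by linarith
  simpa [hM.ne'] using this

theorem Tr_bounded {T : Set (E × ℝ)} {M : ℝ} (hT : Good T M) {n : E} (hn : ‖n‖ = 1) {m : ℕ → ℝ}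
    (hm : Tendsto (fun j => |m j|) atTop atTop) {t : ℕ → E × ℝ} (ht : ∀ j, Tr T n (m j) (t j)) :
    ∃ B, ∀ᶠ j in atTop, ‖t j‖ ≤ B := by
  have hM := hT.Mpos
  refine ⟨max (M * (1 + M) + 1) (1 + M), ?_⟩
  have h1 := tend_shift hm n ((0:E), (1:ℝ)) 2
  filter_upwards [h1.eventually (mem_interior_iff_mem_nhds.1 hT.o_int), ev_ne hm,
    hm.eventually (eventually_ge_atTop 1)] with j hj hmj hm1
  have q1 := ((ht j).back ((0:E), (1:ℝ)) (by simp)).1 (interior_subset hT.o_int)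
  have q2 := ((ht j).2 _ (by
    simp only [Prod.snd_add, Prod.fst_add, inner_add_right, real_inner_smul_right, real_inner_self_eq_norm_sq, hn,
      inner_zero_right]
    field_simp; ring)).1 hj
  have e1 := hT.bd _ q1
  have e2 := hT.bd _ q2
  simp only [Prod.fst_add, Prod.snd_add, Prod.fst_neg, Prod.snd_neg, zero_add, norm_neg, add_zero] at e1 e2
  have e3 : ‖(t j).1‖ ≤ ‖(2 / m j) • n + (t j).1‖ + 2 := by
    have h3 := norm_sub_le ((2 / m j) • n + (t j).1) ((2 / m j) • n)
    rw [add_sub_cancel_left, norm_smul, hn, mul_one, Real.norm_eq_abs, abs_div] at h3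
    have : |(2:ℝ)| / |m j| ≤ 2 := by
      rw [div_le_iff₀ (by linarith)]; norm_num; linarith
    linarith
  have n1 := norm_nonneg (t j).1
  have n2 := norm_nonneg ((2 / m j) • n + (t j).1)
  have f1 : 0 ≤ 1 + -(t j).2 + M := by
    by_contra h; push Not at h; nlinarith
  have f2 : 0 ≤ 1 + (t j).2 + M := by
    by_contra h; push Not at h; nlinarith
  rw [Prod.norm_def]
  refine max_le_max ?_ ?_
  · nlinarith
  · rw [Real.norm_eq_abs, abs_le]; constructor <;> linarith

theorem VT {T : Set (E × ℝ)} {M : ℝ} (hT : Good T M) {n : E} (hn : ‖n‖ = 1) {m : ℕ → ℝ}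
    (hm : Tendsto (fun j => |m j|) atTop atTop) {t : ℕ → E × ℝ} (ht : ∀ j, Tr T n (m j) (t j)) :
    Tendsto t atTop (𝓝 0) := by
  by_contra hcon
  obtain ⟨B, hB⟩ := Tr_bounded hT hn hm ht
  rw [Metric.tendsto_atTop] at hcon
  push Not at hcon
  obtain ⟨ε, hε, hfreq⟩ := hcon
  have hfr : ∃ᶠ j in atTop, ε ≤ ‖t j‖ ∧ ‖t j‖ ≤ B := by
    have : ∃ᶠ j in atTop, ε ≤ ‖t j‖ := by
      rw [frequently_atTop]
      intro N
      obtain ⟨k, hk, h⟩ := hfreq N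
      exact ⟨k, hk, by simpa using h⟩
    exact this.and_eventually hB
  obtain ⟨φ, hφ, hφ2⟩ := extraction_of_frequently_atTop hfr
  obtain ⟨t0, -, ψ, hψ, hlim⟩ := (isCompact_closedBall (0 : E × ℝ) B).tendsto_subseq (x := t ∘ φ)
    (fun k => by simpa using (hφ2 k).2)
  have hsub : Tendsto (φ ∘ ψ) atTop atTop := hφ.tendsto_atTop.comp hψ.tendsto_atTop
  have hm' : Tendsto (fun k => |m (φ (ψ k))|) atTop atTop := hm.comp hsub
  have ht0 : ε ≤ ‖t0‖ := by
    refine ge_of_tendsto hlim.norm (Eventually.of_forall fun k => (hφ2 (ψ k)).1)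
  have hn0 : ⟪n, t0.1⟫ = 0 := by
    have l1 : Tendsto (fun k => ⟪n, (t (φ (ψ k))).1⟫) atTop (𝓝 ⟪n, t0.1⟫) := by
      have : Continuous (fun p : E × ℝ => ⟪n, p.1⟫) := by fun_prop
      exact (this.tendsto t0).comp hlim
    have l2 : Tendsto (fun k => ((t (φ (ψ k))).2 - 2) / m (φ (ψ k))) atTop (𝓝 0) := by
      have c1 : Tendsto (fun k => (t (φ (ψ k))).2 - 2) atTop (𝓝 (t0.2 - 2)) :=
        ((continuous_snd.tendsto t0).comp hlim).sub_const 2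
      have c2 := tend_inv hm' 1
      have := c1.mul c2
      simp only [mul_zero] at this
      refine this.congr (fun k => ?_)
      rw [mul_one_div]
    refine tendsto_nhds_unique l1 (l2.congr' ?_)
    filter_upwards [ev_ne hm'] with k hk
    rw [(ht _).1]
    field_simp; ring
  have s1 : ∀ x ∈ T, ⟪n, x.1⟫ = 0 → x + t0 ∈ T := fun x hx hxn =>
    lim_step hT hn hm' hlim (s := -1) (fun k p hp h => ((ht _).2 p (by rw [hp]; ring)).1 h) hx hxn
  have s2 : ∀ x ∈ T, ⟪n, x.1⟫ = 0 → x + -t0 ∈ T := fun x hx hxn =>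
    lim_step hT hn hm' hlim.neg (s := 1) (fun k p hp h => ((ht _).back p hp).1 h) hx hxn
  have k1 : ∀ k : ℕ, ((0:E), (1:ℝ)) + (k:ℝ) • t0 ∈ T := by
    intro k
    induction k with
    | zero => simpa using interior_subset hT.o_int
    | succ k ih =>
      have := s1 _ ih (by simp [real_inner_smul_right, hn0])
      convert this using 1
      push_cast; rw [add_smul, one_smul, add_assoc]
  have k2 : ∀ k : ℕ, ((0:E), (1:ℝ)) - (k:ℝ) • t0 ∈ T := by
    intro k
    induction k with
    | zero => simpa using interior_subset hT.o_int
    | succ k ih =>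
      have := s2 _ ih (by simp [real_inner_smul_right, hn0])
      convert this using 1
      push_cast; rw [add_smul, one_smul]; abel
  have := no_line hT k1 k2
  rw [this, norm_zero] at ht0
  linarith

end
end

section
open Set Module Filter Topology
open scoped RealInnerProductSpace
set_option linter.unusedSectionVars false

section
variable {E : Type*} [NormedAddCommGroup E] [InnerProductSpace ℝ E] [FiniteDimensional ℝ E]

theorem S2_half {T : Set (E × ℝ)} {M : ℝ} (hT : Good T M) {n : E} (hn : ‖n‖ = 1) {m : ℕ → ℝ}
    (hm : Tendsto (fun j => |m j|) atTop atTop) {t : ℕ → E × ℝ} (ht : Tendsto t atTop (𝓝 0)) (htn : ∀ j, t j ≠ 0)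
    {τ : E × ℝ} (hτ : Tendsto (fun j => ‖t j‖⁻¹ • t j) atTop (𝓝 τ)) {s : ℝ}
    (hs : ∀ j, ∀ p : E × ℝ, p.2 = m j * ⟪n, p.1⟫ + s → p + t j ∈ T → p ∈ T) {x : E × ℝ} (hx : x ∈ frontier T)
    (hxn : ⟪n, x.1⟫ = 0) {u : ℝ} (hu : 0 < u) : x + u • τ ∉ interior T := by
  intro hcon
  set o : E × ℝ := ((0:E), (1:ℝ)) with ho
  let y : ℝ → ℝ → E × ℝ := fun r μ => o + r • (x - o) + (((1 + r * (x.2 - 1) - s) * μ) • n, (0:ℝ))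
  have hy2 : ∀ r μ, (y r μ).2 = 1 + r * (x.2 - 1) := by intro r μ; simp [y, ho]
  have hyp : ∀ r μ, μ ≠ 0 → (y r μ).2 = μ⁻¹ * ⟪n, (y r μ).1⟫ + s := by
    intro r μ hμ
    rw [hy2]
    simp only [y, ho, Prod.fst_add, Prod.smul_fst, Prod.fst_sub, inner_add_right, real_inner_smul_right, inner_sub_right,
      hxn, inner_zero_right, real_inner_self_eq_norm_sq, hn]
    field_simp; ring
  have hyc : Continuous (fun q : ℝ × ℝ => y q.1 q.2) := by simp only [y]; fun_prop
  have hμ : Tendsto (fun j => (m j)⁻¹) atTop (𝓝 0) := by simpa using tend_inv hm 1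
  -- neighborhood
  have hg : Continuous (fun q : ℝ × (ℝ × (E × ℝ)) => y q.1 q.2.1 + u • q.2.2) := by
    have : Continuous (fun q : ℝ × (ℝ × (E × ℝ)) => y q.1 q.2.1) :=
      hyc.comp (by fun_prop : Continuous fun q : ℝ × (ℝ × (E × ℝ)) => (q.1, q.2.1))
    fun_prop
  have hy10 : y 1 0 = x := by
    simp only [y, ho]; ext <;> simp
  have hev : ∀ᶠ q in 𝓝 ((1:ℝ), ((0:ℝ), τ)), y q.1 q.2.1 + u • q.2.2 ∈ interior T := by
    refine hg.continuousAt.eventually (isOpen_interior.mem_nhds ?_)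
    simpa only [hy10] using hcon
  rw [nhds_prod_eq, eventually_prod_iff] at hev
  obtain ⟨pa, hpa, pb, hpb, hP⟩ := hev
  obtain ⟨θ0, hθ0, hball⟩ := Metric.eventually_nhds_iff.1 hpa
  set θ := min (θ0 / 2) (1 / 2) with hθ
  have hθp : 0 < θ := lt_min (by linarith) (by norm_num)
  have hθ1 : θ ≤ 1 / 2 := min_le_right _ _
  have hθ2 : θ < θ0 := lt_of_le_of_lt (min_le_left _ _) (by linarith)
  have hxT : x ∈ T := hT.cl.frontier_subset hx
  -- end points
  have hylo : y (1 - θ) 0 ∈ interior T := by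
    have := conv_to_o hT hxT hθp (by linarith)
    convert this using 1
    simp only [y, ho]; ext
    · simp
    · simp; ring
  have hyhi : y (1 + θ) 0 ∉ T := by
    intro h
    have h2 := hT.conv.combo_interior_self_mem_interior hT.o_int h (a := θ / (1 + θ)) (b := 1 / (1 + θ))
      (by positivity) (by positivity) (by field_simp; ring)
    apply hx.2
    convert h2 using 1
    have : (1 + θ) ≠ 0 := by positivity
    simp only [y, ho]; ext
    · simp [smul_smul, this]
    · simp; field_simp; ring
  have t1 : Tendsto (fun j => y (1 - θ) (m j)⁻¹) atTop (𝓝 (y (1 - θ) 0)) :=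
    ((hyc.comp (by fun_prop : Continuous fun μ : ℝ => ((1 - θ), μ))).tendsto 0).comp hμ
  have t2 : Tendsto (fun j => y (1 + θ) (m j)⁻¹) atTop (𝓝 (y (1 + θ) 0)) :=
    ((hyc.comp (by fun_prop : Continuous fun μ : ℝ => ((1 + θ), μ))).tendsto 0).comp hμ
  have t3 : ∀ᶠ j in atTop, pb ((m j)⁻¹, ‖t j‖⁻¹ • t j) := (hμ.prodMk_nhds hτ).eventually hpb
  have t4 : ∀ᶠ j in atTop, ‖t j‖ < u := by
    have := ht.norm
    simp only [norm_zero] at this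
    exact this.eventually (gt_mem_nhds hu)
  obtain ⟨j, j1, j2, j3, j4, j5⟩ := ((t1.eventually (isOpen_interior.mem_nhds hylo)).and
    ((t2.eventually (hT.cl.isOpen_compl.mem_nhds hyhi)).and (t3.and (t4.and (ev_ne hm))))).exists
  set μ := (m j)⁻¹ with hμj
  have hμ0 : μ ≠ 0 := inv_ne_zero j5
  have hyr : Continuous (fun r => y r μ) := hyc.comp (by fun_prop : Continuous fun r : ℝ => (r, μ))
  have hcomp : IsCompact (Icc (1 - θ) (1 + θ) ∩ {r | y r μ ∈ T}) :=
    isCompact_Icc.inter_right (hT.cl.preimage hyr)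
  obtain ⟨r, ⟨hr1, hr2⟩, hrmax⟩ := hcomp.exists_isMaxOn ⟨1 - θ, ⟨by constructor <;> linarith, (interior_subset (s := T) j1 : y (1 - θ) μ ∈ T)⟩⟩
    continuousOn_id
  have hr2' : y r μ ∈ T := hr2
  have hrlt : r < 1 + θ := by
    refine lt_of_le_of_ne hr1.2 ?_
    rintro rfl
    exact j2 hr2'
  have hin : y r μ + u • (‖t j‖⁻¹ • t j) ∈ interior T := by
    refine hP (hball ?_) j3
    rw [Real.dist_eq, abs_lt]
    constructor <;> linarith [hr1.1, hr1.2]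
  have htp : 0 < ‖t j‖ := norm_pos_iff.2 (htn j)
  have hin2 : y r μ + t j ∈ interior T := by
    have := hT.conv.combo_self_interior_mem_interior hr2' hin (a := 1 - ‖t j‖ / u) (b := ‖t j‖ / u)
      (by rw [sub_nonneg, div_le_one hu]; exact j4.le) (by positivity) (by ring)
    convert this using 1
    have e1 : ‖t j‖ / u * (u * ‖t j‖⁻¹) = 1 := by field_simp
    generalize y r μ = Y
    rw [smul_add (‖t j‖ / u), smul_smul, smul_smul, ← add_assoc, ← add_smul, mul_assoc, e1]; simp
  have hcl : Tendsto (fun r' => y r' μ + t j) (𝓝[>] r) (𝓝 (y r μ + t j)) :=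
    ((hyr.add continuous_const).tendsto r).mono_left nhdsWithin_le_nhds
  obtain ⟨r', h1, h2⟩ := ((hcl.eventually (isOpen_interior.mem_nhds hin2)).and (Ioo_mem_nhdsGT hrlt)).exists
  have h3 : y r' μ ∈ T := hs j _ (by rw [hyp r' μ hμ0, hμj, inv_inv]) (interior_subset h1)
  have h4 : r' ≤ r := hrmax (a := r') ⟨⟨by linarith [hr1.1, h2.1], h2.2.le⟩, h3⟩
  linarith [h2.1]

/-- S2: direction along which the boundary cannot be entered -/
theorem S2 {T : Set (E × ℝ)} {M : ℝ} (hT : Good T M) {n : E} (hn : ‖n‖ = 1) {m : ℕ → ℝ}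
    (hm : Tendsto (fun j => |m j|) atTop atTop) {t : ℕ → E × ℝ} (ht : ∀ j, Tr T n (m j) (t j)) :
    ∃ τ : E × ℝ, ∃ φ : ℕ → ℕ, StrictMono φ ∧ Tendsto (fun j => ‖t (φ j)‖⁻¹ • t (φ j)) atTop (𝓝 τ) ∧ τ ≠ 0 ∧
      ∀ x ∈ frontier T, ⟪n, x.1⟫ = 0 → ∀ u : ℝ, x + u • τ ∉ interior T := by
  have h0 := VT hT hn hm ht
  obtain ⟨τ, hτ1, φ, hφ, hlim⟩ := (isCompact_sphere (0 : E × ℝ) 1).tendsto_subseq (x := fun j => ‖t j‖⁻¹ • t j)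
    (fun j => by simp [norm_smul, (ht j).ne])
  refine ⟨τ, φ, hφ, hlim, by rintro rfl; simp at hτ1, ?_⟩
  intro x hx hxn u
  have hm' : Tendsto (fun k => |m (φ k)|) atTop atTop := hm.comp hφ.tendsto_atTop
  have ht' : Tendsto (fun k => t (φ k)) atTop (𝓝 0) := h0.comp hφ.tendsto_atTop
  rcases lt_trichotomy u 0 with hu | hu | hu
  · have := S2_half hT hn hm' (t := fun k => - t (φ k)) (by simpa using ht'.neg) (fun k => neg_ne_zero.2 (ht _).ne)
      (τ := -τ) (by simpa using hlim.neg) (s := 1) (fun k p hp h => ((ht _).back p hp).2 h) hx hxn (u := -u) (by linarith)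
    simpa using this
  · subst hu; simpa using hx.2
  · exact S2_half hT hn hm' ht' (fun k => (ht _).ne) hlim (s := -1)
      (fun k p hp h => ((ht _).2 p (by rw [hp]; ring)).2 h) hx hxn hu

end
end

section
open Set Module Filter Topology
open scoped RealInnerProductSpace
set_option linter.unusedSectionVars false

section
variable {E : Type*} [NormedAddCommGroup E] [InnerProductSpace ℝ E] [FiniteDimensional ℝ E]

theorem pre_frontier {X : Type*} [TopologicalSpace X] {s T : Set X} (hs : IsPreconnected s) (h1 : (s ∩ T).Nonempty)
    (h2 : (s ∩ Tᶜ).Nonempty) : (s ∩ frontier T).Nonempty := by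
  by_contra hcon
  rw [Set.not_nonempty_iff_eq_empty] at hcon
  have hn : ∀ x ∈ s, x ∉ frontier T := fun x hx hf => by
    have : x ∈ s ∩ frontier T := ⟨hx, hf⟩
    rw [hcon] at this; exact this
  obtain ⟨a, ha, haT⟩ := h1
  obtain ⟨b, hb, hbT⟩ := h2
  obtain ⟨y, -, hy1, hy2⟩ := hs (interior T) ((closure T)ᶜ) isOpen_interior isClosed_closure.isOpen_compl
    (fun x hx => by
      by_cases h : x ∈ interior T
      · exact Or.inl h
      · refine Or.inr fun hc => hn x hx ⟨hc, h⟩)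
    ⟨a, ha, by
      by_contra h
      exact hn a ha ⟨subset_closure haT, h⟩⟩
    ⟨b, hb, fun hc => hn b hb ⟨hc, fun h => hbT (interior_subset h)⟩⟩
  exact hy2 (subset_closure (interior_subset hy1))

theorem exists_perp (hE : 2 ≤ finrank ℝ E) (n : E) : ∃ z : E, ‖z‖ = 1 ∧ ⟪n, z⟫ = 0 := by
  have h : LinearMap.ker (innerₛₗ ℝ n) ≠ ⊥ := by
    intro h
    have h1 := LinearMap.finrank_range_add_finrank_ker (innerₛₗ ℝ n)
    rw [h, finrank_bot] at h1
    have h2 := Submodule.finrank_le (LinearMap.range (innerₛₗ ℝ n))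
    simp at h2
    omega
  obtain ⟨z, hz, hz0⟩ := Submodule.exists_mem_ne_zero_of_ne_bot h
  have hz' : ⟪n, z⟫ = 0 := by simpa using hz
  refine ⟨‖z‖⁻¹ • z, ?_, ?_⟩
  · simp [norm_smul, hz0]
  · simp [real_inner_smul_right, hz']

theorem frontier_unit {T : Set (E × ℝ)} {M : ℝ} (hT : Good T M) (hb : ∀ w : E, (w, (1:ℝ)) ∈ T ↔ ‖w‖ ≤ 1)
    {z : E} (hz : ‖z‖ = 1) : (z, (1:ℝ)) ∈ frontier T := by
  refine ⟨subset_closure ((hb z).2 hz.le), fun hi => ?_⟩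
  have hc : Tendsto (fun r : ℝ => (r • z, (1:ℝ))) (𝓝[>] 1) (𝓝 (z, (1:ℝ))) := by
    have : Continuous (fun r : ℝ => (r • z, (1:ℝ))) := by fun_prop
    have h := this.tendsto 1
    simp only [one_smul] at h
    exact h.mono_left nhdsWithin_le_nhds
  obtain ⟨r, h1, h2⟩ := ((hc.eventually (mem_interior_iff_mem_nhds.1 hi)).and self_mem_nhdsWithin).exists
  have h2' : (1:ℝ) < r := h2
  have h3 : ‖r • z‖ ≤ 1 := (hb _).1 h1
  rw [norm_smul, hz, Real.norm_eq_abs, abs_of_pos (by linarith)] at h3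
  linarith

theorem S3a {T : Set (E × ℝ)} {M : ℝ} (hT : Good T M) {n : E} (hn : ‖n‖ = 1)
    (hb : ∀ w : E, (w, (1:ℝ)) ∈ T ↔ ‖w‖ ≤ 1) {d : ℝ} (hd : d ≠ 0)
    (hside : ∀ w : E, ‖w‖ < 1 → ∀ l : ℝ, 0 ≤ l → l ≤ 1 → (w, 1 + l * d) ∈ interior T) {τ : E × ℝ} (hτ0 : τ ≠ 0)
    (hτ : ∀ x ∈ frontier T, ⟪n, x.1⟫ = 0 → ∀ u : ℝ, x + u • τ ∉ interior T) :
    ∃ β : ℝ, τ.2 = β * ⟪n, τ.1⟫ ∧ ⟪n, τ.1⟫ ≠ 0 ∧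
      ∀ x ∈ frontier T, ⟪n, x.1⟫ = 0 → ∀ u : ℝ, x + u • (n, β) ∉ interior T := by
  set o : E × ℝ := ((0:E), (1:ℝ)) with ho
  have hoT := interior_subset hT.o_int
  have ha : ⟪n, τ.1⟫ ≠ 0 := by
    intro ha
    have hall : ∀ s : ℝ, o + s • τ ∈ T := by
      intro s
      by_contra hs
      have hpre : IsPreconnected (segment ℝ o (o + s • τ)) := (convex_segment _ _).isPreconnected
      obtain ⟨x, hx1, hx2⟩ := pre_frontier (T := T) hpre ⟨o, left_mem_segment _ _ _, hoT⟩
        ⟨_, right_mem_segment _ _ _, hs⟩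
      rw [segment_eq_image'] at hx1
      obtain ⟨r, -, rfl⟩ := hx1
      refine hτ _ hx2 ?_ (-(r * s)) ?_
      · simp [ho, real_inner_smul_right, ha]
      · convert hT.o_int using 1
        simp only [add_sub_cancel_left, smul_smul, neg_smul, ho]; abel
    refine hτ0 (no_line hT (x := o) (fun k => hall k) (fun k => ?_))
    have := hall (-k)
    simpa [sub_eq_add_neg] using this
  set a := ⟪n, τ.1⟫ with had
  set g := a⁻¹ • τ.1 - n with hg
  set β := a⁻¹ * τ.2 with hβ
  have hτe : a⁻¹ • τ = (n + g, β) := by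
    ext
    · simp [hg]
    · simp [hβ]
  have hline : ∀ x ∈ frontier T, ⟪n, x.1⟫ = 0 → ∀ u : ℝ, x + u • (n + g, β) ∉ interior T := by
    intro x hx hxn u
    rw [← hτe, smul_smul]
    exact hτ x hx hxn _
  have hng : ⟪n, g⟫ = 0 := by
    rw [hg, inner_sub_right, real_inner_smul_right, ← had, real_inner_self_eq_norm_sq, hn]
    field_simp; ring
  have hg0 : g = 0 := by
    by_contra hgne
    have hgp : 0 < ‖g‖ := norm_pos_iff.2 hgne
    obtain ⟨σ, hσ, hσ2⟩ : ∃ σ : ℝ, σ * σ = 1 ∧ 0 ≤ σ * β / d := by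
      by_cases h : 0 ≤ β / d
      · exact ⟨1, by norm_num, by simpa using h⟩
      · refine ⟨-1, by norm_num, ?_⟩
        push Not at h
        have : -1 * β / d = -(β / d) := by ring
        rw [this]; linarith
    set κ := σ * β / d with hκ
    set u0 := min (‖g‖ / (‖g‖ ^ 2 + 1)) (1 / (κ + 1)) with hu0
    have hu0p : 0 < u0 := lt_min (by positivity) (by positivity)
    have hu1 : u0 * (‖g‖ ^ 2 + 1) ≤ ‖g‖ := by
      rw [← le_div_iff₀ (by positivity)]; exact min_le_left _ _
    have hu2 : u0 * (κ + 1) ≤ 1 := by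
      rw [← le_div_iff₀ (by positivity)]; exact min_le_right _ _
    set z := (-(σ * ‖g‖⁻¹)) • g with hz
    have hσa : |σ| = 1 := by
      have h := abs_mul_abs_self σ
      rw [hσ] at h
      nlinarith [abs_nonneg σ]
    have hz1 : ‖z‖ = 1 := by
      rw [hz, norm_smul, norm_neg, norm_mul, Real.norm_eq_abs, hσa, norm_inv, norm_norm]; field_simp
    have hnz : ⟪n, z⟫ = 0 := by rw [hz, real_inner_smul_right, hng, mul_zero]
    refine hline (z, 1) (frontier_unit hT hb hz1) hnz (σ * u0) ?_
    have e : (z, (1:ℝ)) + (σ * u0) • (n + g, β) = (z + (σ * u0) • (n + g), 1 + (u0 * κ) * d) := by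
      ext
      · simp
      · simp only [Prod.snd_add, Prod.smul_snd, smul_eq_mul, hκ]; field_simp
    rw [e]
    refine hside _ ?_ _ (by positivity) (by nlinarith)
    have e2 : z + (σ * u0) • (n + g) = (σ * (u0 - ‖g‖⁻¹)) • g + (σ * u0) • n := by
      rw [hz, smul_add, ← add_assoc, add_right_comm, ← add_smul]; congr 2; ring
    have e3 : ‖z + (σ * u0) • (n + g)‖ ^ 2 = (u0 - ‖g‖⁻¹) ^ 2 * ‖g‖ ^ 2 + u0 ^ 2 := by
      rw [e2, norm_add_sq_real, real_inner_smul_left, real_inner_smul_right, real_inner_comm, hng, norm_smul, norm_smul,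
        hn, Real.norm_eq_abs, Real.norm_eq_abs, abs_mul, abs_mul, hσa]
      simp [mul_pow]
    have e4 : (u0 - ‖g‖⁻¹) ^ 2 * ‖g‖ ^ 2 = (u0 * ‖g‖ - 1) ^ 2 := by
      rw [← mul_pow, sub_mul, inv_mul_cancel₀ hgp.ne']
    rw [← abs_of_nonneg (norm_nonneg (z + _)), ← abs_one, ← sq_lt_sq, e3, e4]
    nlinarith
  refine ⟨β, by rw [hβ]; field_simp, ha, ?_⟩
  simpa [hg0] using hline

theorem S3G {T : Set (E × ℝ)} {M : ℝ} (hT : Good T M) {n : E}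
    (hb : ∀ w : E, (w, (1:ℝ)) ∈ T ↔ ‖w‖ ≤ 1) {β : ℝ} (hβ : β ≠ 0)
    (hl : ∀ x ∈ frontier T, ⟪n, x.1⟫ = 0 → ∀ u : ℝ, x + u • (n, β) ∉ interior T) :
    ∀ p ∈ T, ∀ z : E, ‖z‖ = 1 → ⟪n, z⟫ = 0 → ⟪z, p.1⟫ ≤ 1 := by
  intro p hp z hz hnz
  let ℓ : Set (E × ℝ) := {x | ∃ r : ℝ, x = (z, (1:ℝ)) + r • (n, β)}
  have hℓ : Convex ℝ ℓ := by
    rintro x ⟨r, rfl⟩ y ⟨r', rfl⟩ a b _ _ hab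
    refine ⟨a * r + b * r', ?_⟩
    rw [smul_add, smul_add, add_smul, mul_smul, mul_smul, add_add_add_comm, ← add_smul, hab, one_smul]
  obtain ⟨f, u, hf1, hf2⟩ := geometric_hahn_banach_open hT.conv.interior isOpen_interior hℓ (by
    rw [Set.disjoint_right]
    rintro x ⟨r, rfl⟩
    exact hl _ (frontier_unit hT hb hz) hnz r)
  have hfT : ∀ x ∈ T, f x ≤ u := by
    intro x hx
    have hcl : x ∈ closure (interior T) := by
      rw [hT.conv.closure_interior_eq_closure_of_nonempty_interior ⟨_, hT.o_int⟩]; exact subset_closure hx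
    exact closure_minimal (fun y hy => (hf1 y hy).le) (isClosed_le f.continuous continuous_const) hcl
  have hz' : ∀ r : ℝ, u ≤ f (z, 1) + r * f (n, β) := by
    intro r
    have := hf2 _ ⟨r, rfl⟩
    rwa [map_add, map_smul, smul_eq_mul] at this
  have hn0 : f (n, β) = 0 := by
    by_contra h
    have := hz' ((u - f (z, 1) - 1) / f (n, β))
    rw [div_mul_cancel₀ _ h] at this
    linarith
  have hfz : f (z, 1) = u := le_antisymm (hfT _ ((hb z).2 hz.le)) (by have := hz' 0; simpa using this)
  have hfo := hf1 _ hT.o_int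
  have hsplit : ∀ (w : E) (Z : ℝ), f (w, Z) = f (w, 0) + Z * f (0, 1) := by
    intro w Z
    have : ((w, Z) : E × ℝ) = (w, 0) + Z • ((0:E), (1:ℝ)) := by ext <;> simp
    rw [this, map_add, map_smul, smul_eq_mul]
  set L := u - f (0, 1) with hL
  have hLp : 0 < L := by linarith
  let f0 : E →L[ℝ] ℝ := f.comp (ContinuousLinearMap.inl ℝ E ℝ)
  set a := (InnerProductSpace.toDual ℝ E).symm f0 with ha
  have hfa : ∀ w, f (w, 0) = ⟪a, w⟫ := by
    intro w
    rw [ha, InnerProductSpace.toDual_symm_apply]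
    simp [f0]
  have h1 : ∀ w : E, ‖w‖ ≤ 1 → ⟪a, w⟫ ≤ L := by
    intro w hw
    have := hfT _ ((hb w).2 hw)
    rw [hsplit, hfa] at this
    linarith
  have h2 : ⟪a, z⟫ = L := by
    have := hfz
    rw [hsplit, hfa] at this
    linarith
  have h3 : ‖a‖ ≤ L := by
    by_cases h : a = 0
    · rw [h]; simp [hLp.le]
    · have := h1 (‖a‖⁻¹ • a) (by simp [norm_smul, h])
      rw [real_inner_smul_right, real_inner_self_eq_norm_sq] at this
      have hap : ‖a‖ ≠ 0 := norm_ne_zero_iff.2 h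
      field_simp at this
      exact this
  have h4 : a = L • z := by
    rw [← sub_eq_zero, ← norm_eq_zero, ← sq_eq_zero_iff]
    have : ‖a - L • z‖ ^ 2 = ‖a‖ ^ 2 - L ^ 2 := by
      rw [norm_sub_sq_real, real_inner_smul_right, h2, norm_smul, hz, Real.norm_eq_abs, mul_one, sq_abs]; ring
    have h5 : ‖a‖ ^ 2 ≤ L ^ 2 := by gcongr
    nlinarith [sq_nonneg ‖a - L • z‖]
  have h6 : f (0, 1) = 0 := by
    rw [hsplit, hfa, h4, real_inner_smul_left, real_inner_comm, hnz] at hn0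
    simpa [hβ] using hn0
  have h7 := hfT p hp
  have h8 : f p = f (p.1, p.2) := rfl
  rw [h8, hsplit, hfa, h4, real_inner_smul_left, h6] at h7
  have h9 : u = L := by rw [hL, h6]; ring
  rw [h9] at h7
  nlinarith

/-- boundary points cannot be moved inside horizontally -/
def Perp (T : Set (E × ℝ)) : Prop :=
  ∀ n : E, ‖n‖ = 1 → ∀ x ∈ frontier T, ⟪n, x.1⟫ = 0 → ∀ u : ℝ, x + (u • n, (0:ℝ)) ∉ interior T

theorem S3_cut (hE : 2 ≤ finrank ℝ E) {T : Set (E × ℝ)} {M : ℝ} (hT : Good T M)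
    (hb : ∀ w : E, (w, (1:ℝ)) ∈ T ↔ ‖w‖ ≤ 1) {d : ℝ} (hd : d ≠ 0)
    (hside : ∀ w : E, ‖w‖ < 1 → ∀ l : ℝ, 0 ≤ l → l ≤ 1 → (w, 1 + l * d) ∈ interior T)
    (hunb : ∀ z : E, ‖z‖ = 1 → ∃ p ∈ T, 1 < ⟪z, p.1⟫)
    (htr : ∀ n : E, ‖n‖ = 1 → ∃ m : ℕ → ℝ, ∃ t : ℕ → E × ℝ, Tendsto (fun j => |m j|) atTop atTop ∧
      ∀ j, Tr T n (m j) (t j)) : Perp T := by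
  intro n hn
  obtain ⟨m, t, hm, ht⟩ := htr n hn
  obtain ⟨τ, φ, -, -, hτ0, hτ⟩ := S2 hT hn hm ht
  obtain ⟨β, -, -, hl⟩ := S3a hT hn hb hd hside hτ0 hτ
  obtain ⟨z, hz, hnz⟩ := exists_perp hE n
  have hβ : β = 0 := by
    by_contra h
    obtain ⟨p, hp, h1⟩ := hunb z hz
    have := S3G hT hb h hl p hp z hz hnz
    linarith
  subst hβ
  intro x hx hxn u
  have := hl x hx hxn u
  simpa using this

theorem delta_pos {K : Set (E × ℝ)} (hc : Convex ℝ K) {S : Set E} (h1 : ∀ w : E, (w, (1:ℝ)) ∈ K ↔ w ∈ S)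
    (h2 : ∀ w : E, (w, (-1:ℝ)) ∈ K ↔ w ∈ S) {x : E} (hx : x ∈ S.extremePoints ℝ) {n : E} {m : ℝ} {t : E × ℝ}
    (ht : Tr K n m t) (hxn : ⟪n, x⟫ = 0) : 0 < t.2 := by
  by_contra hcon
  push Not at hcon
  have q1 := (ht.2 (x, -1) (by simp [hxn])).1 ((h2 x).2 hx.1)
  have q2 := (ht.back (x, 1) (by simp [hxn])).1 ((h1 x).2 hx.1)
  have hp : 0 < 2 - t.2 := by linarith
  have r1 := hc q1 ((h1 x).2 hx.1) (a := 2 / (2 - t.2)) (b := -t.2 / (2 - t.2)) (by positivity)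
    (by apply div_nonneg <;> linarith) (by field_simp; ring)
  have r2 := hc q2 ((h2 x).2 hx.1) (a := 2 / (2 - t.2)) (b := -t.2 / (2 - t.2)) (by positivity)
    (by apply div_nonneg <;> linarith) (by field_simp; ring)
  have ab : 2 / (2 - t.2) + (-t.2 / (2 - t.2)) = 1 := by field_simp; ring
  have e1 : x + (2 / (2 - t.2)) • t.1 ∈ S := by
    rw [← h2]
    convert r1 using 1
    ext
    · simp only [Prod.fst_add, Prod.smul_fst, smul_add]
      rw [add_right_comm, ← add_smul, ab, one_smul]
    · simp; field_simp; ring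
  have e2 : x - (2 / (2 - t.2)) • t.1 ∈ S := by
    rw [← h1]
    convert r2 using 1
    ext
    · simp only [Prod.fst_add, Prod.smul_fst, smul_add, Prod.fst_neg, smul_neg]
      rw [add_right_comm, ← add_smul, ab, one_smul, sub_eq_add_neg]
    · simp; field_simp; ring
  have h3 := hx.2 e1 e2 ⟨1/2, 1/2, by norm_num, by norm_num, by norm_num, by module⟩
  have h4 : t.1 = 0 := by
    have h5 : (2 / (2 - t.2)) • t.1 = 0 := by simpa using h3
    rcases smul_eq_zero.1 h5 with h | h
    · exact absurd h (by positivity)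
    · exact h
  have := ht.1
  rw [h4] at this
  simp at this
  linarith

theorem cyl_contra {K : Set (E × ℝ)} {S : Set E} 
    (hcyl : ∀ w : E, ∀ Z, -1 ≤ Z → Z ≤ 1 → ((w, Z) ∈ K ↔ w ∈ S)) {x : E} (hx : x ∈ S.extremePoints ℝ) {n : E} {m : ℝ}
    {t : E × ℝ} (ht : Tr K n m t) (hxn : ⟪n, x⟫ = 0) (h0 : 0 < t.2) (h2 : t.2 < 2) : False := by
  have q1 := (ht.2 (x, -1) (by simp [hxn])).1 ((hcyl x _ (by norm_num) (by norm_num)).2 hx.1)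
  have q2 := (ht.back (x, 1) (by simp [hxn])).1 ((hcyl x _ (by norm_num) (by norm_num)).2 hx.1)
  have e1 : x + t.1 ∈ S := (hcyl _ (-1 + t.2) (by linarith) (by linarith)).1 q1
  have e2 : x - t.1 ∈ S := (hcyl _ (1 - t.2) (by linarith) (by linarith)).1 (by
    convert q2 using 1; ext <;> simp [sub_eq_add_neg])
  have h3 := hx.2 e1 e2 ⟨1/2, 1/2, by norm_num, by norm_num, by norm_num, by module⟩
  have h4 : t.1 = 0 := by simpa using h3
  have := ht.1
  rw [h4] at this
  simp at this
  linarith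

end
end

section
open Set Module Filter Topology
open scoped RealInnerProductSpace
set_option linter.unusedSectionVars false

section
variable {E : Type*} [NormedAddCommGroup E] [InnerProductSpace ℝ E] [FiniteDimensional ℝ E]

theorem side_noncut {K : Set (E × ℝ)} (hc : Convex ℝ K) (h1 : ((0:E), (1:ℝ)) ∈ interior K)
    (h2 : ((0:E), (-1:ℝ)) ∈ interior K)
    (hb1 : ∀ w : E, (w, (1:ℝ)) ∈ K ↔ ‖w‖ ≤ 1) (hb2 : ∀ w : E, (w, (-1:ℝ)) ∈ K ↔ ‖w‖ ≤ 1) :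
    ∀ w : E, ‖w‖ < 1 → ∀ Z : ℝ, -1 ≤ Z → Z ≤ 1 → (w, Z) ∈ interior K := by
  have key : ∀ s : ℝ, ((0:E), s) ∈ interior K → (∀ w : E, (w, s) ∈ K ↔ ‖w‖ ≤ 1) → ∀ w : E, ‖w‖ < 1 → (w, s) ∈ interior K := by
    intro s hs hb w hw
    by_cases h : w = 0
    · rwa [h]
    have hp : 0 < ‖w‖ := norm_pos_iff.2 h
    have h3 : (‖w‖⁻¹ • w, s) ∈ K := (hb _).2 (by simp [norm_smul, hp.ne'])
    have := hc.combo_interior_self_mem_interior hs h3 (a := 1 - ‖w‖) (b := ‖w‖) (by linarith) hp.le (by ring)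
    convert this using 1
    ext
    · simp [smul_smul, hp.ne']
    · simp; ring
  intro w hw Z hZ1 hZ2
  have := hc.interior (key _ h1 hb1 w hw) (key _ h2 hb2 w hw) (a := (1 + Z) / 2) (b := (1 - Z) / 2) (by linarith)
    (by linarith) (by ring)
  convert this using 1
  ext
  · simp only [Prod.fst_add, Prod.smul_fst]; rw [← add_smul]
    have : (1 + Z) / 2 + (1 - Z) / 2 = 1 := by ring
    rw [this, one_smul]
  · simp; ring

theorem unit_extreme {z : E} (hz : ‖z‖ = 1) : z ∈ ({w : E | ‖w‖ ≤ 1}).extremePoints ℝ := by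
  have h : {w : E | ‖w‖ ≤ 1} = Metric.closedBall 0 1 := by ext; simp
  haveI : Nontrivial E := ⟨⟨z, 0, by rintro rfl; simp at hz⟩⟩
  rw [h, StrictConvexSpace.extremePoints_closedBall_eq_sphere]
  simpa using hz

theorem beta_noncut (hE : 2 ≤ finrank ℝ E) {K : Set (E × ℝ)} {M : ℝ} (hT : Good K M)
    (h2 : ((0:E), (-1:ℝ)) ∈ interior K)
    (hb1 : ∀ w : E, (w, (1:ℝ)) ∈ K ↔ ‖w‖ ≤ 1) (hb2 : ∀ w : E, (w, (-1:ℝ)) ∈ K ↔ ‖w‖ ≤ 1)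
    (htr : ∀ n : E, ‖n‖ = 1 → ∀ m : ℝ, ∃ t : E × ℝ, Tr K n m t) {n : E} (hn : ‖n‖ = 1) {s : ℝ} (hs : s * s = 1) :
    ∃ β : ℝ, s * β ≤ 0 ∧ ∀ x ∈ frontier K, ⟪n, x.1⟫ = 0 → ∀ u : ℝ, x + u • (n, β) ∉ interior K := by
  choose t ht using fun j : ℕ => htr n hn (s * (j + 1))
  have hsa : |s| = 1 := by
    have h := abs_mul_abs_self s
    rw [hs] at h
    nlinarith [abs_nonneg s]
  have hm : Tendsto (fun j : ℕ => |s * ((j:ℝ) + 1)|) atTop atTop := by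
    have : (fun j : ℕ => |s * ((j:ℝ) + 1)|) = fun j : ℕ => (j:ℝ) + 1 := by
      ext j; rw [abs_mul, hsa, one_mul, abs_of_pos (by positivity)]
    rw [this]
    exact tendsto_atTop_add_const_right _ _ tendsto_natCast_atTop_atTop
  obtain ⟨z, hz, hnz⟩ := exists_perp hE n
  have hpos : ∀ j, 0 < (t j).2 := fun j =>
    delta_pos hT.conv (S := {w | ‖w‖ ≤ 1}) hb1 hb2 (unit_extreme hz) (ht j) hnz
  have hlim := VT hT hn hm ht
  have hlt : ∀ᶠ j in atTop, (t j).2 < 2 := by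
    have : Tendsto (fun j => (t j).2) atTop (𝓝 0) := (continuous_snd.tendsto (0 : E × ℝ)).comp hlim
    exact this.eventually (gt_mem_nhds (by norm_num))
  have hneg : ∀ᶠ j in atTop, s * ⟪n, (t j).1⟫ ≤ 0 := by
    filter_upwards [hlt] with j hj
    have := (ht j).1
    have hj1 : (0:ℝ) < (j:ℝ) + 1 := by positivity
    by_contra hc
    push Not at hc
    nlinarith [mul_pos hj1 hc]
  obtain ⟨τ, φ, hφ, hτl, hτ0, hτ⟩ := S2 hT hn hm ht
  obtain ⟨β, hβ1, hβ2, hl⟩ := S3a hT hn hb1 (d := -2) (by norm_num) (fun w hw l h0 h1 =>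
    side_noncut hT.conv hT.o_int h2 hb1 hb2 w hw _ (by linarith) (by linarith)) hτ0 hτ
  have e1 : 0 ≤ τ.2 := by
    refine ge_of_tendsto' ((continuous_snd.tendsto τ).comp hτl) fun j => ?_
    simp only [Function.comp, Prod.smul_snd, smul_eq_mul]
    have := (hpos (φ j)).le
    positivity
  have e2 : s * ⟪n, τ.1⟫ ≤ 0 := by
    have hcont : Continuous fun τ : E × ℝ => s * ⟪n, τ.1⟫ := by fun_prop
    refine le_of_tendsto ((hcont.tendsto τ).comp hτl) ?_
    filter_upwards [hφ.tendsto_atTop.eventually hneg] with j hj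
    simp only [Function.comp, Prod.smul_fst, real_inner_smul_right]
    have : 0 ≤ ‖t (φ j)‖⁻¹ := by positivity
    nlinarith
  refine ⟨β, ?_, hl⟩
  have hb3 : s * ⟪n, τ.1⟫ ≠ 0 := mul_ne_zero (by rintro rfl; simp at hs) hβ2
  have hb4 : s * ⟪n, τ.1⟫ < 0 := lt_of_le_of_ne e2 hb3
  have h5 : (s * β) * (s * ⟪n, τ.1⟫) = τ.2 := by rw [hβ1]; linear_combination (β * ⟪n, τ.1⟫) * hs
  by_contra hc
  push Not at hc
  nlinarith [mul_neg_of_pos_of_neg hc hb4]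

theorem S3_noncut (hE : 2 ≤ finrank ℝ E) {K : Set (E × ℝ)} {M : ℝ} (hT : Good K M)
    (h2 : ((0:E), (-1:ℝ)) ∈ interior K)
    (hb1 : ∀ w : E, (w, (1:ℝ)) ∈ K ↔ ‖w‖ ≤ 1) (hb2 : ∀ w : E, (w, (-1:ℝ)) ∈ K ↔ ‖w‖ ≤ 1)
    (htr : ∀ n : E, ‖n‖ = 1 → ∀ m : ℝ, ∃ t : E × ℝ, Tr K n m t) : Perp K := by
  intro n hn x hx hxn y hy
  have side := side_noncut hT.conv hT.o_int h2 hb1 hb2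
  have hxK : x ∈ K := hT.cl.frontier_subset hx
  have hy0 : y ≠ 0 := by
    rintro rfl
    apply hx.2
    rwa [zero_smul, Prod.mk_zero_zero, add_zero] at hy
  -- a nonzero beta of each sign
  have hβ : ∀ s : ℝ, s * s = 1 → ∃ β : ℝ, s * β < 0 ∧ ∀ x ∈ frontier K, ⟪n, x.1⟫ = 0 → ∀ u : ℝ, x + u • (n, β) ∉ interior K := by
    intro s hs
    obtain ⟨β, h3, h4⟩ := beta_noncut hE hT h2 hb1 hb2 htr hn hs
    refine ⟨β, lt_of_le_of_ne h3 ?_, h4⟩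
    intro h0
    have hβ0 : β = 0 := by
      rcases mul_eq_zero.1 h0 with h | h
      · rw [h] at hs; simp at hs
      · exact h
    subst hβ0
    apply h4 x hx hxn y
    simpa using hy
  have hG : ∀ p ∈ K, ∀ z : E, ‖z‖ = 1 → ⟪n, z⟫ = 0 → ⟪z, p.1⟫ ≤ 1 := by
    obtain ⟨β, h3, h4⟩ := hβ 1 (by norm_num)
    exact S3G hT hb1 (β := β) (by rintro rfl; simp at h3) h4
  have hw1 : ‖x.1‖ ≤ 1 := by
    by_cases h : x.1 = 0
    · simp [h]
    have hp : 0 < ‖x.1‖ := norm_pos_iff.2 h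
    have := hG x hxK (‖x.1‖⁻¹ • x.1) (by simp [norm_smul, hp.ne']) (by rw [real_inner_smul_right, hxn, mul_zero])
    rw [real_inner_smul_left, real_inner_self_eq_norm_sq] at this
    field_simp at this
    exact this
  rcases hw1.eq_or_lt with hw | hw
  · -- norm one
    have hcont : Continuous fun r : ℝ => x + (y • n, (0:ℝ)) + r • (x.1, (0:ℝ)) := by fun_prop
    have hev : ∀ᶠ r in 𝓝 (0:ℝ), x + (y • n, (0:ℝ)) + r • (x.1, (0:ℝ)) ∈ K := by
      have := hcont.tendsto 0
      rw [zero_smul, add_zero] at this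
      exact this.eventually (mem_interior_iff_mem_nhds.1 hy)
    have hev2 : ∀ᶠ r in 𝓝[>] (0:ℝ), x + (y • n, (0:ℝ)) + r • (x.1, (0:ℝ)) ∈ K := hev.filter_mono nhdsWithin_le_nhds
    obtain ⟨r, hr1, hr2⟩ := (hev2.and self_mem_nhdsWithin).exists
    have hr2' : 0 < r := hr2
    have := hG _ hr1 x.1 hw hxn
    simp only [Prod.fst_add, Prod.smul_fst, inner_add_right, real_inner_smul_right, real_inner_self_eq_norm_sq, hw] at this
    rw [real_inner_comm, hxn] at this
    linarith
  · have hZ : 1 < |x.2| := by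
      by_contra hc
      push Not at hc
      obtain ⟨h3, h4⟩ := abs_le.1 hc
      exact hx.2 (side x.1 hw x.2 h3 h4)
    have hZ0 : x.2 ≠ 0 := by
      intro h; rw [h] at hZ; simp at hZ; linarith
    obtain ⟨s, hs, hsp⟩ : ∃ s : ℝ, s * s = 1 ∧ 0 < s * (y * x.2) := by
      have h0 : y * x.2 ≠ 0 := mul_ne_zero hy0 hZ0
      rcases lt_or_gt_of_ne h0 with h | h
      · exact ⟨-1, by norm_num, by linarith⟩
      · exact ⟨1, by norm_num, by linarith⟩
    obtain ⟨β, h3, h4⟩ := hβ s hs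
    have h5 : β * y / x.2 < 0 := by
      have e : β * y / x.2 = (s * β) * (s * (y * x.2)) / x.2 ^ 2 := by
        have e0 : (s * β) * (s * (y * x.2)) = β * y * x.2 := by linear_combination (β * y * x.2) * hs
        rw [e0]; field_simp
      rw [e]
      have : 0 < x.2 ^ 2 := by positivity
      apply div_neg_of_neg_of_pos _ this
      exact mul_neg_of_neg_of_pos h3 hsp
    set μ := -(β * y / x.2) with hμ
    have hμp : 0 < μ := by linarith
    have ev1 : ∀ᶠ l in 𝓝[>] (0:ℝ), l < 1 := nhdsWithin_le_nhds (gt_mem_nhds one_pos)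
    have ev2 : ∀ᶠ l in 𝓝[>] (0:ℝ), l * μ < 1 := by
      have : Continuous fun l : ℝ => l * μ := by fun_prop
      have h := this.tendsto 0
      rw [zero_mul] at h
      exact nhdsWithin_le_nhds (h.eventually (gt_mem_nhds one_pos))
    have ev3 : ∀ᶠ l in 𝓝[>] (0:ℝ), ‖x.1 + (l * y) • n‖ < 1 := by
      have : Continuous fun l : ℝ => ‖x.1 + (l * y) • n‖ := by fun_prop
      have h := this.tendsto 0
      rw [zero_mul, zero_smul, add_zero] at h
      exact nhdsWithin_le_nhds (h.eventually (gt_mem_nhds hw))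
    obtain ⟨l, ⟨⟨l1, l2⟩, l3⟩, l4⟩ := (((ev1.and ev2).and ev3).and self_mem_nhdsWithin).exists
    have l4' : 0 < l := l4
    have q1 : x + ((l * y) • n, (0:ℝ)) ∈ interior K := by
      have := hT.conv.combo_self_interior_mem_interior hxK hy (a := 1 - l) (b := l) (by linarith) l4' (by ring)
      convert this using 1
      ext
      · simp only [Prod.fst_add, Prod.smul_fst]; module
      · simp; ring
    have q2 := side _ l3 0 (by norm_num) (by norm_num)
    have q3 := hT.conv.interior q1 q2 (a := 1 - l * μ) (b := l * μ) (by linarith) (by positivity) (by ring)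
    apply h4 x hx hxn (l * y)
    convert q3 using 1
    ext
    · simp only [Prod.fst_add, Prod.smul_fst]; module
    · simp [hμ]; field_simp

/-- rotation invariance -/
def RotInv (T : Set (E × ℝ)) : Prop := ∀ w w' : E, ∀ Z : ℝ, ‖w‖ = ‖w'‖ → (w, Z) ∈ T → (w', Z) ∈ T

theorem S4 (hE : 2 ≤ finrank ℝ E) {T : Set (E × ℝ)} {M : ℝ} (hT : Good T M) (hP : Perp T) : RotInv T := by
  set o : E × ℝ := ((0:E), (1:ℝ)) with ho
  set T' : Set (E × ℝ) := {p | p + o ∈ T} with hT'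
  let sh : E × ℝ ≃ₜ E × ℝ := Homeomorph.addRight o
  have hpre : T' = sh ⁻¹' T := rfl
  have hc : Convex ℝ T' := hT.conv.translate_preimage_left o
  have h0 : T' ∈ 𝓝 (0 : E × ℝ) := by
    rw [← mem_interior_iff_mem_nhds, hpre, ← sh.preimage_interior]
    have : sh 0 = o := by simp [sh]
    show sh 0 ∈ interior T
    rw [this]; exact hT.o_int
  have hcl : IsClosed T' := hT.cl.preimage sh.continuous
  have hS := subL_gauge hc h0
  have hmem := mem_iff_gauge hc hcl h0
  set G := gauge T' with hG
  -- perpendicular monotonicity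
  have mono : ∀ (n w : E) (u s : ℝ), ‖n‖ = 1 → ⟪n, w⟫ = 0 → G (w, s) ≤ G (w + u • n, s) := by
    intro n w u s hn hnw
    rcases (gauge_nonneg (s := T') (w, s)).eq_or_lt with h | h
    · rw [hG, ← h]; exact gauge_nonneg _
    set g := G (w, s) with hg
    have hgp : 0 < g := h
    have hfr : g⁻¹ • (w, s) ∈ frontier T' := by
      rw [← gauge_eq_one_iff_mem_frontier hc h0]
      have := hS.smul g⁻¹ (w, s) (by positivity)
      rw [← hg, inv_mul_cancel₀ hgp.ne'] at this
      exact this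
    have hni := hP n hn (g⁻¹ • (w, s) + o) (by
      rw [hpre, ← sh.preimage_frontier] at hfr; exact hfr) (by
      simp [ho, real_inner_smul_right, hnw]) (g⁻¹ * u)
    have hni2 : g⁻¹ • (w + u • n, s) ∉ interior T' := by
      rw [hpre, ← sh.preimage_interior]
      intro hi
      apply hni
      convert show sh (g⁻¹ • (w + u • n, s)) ∈ interior T from hi using 1
      simp only [sh, Homeomorph.coe_addRight, ho]
      ext
      · simp [smul_add, smul_smul]
      · simp
    rw [← gauge_lt_one_iff_mem_interior hc h0, not_lt] at hni2
    have := hS.smul g⁻¹ (w + u • n, s) (by positivity)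
    have h3 : 1 ≤ g⁻¹ * G (w + u • n, s) := by rw [← this]; exact hni2
    rw [inv_mul_eq_div, le_div_iff₀ hgp, one_mul] at h3
    exact h3
  obtain ⟨L, hL⟩ := hS.lip
  have circ : ∀ (e1 e2 : E) (r s : ℝ), ‖e1‖ = 1 → ‖e2‖ = 1 → ⟪e1, e2⟫ = 0 → 0 ≤ r → ∀ θ θ' : ℝ,
      G (r • (Real.cos θ • e1 + Real.sin θ • e2), s) = G (r • (Real.cos θ' • e1 + Real.sin θ' • e2), s) := by
    intro e1 e2 r s he1 he2 h12 hr
    have h21 : ⟪e2, e1⟫ = 0 := by rw [real_inner_comm]; exact h12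
    refine quad_const (φ := fun θ => G (r • (Real.cos θ • e1 + Real.sin θ • e2), s)) (M := |L| * r) ?_
    intro a b _
    set w := Real.cos a • e1 + Real.sin a • e2 with hw
    set w' := -Real.sin a • e1 + Real.cos a • e2 with hw'
    have e : Real.cos b • e1 + Real.sin b • e2 = Real.cos (b - a) • w + Real.sin (b - a) • w' := by
      have hb : b = a + (b - a) := by ring
      conv_lhs => rw [hb, Real.cos_add, Real.sin_add]
      rw [hw, hw']; module
    have hn1 : ‖w‖ = 1 := by
      have : ‖w‖ ^ 2 = 1 := by
        rw [hw, norm_add_sq_real, norm_smul, norm_smul, he1, he2, real_inner_smul_left, real_inner_smul_right, h12]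
        simp
      nlinarith [norm_nonneg w]
    have hn2 : ‖w'‖ = 1 := by
      have : ‖w'‖ ^ 2 = 1 := by
        rw [hw', norm_add_sq_real, norm_smul, norm_smul, he1, he2, real_inner_smul_left, real_inner_smul_right, h12]
        simp
      nlinarith [norm_nonneg w']
    have hww : ⟪w', w⟫ = 0 := by
      rw [hw, hw']
      simp only [inner_add_left, inner_add_right, real_inner_smul_left, real_inner_smul_right, h12, h21,
        real_inner_self_eq_norm_sq, he1, he2]; ring
    have m1 := mono w' ((r * Real.cos (b - a)) • w) (r * Real.sin (b - a)) s hn2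
      (by rw [real_inner_smul_right, hww, mul_zero])
    show G (r • w, s) - |L| * r * (b - a) ^ 2 ≤ G (r • (Real.cos b • e1 + Real.sin b • e2), s)
    clear_value w w'
    rw [e, smul_add, smul_smul, smul_smul]
    have m2 := hL (r • w, s) ((r * Real.cos (b - a)) • w, s)
    have m3 : ‖((r • w, s) : E × ℝ) - ((r * Real.cos (b - a)) • w, s)‖ = r * (1 - Real.cos (b - a)) := by
      rw [Prod.mk_sub_mk, sub_self, ← sub_smul, Prod.norm_def]
      have : r - r * Real.cos (b - a) = r * (1 - Real.cos (b - a)) := by ring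
      have h1 : 0 ≤ 1 - Real.cos (b - a) := by linarith [Real.cos_le_one (b - a)]
      rw [this, norm_smul, hn1, mul_one, Real.norm_eq_abs, abs_of_nonneg (by positivity), norm_zero,
        max_eq_left (by positivity)]
    rw [m3] at m2
    have m4 := le_abs_self (G (r • w, s) - G ((r * Real.cos (b - a)) • w, s))
    have m5 := Real.one_sub_sq_div_two_le_cos (x := b - a)
    have m6 : L * (r * (1 - Real.cos (b - a))) ≤ |L| * r * (b - a) ^ 2 := by
      have h1 : 0 ≤ 1 - Real.cos (b - a) := by linarith [Real.cos_le_one (b - a)]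
      calc L * (r * (1 - Real.cos (b - a))) ≤ |L| * (r * (1 - Real.cos (b - a))) := by
            gcongr; exact le_abs_self L
        _ ≤ |L| * (r * (b - a) ^ 2) := by gcongr; nlinarith [sq_nonneg (b - a)]
        _ = _ := by ring
    linarith
  have inv : ∀ w w' : E, ∀ s : ℝ, ‖w‖ = ‖w'‖ → G (w, s) = G (w', s) := by
    intro w w' s h
    by_cases hw : w = 0
    · have : w' = 0 := by rw [← norm_eq_zero, ← h, hw, norm_zero]
      rw [hw, this]
    set r := ‖w‖ with hr
    have hrp : 0 < r := norm_pos_iff.2 hw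
    set e1 := r⁻¹ • w with he1
    have n1 : ‖e1‖ = 1 := by rw [he1, norm_smul, ← hr]; simp [hrp.le, hrp.ne', abs_of_pos hrp]
    set f := r⁻¹ • w' with hf
    have nf : ‖f‖ = 1 := by rw [hf, norm_smul, ← h]; simp [hrp.le, hrp.ne', abs_of_pos hrp]
    clear_value e1 f
    set c := ⟪e1, f⟫ with hc'
    set v := f - c • e1 with hv
    have hve : ⟪e1, v⟫ = 0 := by
      rw [hv, inner_sub_right, real_inner_smul_right, real_inner_self_eq_norm_sq, n1, ← hc']; ring
    have hvn : ‖v‖ ^ 2 = 1 - c ^ 2 := by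
      rw [hv, norm_sub_sq_real, real_inner_smul_right, real_inner_comm, ← hc', norm_smul, n1, nf, mul_one,
        Real.norm_eq_abs, sq_abs]; ring
    obtain ⟨e2, n2, h12, hve2⟩ : ∃ e2 : E, ‖e2‖ = 1 ∧ ⟪e1, e2⟫ = 0 ∧ v = ‖v‖ • e2 := by
      by_cases h0 : v = 0
      · obtain ⟨z, hz, hz2⟩ := exists_perp hE e1
        exact ⟨z, hz, hz2, by simp [h0]⟩
      · have : ‖v‖ ≠ 0 := norm_ne_zero_iff.2 h0
        refine ⟨‖v‖⁻¹ • v, by simp [norm_smul, this], by rw [real_inner_smul_right, hve, mul_zero], ?_⟩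
        rw [smul_smul, mul_inv_cancel₀ this, one_smul]
    have hcb : |c| ≤ 1 := by
      rw [← abs_one, ← sq_le_sq]; nlinarith [sq_nonneg ‖v‖]
    have hcos := Real.cos_arccos (abs_le.1 hcb).1 (abs_le.1 hcb).2
    have hsin : Real.sin (Real.arccos c) = ‖v‖ := by
      rw [Real.sin_arccos, ← hvn, Real.sqrt_sq (norm_nonneg v)]
    have := circ e1 e2 r s n1 n2 h12 hrp.le 0 (Real.arccos c)
    rw [hcos, hsin, ← hve2, Real.cos_zero, Real.sin_zero, zero_smul, add_zero, one_smul] at this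
    have e3 : r • e1 = w := by rw [he1, smul_smul, mul_inv_cancel₀ hrp.ne', one_smul]
    have e4 : r • (c • e1 + v) = w' := by
      rw [hv, add_sub_cancel, hf, smul_smul, mul_inv_cancel₀ hrp.ne', one_smul]
    rw [e3, e4] at this
    exact this
  intro w w' Z h hw
  have h1 : (w, Z - 1) ∈ T' := by
    show (w, Z - 1) + o ∈ T
    rw [ho, Prod.mk_add_mk, add_zero, sub_add_cancel]; exact hw
  have h2 : (w', Z - 1) ∈ T' := by
    rw [hmem, ← inv w w' _ h, ← hmem]; exact h1
  have h3 : (w', Z - 1) + o ∈ T := h2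
  rwa [ho, Prod.mk_add_mk, add_zero, sub_add_cancel] at h3

end
end

section
open Set Module Filter Topology
open scoped RealInnerProductSpace
set_option linter.unusedSectionVars false

theorem S5core {I : Set ℝ} {r : ℝ → ℝ} (hIc : IsClosed I) (hr : ConcaveOn ℝ I r)
    (hnn : ∀ Z ∈ I, 0 ≤ r Z) (hr1 : r 1 = 1) (h1 : (1:ℝ) ∈ interior I) (hpos : ∀ Z ∈ interior I, 0 < r Z)
    (usc : ∀ (z x : ℕ → ℝ) (a y : ℝ), (∀ k, z k ∈ I) → (∀ k, x k ≤ r (z k)) → (∀ k, 0 ≤ x k) → Tendsto z atTop (𝓝 a) →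
      Tendsto x atTop (𝓝 y) → y ≤ r a)
    {m δ : ℕ → ℝ} (hm : Tendsto (fun j => |m j|) atTop atTop) (hδ : Tendsto δ atTop (𝓝 0))
    (step : ∀ᶠ j in atTop, ∀ Z ∈ I, ((Z + 1) / m j) ^ 2 ≤ r Z ^ 2 → Z + δ j ∈ I ∧
      r (Z + δ j) ^ 2 = r Z ^ 2 + (δ j - 2) * (2 * Z + δ j) / m j ^ 2)
    (back : ∀ᶠ j in atTop, ∀ Z ∈ I, ((Z - 1) / m j) ^ 2 ≤ r Z ^ 2 → Z - δ j ∈ I ∧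
      r (Z - δ j) ^ 2 = r Z ^ 2 - (δ j - 2) * (2 * Z - δ j) / m j ^ 2) :
    ∃ κ : ℝ, Tendsto (fun j => (2 - δ j) / (m j ^ 2 * δ j)) atTop (𝓝 κ) ∧ (∀ Z ∈ I, r Z ^ 2 = 1 + κ - κ * Z ^ 2) ∧
      ∀ a ∈ frontier I, κ * a ^ 2 = 1 + κ := by
  have h1I := interior_subset h1
  have bigm : ∀ C : ℝ, ∀ ε > 0, ∀ᶠ j in atTop, ∀ Z, |Z| ≤ C → (Z / m j) ^ 2 ≤ ε ^ 2 := by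
    intro C ε hε
    filter_upwards [hm.eventually (eventually_ge_atTop (C / ε)), hm.eventually (eventually_gt_atTop 0)] with j hj hj0 Z hZ
    rw [sq_le_sq, abs_div, abs_of_pos hε, div_le_iff₀ hj0]
    rw [div_le_iff₀ hε] at hj
    linarith
  have hδ0 : ∀ᶠ j in atTop, δ j ≠ 0 := by
    filter_upwards [step, bigm 2 1 one_pos, ev_ne hm] with j hj hj2 hj3 h0
    have := (hj 1 h1I (by rw [hr1]; exact hj2 _ (by norm_num))).2
    rw [h0] at this
    simp [hr1, hj3] at this
  set κ : ℕ → ℝ := fun j => (2 - δ j) / (m j ^ 2 * δ j) with hκ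
  -- unified step
  have ustep : ∀ᶠ j in atTop, 0 < |δ j| ∧ ∀ Z ∈ I, (∀ Y, |Y| ≤ |Z| + 1 → (Y / m j) ^ 2 ≤ r Z ^ 2) → Z + |δ j| ∈ I ∧
      r (Z + |δ j|) ^ 2 + κ j * (Z + |δ j|) ^ 2 = r Z ^ 2 + κ j * Z ^ 2 := by
    filter_upwards [step, back, hδ0, ev_ne hm] with j hs hb h0 hm0
    refine ⟨abs_pos.2 h0, fun Z hZ hY => ?_⟩
    have hκj : κ j * δ j = (2 - δ j) / m j ^ 2 := by
      simp only [hκ]; field_simp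
    rcases lt_or_gt_of_ne h0 with h | h
    · rw [abs_of_neg h]
      obtain ⟨q1, q2⟩ := hb Z hZ (hY _ (by
        have := abs_sub Z 1; simpa using this))
      rw [← sub_eq_add_neg]
      refine ⟨q1, ?_⟩
      rw [q2]
      have e : (δ j - 2) * (2 * Z - δ j) / m j ^ 2 = -(κ j * δ j) * (2 * Z - δ j) := by rw [hκj]; ring
      rw [e]; ring
    · rw [abs_of_pos h]
      obtain ⟨q1, q2⟩ := hs Z hZ (hY _ (by
        have := abs_add_le Z 1; simpa using this))
      refine ⟨q1, ?_⟩
      rw [q2]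
      have e : (δ j - 2) * (2 * Z + δ j) / m j ^ 2 = -(κ j * δ j) * (2 * Z + δ j) := by rw [hκj]; ring
      rw [e]; ring
  have hcontr : ContinuousOn r (interior I) := hr.continuousOn_interior
  -- the limit relation
  have lim : ∀ Z1 ∈ interior I, ∀ Z2 ∈ interior I, Z1 < Z2 → ∃ y : ℕ → ℝ, Tendsto y atTop (𝓝 Z2) ∧
      Tendsto (fun j => κ j * (y j ^ 2 - Z1 ^ 2)) atTop (𝓝 (r Z1 ^ 2 - r Z2 ^ 2)) := by
    intro Z1 hZ1 Z2 hZ2 h12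
    set ε := min (r Z1) (r Z2) with hε
    have hεp : 0 < ε := lt_min (hpos _ hZ1) (hpos _ hZ2)
    have hεr : ∀ Z ∈ Icc Z1 Z2, ε ≤ r Z := fun Z hZ =>
      hr.min_le_of_mem_Icc (interior_subset hZ1) (interior_subset hZ2) hZ
    set C := max |Z1| |Z2| + 1 with hC
    refine ⟨fun j => Z1 + (⌊(Z2 - Z1) / |δ j|⌋₊ : ℝ) * |δ j|, ?_, ?_⟩
    · have hsq : Tendsto (fun j => Z2 - |δ j|) atTop (𝓝 Z2) := by
        have := hδ.abs.const_sub Z2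
        simpa using this
      refine tendsto_of_tendsto_of_tendsto_of_le_of_le' hsq tendsto_const_nhds ?_ ?_
      · filter_upwards [ustep] with j hj
        have := (Nat.lt_floor_add_one ((Z2 - Z1) / |δ j|)).le
        rw [div_le_iff₀ hj.1] at this
        linarith
      · filter_upwards [ustep] with j hj
        have := Nat.floor_le (a := (Z2 - Z1) / |δ j|) (div_nonneg (by linarith) hj.1.le)
        rw [le_div_iff₀ hj.1] at this
        linarith
    · have hy : Tendsto (fun j => Z1 + (⌊(Z2 - Z1) / |δ j|⌋₊ : ℝ) * |δ j|) atTop (𝓝 Z2) := by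
        have hsq : Tendsto (fun j => Z2 - |δ j|) atTop (𝓝 Z2) := by
          have := hδ.abs.const_sub Z2
          simpa using this
        refine tendsto_of_tendsto_of_tendsto_of_le_of_le' hsq tendsto_const_nhds ?_ ?_
        · filter_upwards [ustep] with j hj
          have := (Nat.lt_floor_add_one ((Z2 - Z1) / |δ j|)).le
          rw [div_le_iff₀ hj.1] at this
          linarith
        · filter_upwards [ustep] with j hj
          have := Nat.floor_le (a := (Z2 - Z1) / |δ j|) (div_nonneg (by linarith) hj.1.le)
          rw [le_div_iff₀ hj.1] at this
          linarith
      have hcZ2 : ContinuousAt r Z2 := hcontr.continuousAt (isOpen_interior.mem_nhds hZ2)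
      have hlimr := ((hcZ2.tendsto.comp hy).pow 2).const_sub (r Z1 ^ 2)
      refine hlimr.congr' ?_
      filter_upwards [ustep, bigm C ε hεp] with j hj hj2
      have ind : ∀ k : ℕ, Z1 + k * |δ j| ≤ Z2 + |δ j| → Z1 + k * |δ j| ∈ I ∧
          r (Z1 + k * |δ j|) ^ 2 + κ j * (Z1 + k * |δ j|) ^ 2 = r Z1 ^ 2 + κ j * Z1 ^ 2 := by
        intro k
        induction k with
        | zero => intro _; simpa using interior_subset hZ1
        | succ k ih =>
          intro hk
          push_cast at hk ⊢
          have hk1 : Z1 + k * |δ j| ≤ Z2 := by linarith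
          obtain ⟨i1, i2⟩ := ih (by linarith [hj.1])
          have hk0 : Z1 ≤ Z1 + k * |δ j| := by
            have : 0 ≤ (k:ℝ) * |δ j| := by positivity
            linarith
          obtain ⟨q1, q2⟩ := hj.2 _ i1 (fun Y hY => by
            refine (hj2 Y ?_).trans ?_
            · have := abs_le_max_abs_abs hk0 hk1
              linarith
            · have := hεr _ ⟨hk0, hk1⟩
              gcongr)
          have e : Z1 + (k + 1) * |δ j| = Z1 + k * |δ j| + |δ j| := by ring
          rw [e]
          exact ⟨q1, q2.trans i2⟩
      have hfl := Nat.floor_le (a := (Z2 - Z1) / |δ j|) (div_nonneg (by linarith) hj.1.le)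
      rw [le_div_iff₀ hj.1] at hfl
      have := (ind _ (by linarith [hj.1] : Z1 + (⌊(Z2 - Z1) / |δ j|⌋₊ : ℝ) * |δ j| ≤ Z2 + |δ j|)).2
      simp only [Function.comp]
      linarith
  -- kappa converges
  obtain ⟨Z2, hZ2, h12⟩ : ∃ Z2 ∈ interior I, (1:ℝ) < Z2 := by
    have ev : ∀ᶠ z in 𝓝[>] (1:ℝ), z ∈ interior I := nhdsWithin_le_nhds (isOpen_interior.mem_nhds h1)
    obtain ⟨z, hz1, hz2⟩ := (ev.and self_mem_nhdsWithin).exists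
    exact ⟨z, hz1, hz2⟩
  obtain ⟨K, hK⟩ : ∃ K, Tendsto κ atTop (𝓝 K) := by
    obtain ⟨y, hy1, hy2⟩ := lim 1 h1 Z2 hZ2 h12
    have hne : Z2 ^ 2 - 1 ^ 2 ≠ 0 := by nlinarith
    have hy3 : Tendsto (fun j => y j ^ 2 - 1 ^ 2) atTop (𝓝 (Z2 ^ 2 - 1 ^ 2)) := (hy1.pow 2).sub_const _
    refine ⟨_, (hy2.div hy3 hne).congr' ?_⟩
    filter_upwards [hy3.eventually_ne hne] with j hj
    simp only [Pi.div_apply]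
    rw [mul_div_cancel_right₀ _ hj]
  refine ⟨K, hK, ?_⟩
  have rel : ∀ Z1 ∈ interior I, ∀ Z2 ∈ interior I, Z1 < Z2 → K * (Z2 ^ 2 - Z1 ^ 2) = r Z1 ^ 2 - r Z2 ^ 2 := by
    intro Z1 hZ1 Z2 hZ2 h12
    obtain ⟨y, hy1, hy2⟩ := lim Z1 hZ1 Z2 hZ2 h12
    exact tendsto_nhds_unique (hK.mul ((hy1.pow 2).sub_const _)) hy2
  have relI : ∀ Z ∈ interior I, r Z ^ 2 = 1 + K - K * Z ^ 2 := by
    intro Z hZ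
    rcases lt_trichotomy Z 1 with h | h | h
    · have := rel Z hZ 1 h1 h
      rw [hr1] at this
      linarith
    · rw [h, hr1]; ring
    · have := rel 1 h1 Z hZ h
      rw [hr1] at this
      linarith
  -- end points
  have hfr : ∀ a ∈ frontier I, r a = 0 ∧ K * a ^ 2 = 1 + K := by
    intro a ha
    have haI : a ∈ I := hIc.frontier_subset ha
    have hra : r a = 0 := by
      by_contra hne
      have hp : 0 < r a := lt_of_le_of_ne (hnn a haI) (Ne.symm hne)
      have b := bigm (|a| + 1) (r a) hp
      obtain ⟨j, ⟨⟨hs, hb⟩, h0⟩, hbj⟩ := (((step.and back).and hδ0).and b).exists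
      have q1 := (hs a haI (hbj _ (by have := abs_add_le a 1; simpa using this))).1
      have q2 := (hb a haI (hbj _ (by have := abs_sub a 1; simpa using this))).1
      apply ha.2
      have hmin : Icc (a - |δ j|) (a + |δ j|) ⊆ I := by
        have : a - |δ j| ∈ I ∧ a + |δ j| ∈ I := by
          rcases abs_cases (δ j) with ⟨h, _⟩ | ⟨h, _⟩
          · rw [h]; exact ⟨q2, q1⟩
          · rw [h, sub_neg_eq_add, ← sub_eq_add_neg]; exact ⟨q1, q2⟩
        exact (hr.1.ordConnected).out this.1 this.2
      rw [mem_interior_iff_mem_nhds]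
      have hp2 : 0 < |δ j| := abs_pos.2 h0
      exact Filter.mem_of_superset (Icc_mem_nhds (by linarith) (by linarith)) hmin
    refine ⟨hra, ?_⟩
    have hac : a ∈ closure (interior I) := by
      rw [hr.1.closure_interior_eq_closure_of_nonempty_interior ⟨1, h1⟩]; exact ha.1
    obtain ⟨z, hz1, hz2⟩ := mem_closure_iff_seq_limit.1 hac
    have hlim : Tendsto (fun k => r (z k) ^ 2) atTop (𝓝 (1 + K - K * a ^ 2)) := by
      have : Tendsto (fun k => 1 + K - K * z k ^ 2) atTop (𝓝 (1 + K - K * a ^ 2)) := ((hz2.pow 2).const_mul K).const_sub _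
      exact this.congr fun k => (relI _ (hz1 k)).symm
    have hge : 0 ≤ 1 + K - K * a ^ 2 := ge_of_tendsto' hlim fun k => sq_nonneg _
    have hlim2 : Tendsto (fun k => r (z k)) atTop (𝓝 (√(1 + K - K * a ^ 2))) := by
      have := (Real.continuous_sqrt.tendsto _).comp hlim
      refine this.congr fun k => ?_
      simp only [Function.comp]
      rw [Real.sqrt_sq (hpos _ (hz1 k)).le]
    have := usc z (fun k => r (z k)) a _ (fun k => interior_subset (hz1 k)) (fun k => le_rfl)
      (fun k => (hpos _ (hz1 k)).le) hz2 hlim2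
    rw [hra] at this
    have h3 := Real.sqrt_eq_zero'.1 (le_antisymm this (Real.sqrt_nonneg _))
    linarith
  refine ⟨fun Z hZ => ?_, fun a ha => (hfr a ha).2⟩
  by_cases h : Z ∈ interior I
  · exact relI Z h
  · obtain ⟨q1, q2⟩ := hfr Z ⟨subset_closure hZ, h⟩
    rw [q1]; linarith
end

section
open Set Module Filter Topology
open scoped RealInnerProductSpace
set_option linter.unusedSectionVars false

section
variable {E : Type*} [NormedAddCommGroup E] [InnerProductSpace ℝ E] [FiniteDimensional ℝ E]

theorem tr_par {T : Set (E × ℝ)} {M : ℝ} (hT : Good T M) (hR : RotInv T)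
    (hb : ∀ w : E, (w, (1:ℝ)) ∈ T ↔ ‖w‖ ≤ 1) {n : E} (hn : ‖n‖ = 1) {m : ℝ} (hm : 2 ≤ |m|) {t : E × ℝ}
    (ht : Tr T n m t) : t.1 = ⟪n, t.1⟫ • n := by
  have hm0 : m ≠ 0 := by rintro rfl; simp at hm; linarith
  set rf : E → E := fun w => (2 * ⟪n, w⟫) • n - w with hrf
  have nn : ⟪n, n⟫ = 1 := by rw [real_inner_self_eq_norm_sq, hn]; norm_num
  have rf1 : ∀ w, ⟪n, rf w⟫ = ⟪n, w⟫ := by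
    intro w; simp only [hrf, inner_sub_right, real_inner_smul_right, nn]; ring
  have rf2 : ∀ w, ‖rf w‖ = ‖w‖ := by
    intro w
    have : ‖rf w‖ ^ 2 = ‖w‖ ^ 2 := by
      simp only [hrf]
      rw [norm_sub_sq_real, real_inner_smul_left, norm_smul, hn, mul_one, Real.norm_eq_abs, sq_abs]; ring
    exact (pow_left_inj₀ (norm_nonneg _) (norm_nonneg _) two_ne_zero).1 this
  have rf3 : ∀ v w, rf (v + w) = rf v + rf w := by
    intro v w; simp only [hrf, inner_add_right]; module
  have rf4 : ∀ w, rf (rf w) = w := by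
    intro w
    show (2 * ⟪n, rf w⟫) • n - rf w = w
    rw [rf1]; simp only [hrf]; abel
  have rf5 : ∀ w, rf (-w) = -rf w := by
    intro w; simp only [hrf, inner_neg_right]; module
  set v : E × ℝ := (t.1 - rf t.1, 0) with hv
  have hvn : ⟪n, v.1⟫ = 0 := by simp only [hv, inner_sub_right, rf1, sub_self]
  have plus : ∀ p : E × ℝ, p.2 = m * ⟪n, p.1⟫ - 1 → p ∈ T → p + v ∈ T := by
    intro p hp hpT
    have a1 : (p.1 + t.1, p.2 + t.2) ∈ T := (ht.2 p hp).1 hpT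
    have a2 : (rf (p.1 + t.1), p.2 + t.2) ∈ T := hR _ _ _ (rf2 _).symm a1
    have a3 : (rf (p.1 + t.1), p.2 + t.2) + (-t) ∈ T := (ht.back _ (by
      simp only [rf1, inner_add_right, hp, ht.1]; ring)).1 a2
    have a4 := hR _ _ _ (rf2 ((rf (p.1 + t.1), p.2 + t.2) + (-t)).1).symm a3
    convert a4 using 1
    ext
    · simp only [Prod.fst_add, Prod.fst_neg, rf3, rf4, rf5, hv]; abel
    · simp [hv]
  have minus : ∀ p : E × ℝ, p.2 = m * ⟪n, p.1⟫ - 1 → p ∈ T → p - v ∈ T := by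
    intro p hp hpT
    have a1 : (rf p.1, p.2) ∈ T := hR _ _ _ (rf2 _).symm hpT
    have a2 : (rf p.1, p.2) + t ∈ T := (ht.2 _ (by simp only [rf1, hp])).1 a1
    have a3 := hR _ _ _ (rf2 ((rf p.1, p.2) + t).1).symm a2
    have a4 := (ht.back _ (by
      simp only [rf1, Prod.fst_add, Prod.snd_add, inner_add_right, hp, ht.1]; ring)).1 a3
    convert a4 using 1
    ext
    · simp only [Prod.fst_add, Prod.fst_neg, rf3, rf4, hv, Prod.fst_sub]; abel
    · simp [hv]
  set p : E × ℝ := ((2 / m) • n, 1) with hp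
  have hp1 : p.2 = m * ⟪n, p.1⟫ - 1 := by
    simp only [hp, real_inner_smul_right, nn]; field_simp; norm_num
  have hpT : p ∈ T := by
    rw [hp, hb, norm_smul, hn, mul_one, Real.norm_eq_abs, abs_div, abs_two, div_le_one (by linarith)]; exact hm
  have l1 : ∀ k : ℕ, p + (k:ℝ) • v ∈ T := by
    intro k
    induction k with
    | zero => simpa using hpT
    | succ k ih =>
      have := plus _ (by
        simp only [Prod.fst_add, Prod.snd_add, Prod.smul_fst, Prod.smul_snd, inner_add_right, real_inner_smul_right, hvn, hp1]
        simp [hv]) ih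
      convert this using 1
      push_cast; module
  have l2 : ∀ k : ℕ, p - (k:ℝ) • v ∈ T := by
    intro k
    induction k with
    | zero => simpa using hpT
    | succ k ih =>
      have := minus _ (by
        simp only [Prod.fst_sub, Prod.snd_sub, Prod.smul_fst, Prod.smul_snd, inner_sub_right, real_inner_smul_right, hvn, hp1]
        simp [hv]) ih
      convert this using 1
      push_cast; module
  have hv0 := no_line hT l1 l2
  have : t.1 - rf t.1 = 0 := congrArg Prod.fst hv0
  have e : t.1 - rf t.1 = (2:ℝ) • (t.1 - ⟪n, t.1⟫ • n) := by simp only [hrf]; module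
  rw [e] at this
  have := (smul_eq_zero.1 this).resolve_left two_ne_zero
  exact sub_eq_zero.1 this

theorem S5 (hE : 2 ≤ finrank ℝ E) {T : Set (E × ℝ)} {M : ℝ} (hT : Good T M) (hR : RotInv T)
    (hb : ∀ w : E, (w, (1:ℝ)) ∈ T ↔ ‖w‖ ≤ 1) {n : E} (hn : ‖n‖ = 1) {m : ℕ → ℝ} {t : ℕ → E × ℝ}
    (hm : Tendsto (fun j => |m j|) atTop atTop) (ht : ∀ j, Tr T n (m j) (t j)) :
    ∃ κ : ℝ, Tendsto (fun j => (2 - (t j).2) / (m j ^ 2 * (t j).2)) atTop (𝓝 κ) ∧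
      (∀ w Z, (w, Z) ∈ T ↔ ((0:E), Z) ∈ T ∧ ‖w‖ ^ 2 ≤ 1 + κ - κ * Z ^ 2) ∧
      ∀ a ∈ frontier {Z : ℝ | ((0:E), Z) ∈ T}, κ * a ^ 2 = 1 + κ := by
  obtain ⟨z, hz, hnz⟩ := exists_perp hE n
  have nn : ⟪n, n⟫ = 1 := by rw [real_inner_self_eq_norm_sq, hn]; norm_num
  set I : Set ℝ := {Z : ℝ | ((0:E), Z) ∈ T} with hI
  set r : ℝ → ℝ := fun Z => sSup {x : ℝ | (x • n, Z) ∈ T} with hr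
  have nx : ∀ x : ℝ, ‖x • n‖ = |x| := fun x => by rw [norm_smul, hn, mul_one, Real.norm_eq_abs]
  have hbdd : ∀ Z, BddAbove {x : ℝ | (x • n, Z) ∈ T} := by
    intro Z
    refine ⟨M * (Z + M), fun x hx => ?_⟩
    have := hT.bd _ hx
    rw [nx] at this
    exact (le_abs_self x).trans this
  have shrink : ∀ (x y Z : ℝ), 0 ≤ x → |y| ≤ x → (x • n, Z) ∈ T → (y • n, Z) ∈ T := by
    intro x y Z hx hy hxT
    rcases hx.eq_or_lt with h | h
    · rw [← h] at hy hxT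
      have : y = 0 := by simpa using hy
      rwa [this]
    have hneg : ((-x) • n, Z) ∈ T := hR _ _ _ (by rw [nx, nx, abs_neg]) hxT
    obtain ⟨hy1, hy2⟩ := abs_le.1 hy
    have := hT.conv hxT hneg (a := (x + y) / (2 * x)) (b := (x - y) / (2 * x)) (by apply div_nonneg <;> linarith)
      (by apply div_nonneg <;> linarith) (by field_simp; ring)
    convert this using 1
    ext
    · simp only [Prod.fst_add, Prod.smul_fst, smul_smul, ← add_smul]
      congr 1; field_simp; ring
    · simp; field_simp; ring
  have hP : ∀ x Z : ℝ, (x • n, Z) ∈ T ↔ Z ∈ I ∧ |x| ≤ r Z := by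
    intro x Z
    constructor
    · intro h
      have h2 : (|x| • n, Z) ∈ T := hR _ _ _ (by rw [nx, nx, abs_abs]) h
      refine ⟨?_, le_csSup (hbdd Z) h2⟩
      have := shrink |x| 0 Z (abs_nonneg x) (by simp) h2
      rwa [zero_smul] at this
    · rintro ⟨h1, h2⟩
      have hcl : IsClosed {x : ℝ | (x • n, Z) ∈ T} := hT.cl.preimage (f := fun x : ℝ => (x • n, Z)) (by fun_prop)
      have hmem : (r Z • n, Z) ∈ T := hcl.csSup_mem ⟨0, by
        show ((0:ℝ) • n, Z) ∈ T
        rw [zero_smul]; exact h1⟩ (hbdd Z)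
      exact shrink (r Z) x Z ((abs_nonneg x).trans h2) h2 hmem
  have hW : ∀ (w : E) (Z : ℝ), (w, Z) ∈ T ↔ Z ∈ I ∧ ‖w‖ ≤ r Z := by
    intro w Z
    have := hP ‖w‖ Z
    rw [abs_norm] at this
    rw [← this]
    exact ⟨hR _ _ _ (by rw [nx, abs_norm]), hR _ _ _ (by rw [nx, abs_norm])⟩
  have hnn : ∀ Z ∈ I, 0 ≤ r Z := by
    intro Z hZ
    have := ((hW 0 Z).1 hZ).2
    simpa using this
  have hIc : IsClosed I := hT.cl.preimage (f := fun Z : ℝ => ((0:E), Z)) (by fun_prop)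
  have hIconv : Convex ℝ I := by
    intro x hx y hy a b ha hb hab
    have := hT.conv hx hy ha hb hab
    show ((0:E), a • x + b • y) ∈ T
    convert this using 1
    ext <;> simp
  have hconc : ConcaveOn ℝ I r := by
    refine ⟨hIconv, fun x hx y hy a b ha hb hab => ?_⟩
    have h1 : (r x • n, x) ∈ T := (hP _ _).2 ⟨hx, by rw [abs_of_nonneg (hnn x hx)]⟩
    have h2 : (r y • n, y) ∈ T := (hP _ _).2 ⟨hy, by rw [abs_of_nonneg (hnn y hy)]⟩
    have h3 : ((a * r x + b * r y) • n, a • x + b • y) ∈ T := by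
      convert hT.conv h1 h2 ha hb hab using 1
      ext
      · simp only [Prod.fst_add, Prod.smul_fst]; module
      · simp
    exact (le_abs_self _).trans ((hP _ _).1 h3).2
  have hoT : ((0:E), (1:ℝ)) ∈ T := interior_subset hT.o_int
  have ho1 : (1:ℝ) ∈ I := hoT
  have hr1 : r 1 = 1 := by
    apply le_antisymm
    · have h1 : (r 1 • n, (1:ℝ)) ∈ T := (hP _ _).2 ⟨ho1, by
        rw [abs_of_nonneg (hnn 1 ho1)]⟩
      rw [hb, nx] at h1
      exact (le_abs_self _).trans h1
    · have h1 : ((1:ℝ) • n, (1:ℝ)) ∈ T := by rw [hb, nx]; simp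
      simpa using ((hP _ _).1 h1).2
  have hcI : Continuous fun Z : ℝ => ((0:E), Z) := by fun_prop
  have h1 : (1:ℝ) ∈ interior I := by
    rw [mem_interior_iff_mem_nhds]
    exact hcI.continuousAt.preimage_mem_nhds (mem_interior_iff_mem_nhds.1 hT.o_int)
  have hpos : ∀ Z ∈ interior I, 0 < r Z := by
    intro Z hZ
    have hZI : ((0:E), Z) ∈ interior T := by
      have ev : ∀ᶠ ε in 𝓝[>] (0:ℝ), Z + ε * (Z - 1) ∈ I := by
        have hc : Continuous fun ε : ℝ => Z + ε * (Z - 1) := by fun_prop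
        have := hc.tendsto 0
        rw [zero_mul, add_zero] at this
        exact nhdsWithin_le_nhds (this.eventually (mem_interior_iff_mem_nhds.1 hZ))
      obtain ⟨ε, h3, h4⟩ := (ev.and self_mem_nhdsWithin).exists
      have h4' : 0 < ε := h4
      have := hT.conv.combo_interior_self_mem_interior hT.o_int h3 (a := ε / (1 + ε)) (b := 1 / (1 + ε)) (by positivity)
        (by positivity) (by field_simp; ring)
      convert this using 1
      ext
      · simp
      · simp; field_simp; ring
    have ev : ∀ᶠ ε in 𝓝[>] (0:ℝ), (ε • n, Z) ∈ T := by
      have hc : Continuous fun ε : ℝ => (ε • n, Z) := by fun_prop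
      have := hc.tendsto 0
      rw [zero_smul] at this
      exact nhdsWithin_le_nhds (this.eventually (mem_interior_iff_mem_nhds.1 hZI))
    obtain ⟨ε, h3, h4⟩ := (ev.and self_mem_nhdsWithin).exists
    have h4' : 0 < ε := h4
    have := ((hP _ _).1 h3).2
    rw [abs_of_pos h4'] at this
    linarith
  have nw : ∀ a b : ℝ, ‖a • n + b • z‖ ^ 2 = a ^ 2 + b ^ 2 := by
    intro a b
    rw [norm_add_sq_real, real_inner_smul_left, real_inner_smul_right, hnz, norm_smul, norm_smul, hn, hz]; simp
  have iw : ∀ a b : ℝ, ⟪n, a • n + b • z⟫ = a := by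
    intro a b; rw [inner_add_right, real_inner_smul_right, real_inner_smul_right, nn, hnz]; ring
  have hW2 : ∀ a b Z : ℝ, (a • n + b • z, Z) ∈ T ↔ Z ∈ I ∧ a ^ 2 + b ^ 2 ≤ r Z ^ 2 := by
    intro a b Z
    rw [hW, ← nw]
    refine and_congr_right fun hZ => ?_
    rw [sq_le_sq, abs_norm, abs_of_nonneg (hnn Z hZ)]
  have gen : ∀ (m ε a δ : ℝ), m ≠ 0 → (∀ p : E × ℝ, p.2 = m * ⟪n, p.1⟫ - ε → (p ∈ T ↔ p + (a • n, δ) ∈ T)) →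
      ∀ Z ∈ I, ((Z + ε) / m) ^ 2 ≤ r Z ^ 2 → Z + δ ∈ I ∧ r (Z + δ) ^ 2 = r Z ^ 2 + a * (2 * ((Z + ε) / m) + a) := by
    intro m ε a δ hm htr Z hZ hZr
    set s := (Z + ε) / m with hs
    have tr2 : ∀ y : ℝ, s ^ 2 + y ^ 2 ≤ r Z ^ 2 ↔ Z + δ ∈ I ∧ (s + a) ^ 2 + y ^ 2 ≤ r (Z + δ) ^ 2 := by
      intro y
      have e1 : (s • n + y • z, Z) + (a • n, δ) = ((s + a) • n + y • z, Z + δ) := by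
        ext
        · simp only [Prod.fst_add]; module
        · simp
      have := htr (s • n + y • z, Z) (by simp only [iw, hs]; field_simp; ring)
      rw [e1, hW2, hW2] at this
      rw [← this]
      exact ⟨fun h => ⟨hZ, h⟩, fun h => h.2⟩
    have y1 := (tr2 (√(r Z ^ 2 - s ^ 2))).1 (by rw [Real.sq_sqrt (by linarith)]; linarith)
    rw [Real.sq_sqrt (by linarith)] at y1
    have hb2 : (s + a) ^ 2 ≤ r (Z + δ) ^ 2 := by linarith [y1.2]
    have y2 := (tr2 (√(r (Z + δ) ^ 2 - (s + a) ^ 2))).2 ⟨y1.1, by rw [Real.sq_sqrt (by linarith)]; linarith⟩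
    rw [Real.sq_sqrt (by linarith)] at y2
    refine ⟨y1.1, le_antisymm ?_ ?_⟩
    · nlinarith
    · nlinarith [y1.2]
  have hδ : Tendsto (fun j => (t j).2) atTop (𝓝 0) := by
    have := VT hT hn hm ht
    exact (continuous_snd.tendsto (0 : E × ℝ)).comp this
  obtain ⟨κ, k1, k2, k3⟩ := S5core hIc hconc hnn hr1 h1 hpos (by
      intro zz x a y hz1 hx1 hx0 hz2 hx2
      have hl : Tendsto (fun k => (x k • n, zz k)) atTop (𝓝 (y • n, a)) := (hx2.smul_const n).prodMk_nhds hz2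
      have := hT.cl.mem_of_tendsto hl (Eventually.of_forall fun k => (hP _ _).2 ⟨hz1 k, by
        rw [abs_of_nonneg (hx0 k)]; exact hx1 k⟩)
      exact (le_abs_self y).trans ((hP _ _).1 this).2) hm hδ (by
      filter_upwards [hm.eventually (eventually_ge_atTop 2), ev_ne hm] with j hj hj0 Z hZ hZr
      have hpar := tr_par hT hR hb hn hj (ht j)
      have h2 := (ht j).1
      set a := ⟪n, (t j).1⟫ with ha
      have hte : t j = (a • n, (t j).2) := by ext; · exact hpar
                                              · rfl
      obtain ⟨q1, q2⟩ := gen (m j) 1 a (t j).2 hj0 (by rw [← hte]; exact (ht j).2) Z hZ hZr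
      refine ⟨q1, q2.trans ?_⟩
      have e : a = ((t j).2 - 2) / m j := by rw [h2]; field_simp; ring
      rw [e]; field_simp; ring) (by
      filter_upwards [hm.eventually (eventually_ge_atTop 2), ev_ne hm] with j hj hj0 Z hZ hZr
      have hpar := tr_par hT hR hb hn hj (ht j)
      have h2 := (ht j).1
      set a := ⟪n, (t j).1⟫ with ha
      have hte : -t j = ((-a) • n, -(t j).2) := by
        ext
        · rw [Prod.fst_neg, hpar, neg_smul]
        · rfl
      obtain ⟨q1, q2⟩ := gen (m j) (-1) (-a) (-(t j).2) hj0 (fun p hp => by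
        rw [← hte]; exact (ht j).back p (by rw [hp]; ring)) Z hZ (by rw [← sub_eq_add_neg]; exact hZr)
      rw [← sub_eq_add_neg] at q1 q2
      refine ⟨q1, q2.trans ?_⟩
      have e : a = ((t j).2 - 2) / m j := by rw [h2]; field_simp; ring
      rw [e]; field_simp; ring)
  refine ⟨κ, k1, fun w Z => ?_, k3⟩
  rw [hW]
  refine and_congr_right fun hZ => ?_
  rw [← k2 Z hZ, sq_le_sq, abs_norm, abs_of_nonneg (hnn Z hZ)]

end
end

section
open Set Module Filter Topology
open scoped RealInnerProductSpace
set_option linter.unusedSectionVars false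

section
variable {E : Type*} [NormedAddCommGroup E] [InnerProductSpace ℝ E] [FiniteDimensional ℝ E]

/-- `(w, Z) ↦ (L w, Z + η w)` -/
noncomputable def gE (L : E ≃ₗ[ℝ] E) (η : E →ₗ[ℝ] ℝ) : (E × ℝ) ≃ₗ[ℝ] (E × ℝ) where
  toFun p := (L p.1, p.2 + η p.1)
  invFun p := (L.symm p.1, p.2 - η (L.symm p.1))
  map_add' p q := by ext <;> simp; ring
  map_smul' t p := by ext <;> simp; ring
  left_inv p := by ext <;> simp
  right_inv p := by ext <;> simp

theorem gE_apply (L : E ≃ₗ[ℝ] E) (η : E →ₗ[ℝ] ℝ) (w : E) (Z : ℝ) : gE L η (w, Z) = (L w, Z + η w) := rfl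

noncomputable def gH (L : E ≃ₗ[ℝ] E) (η : E →ₗ[ℝ] ℝ) : (E × ℝ) ≃ₜ (E × ℝ) :=
  (gE L η).toContinuousLinearEquiv.toHomeomorph

theorem gH_apply (L : E ≃ₗ[ℝ] E) (η : E →ₗ[ℝ] ℝ) (w : E) (Z : ℝ) : gH L η (w, Z) = (L w, Z + η w) := rfl

theorem gH_coe (L : E ≃ₗ[ℝ] E) (η : E →ₗ[ℝ] ℝ) : ⇑(gH L η) = ⇑(gE L η) := rfl

theorem gH_convex (L : E ≃ₗ[ℝ] E) (η : E →ₗ[ℝ] ℝ) {K : Set (E × ℝ)} (hK : Convex ℝ K) : Convex ℝ (gH L η ⁻¹' K) := by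
  rw [gH_coe]
  exact hK.linear_preimage (gE L η).toLinearMap

theorem gH_interior (L : E ≃ₗ[ℝ] E) (η : E →ₗ[ℝ] ℝ) {K : Set (E × ℝ)} {p : E × ℝ} (h : gH L η p ∈ interior K) :
    p ∈ interior (gH L η ⁻¹' K) := by
  rw [← (gH L η).preimage_interior]; exact h

theorem gH_compact (L : E ≃ₗ[ℝ] E) (η : E →ₗ[ℝ] ℝ) {K : Set (E × ℝ)} (hK : IsCompact K) :
    IsCompact (gH L η ⁻¹' K) := (gH L η).isCompact_preimage.2 hK

theorem gH_closed (L : E ≃ₗ[ℝ] E) (η : E →ₗ[ℝ] ℝ) {K : Set (E × ℝ)} (hK : IsClosed K) :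
    IsClosed (gH L η ⁻¹' K) := hK.preimage (gH L η).continuous

theorem gH_tr (L : E ≃ₗ[ℝ] E) (η0 : E →ₗ[ℝ] ℝ) {A B : Set (E × ℝ)} {η : E →ₗ[ℝ] ℝ} {c : E}
    (h : ∀ w, (w, ((η + η0) ∘ₗ L.symm.toLinearMap) w - 1) ∈ A ↔
      (w + c, ((η + η0) ∘ₗ L.symm.toLinearMap) (w + c) + 1) ∈ B) (w : E) :
    (w, η w - 1) ∈ gH L η0 ⁻¹' A ↔ (w + L.symm c, η (w + L.symm c) + 1) ∈ gH L η0 ⁻¹' B := by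
  have := h (L w)
  simp only [mem_preimage, gH_apply, map_add, LinearEquiv.apply_symm_apply]
  simp only [LinearMap.comp_apply, LinearMap.add_apply, map_add, LinearEquiv.coe_coe, LinearEquiv.symm_apply_apply] at this
  convert this using 3 <;> ring

theorem good_compact {K : Set (E × ℝ)} (hc : Convex ℝ K) (hK : IsCompact K) (h1 : ((0:E), (1:ℝ)) ∈ interior K) :
    ∃ M, Good K M := by
  obtain ⟨R, hR⟩ := hK.isBounded.exists_norm_le
  have hR1 : 0 ≤ R := (norm_nonneg _).trans (hR _ (interior_subset h1))
  refine ⟨R + 2, hK.isClosed, hc, h1, by linarith, fun p hp => ?_⟩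
  have h3 := hR p hp
  have h4 := norm_fst_le p
  have h5 := (norm_snd_le p).trans h3
  have h6 := neg_abs_le p.2
  rw [Real.norm_eq_abs] at h5
  nlinarith

theorem tr_of_htr {A : Set (E × ℝ)} {n : E} {m : ℝ} {c : E}
    (h : ∀ w, (w, (m • (innerₛₗ ℝ n : E →ₗ[ℝ] ℝ)) w - 1) ∈ A ↔ (w + c, (m • (innerₛₗ ℝ n : E →ₗ[ℝ] ℝ)) (w + c) + 1) ∈ A) :
    Tr A n m (c, 2 + m * ⟪n, c⟫) := by
  refine ⟨rfl, fun p hp => ?_⟩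
  have := h p.1
  simp only [LinearMap.smul_apply, innerₛₗ_apply_apply, smul_eq_mul, inner_add_right] at this
  convert this using 2
  · ext <;> simp [hp]
  · ext <;> simp [hp]; ring

theorem abs_tend : Tendsto (fun j : ℕ => |((j:ℝ) + 1)|) atTop atTop := by
  have : Tendsto (fun j : ℕ => ((j:ℝ) + 1)) atTop atTop :=
    tendsto_atTop_add_const_right _ _ tendsto_natCast_atTop_atTop
  exact tendsto_abs_atTop_atTop.comp this

theorem TN3 (hE : 2 ≤ finrank ℝ E) {K : Set (E × ℝ)} (hc : Convex ℝ K) (hK : IsCompact K)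
    (h1 : ((0:E), (1:ℝ)) ∈ interior K) (h2 : ((0:E), (-1:ℝ)) ∈ interior K)
    (htr : ∀ η : E →ₗ[ℝ] ℝ, ∃ c, ∀ w, (w, η w - 1) ∈ K ↔ (w + c, η (w + c) + 1) ∈ K)
    (hb1 : ∀ w : E, (w, (1:ℝ)) ∈ K ↔ ‖w‖ ≤ 1) (hb2 : ∀ w : E, (w, (-1:ℝ)) ∈ K ↔ ‖w‖ ≤ 1) :
    ∃ κ : ℝ, 0 < κ ∧ ∀ w Z, (w, Z) ∈ K ↔ ‖w‖ ^ 2 + κ * Z ^ 2 ≤ 1 + κ := by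
  obtain ⟨M, hT⟩ := good_compact hc hK h1
  have hTr : ∀ n : E, ‖n‖ = 1 → ∀ m : ℝ, ∃ t : E × ℝ, Tr K n m t := by
    intro n hn m
    obtain ⟨c, hcc⟩ := htr (m • (innerₛₗ ℝ n : E →ₗ[ℝ] ℝ))
    exact ⟨_, tr_of_htr hcc⟩
  have hP := S3_noncut hE hT h2 hb1 hb2 hTr
  have hR := S4 hE hT hP
  obtain ⟨n, hn, -⟩ := exists_perp hE 0
  choose t ht using fun j : ℕ => hTr n hn (j + 1)
  obtain ⟨κ, -, hκ, hfr⟩ := S5 hE hT hR hb1 hn abs_tend ht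
  set I : Set ℝ := {Z : ℝ | ((0:E), Z) ∈ K} with hI
  have hIemb : Continuous (fun Z : ℝ => ((0:E), Z)) := by fun_prop
  have hIc : IsClosed I := hK.isClosed.preimage hIemb
  have hIcpt : IsCompact I := by
    have : I ⊆ Prod.snd '' K := fun Z hZ => ⟨_, hZ, rfl⟩
    exact (hK.image continuous_snd).of_isClosed_subset hIc this
  have hi1 : (1:ℝ) ∈ interior I := preimage_interior_subset_interior_preimage hIemb h1
  have hi2 : (-1:ℝ) ∈ interior I := preimage_interior_subset_interior_preimage hIemb h2
  have hne : I.Nonempty := ⟨1, interior_subset hi1⟩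
  have haI := hIcpt.sSup_mem hne
  have hbI := hIcpt.sInf_mem hne
  set a := sSup I with ha
  set b := sInf I with hb
  have hle : ∀ x ∈ I, x ≤ a := fun x hx => le_csSup hIcpt.bddAbove hx
  have hge : ∀ x ∈ I, b ≤ x := fun x hx => csInf_le hIcpt.bddBelow hx
  have nint : ∀ x ∈ interior I, b < x ∧ x < a := by
    intro x hx
    obtain ⟨ε, hε, hball⟩ := Metric.mem_nhds_iff.1 (mem_interior_iff_mem_nhds.1 hx)
    have e1 := hle _ (hball (show x + ε / 2 ∈ Metric.ball x ε by simp [abs_of_pos hε]; linarith))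
    have e2 := hge _ (hball (show x - ε / 2 ∈ Metric.ball x ε by simp [Real.dist_eq, abs_of_pos hε]; linarith))
    constructor <;> linarith
  have hfa := hfr a ⟨subset_closure haI, fun h => lt_irrefl _ (nint _ h).2⟩
  have hfb := hfr b ⟨subset_closure hbI, fun h => lt_irrefl _ (nint _ h).1⟩
  have ha1 := (nint _ hi1).2
  have hb1' := (nint _ hi2).1
  have hk : 0 < κ := by
    have ha2 : 0 < a ^ 2 - 1 := by nlinarith
    have hk1 : κ * (a ^ 2 - 1) = 1 := by linarith
    by_contra hcon
    push Not at hcon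
    nlinarith
  have hab : b = -a := by
    have : κ * ((a - b) * (a + b)) = 0 := by linarith
    rcases mul_eq_zero.1 this with h | h
    · linarith
    · rcases mul_eq_zero.1 h with h | h <;> linarith
  refine ⟨κ, hk, fun w Z => ?_⟩
  rw [hκ w Z]
  constructor
  · rintro ⟨-, h⟩; linarith
  · intro h
    refine ⟨?_, by linarith⟩
    have h4 : κ * Z ^ 2 ≤ κ * a ^ 2 := by nlinarith [sq_nonneg ‖w‖]
    have h5 : Z ^ 2 ≤ a ^ 2 := le_of_mul_le_mul_left h4 hk
    have h6 := abs_le_of_sq_le_sq' h5 (by linarith)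
    have hIconv : Convex ℝ I := by
      have : I = (LinearMap.inr ℝ E ℝ) ⁻¹' K := rfl
      rw [this]; exact hc.linear_preimage _
    exact hIconv.ordConnected.out hbI haI ⟨by linarith [h6.1], h6.2⟩

theorem cyl_noncut (hE : 2 ≤ finrank ℝ E) {K : Set (E × ℝ)} (hc : Convex ℝ K) (hK : IsCompact K)
    (h1 : ((0:E), (1:ℝ)) ∈ interior K) 
    (htr : ∀ η : E →ₗ[ℝ] ℝ, ∃ c, ∀ w, (w, η w - 1) ∈ K ↔ (w + c, η (w + c) + 1) ∈ K)
    (hs : ∀ w : E, (w, (1:ℝ)) ∈ K ↔ (w, (-1:ℝ)) ∈ K)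
    (hcyl : ∀ w Z, -1 ≤ Z → Z ≤ 1 → (w, Z) ∈ K → (w, (1:ℝ)) ∈ K) : False := by
  obtain ⟨M, hT⟩ := good_compact hc hK h1
  set S : Set E := {w | (w, (1:ℝ)) ∈ K} with hS
  have hcyl' : ∀ w : E, ∀ Z : ℝ, -1 ≤ Z → Z ≤ 1 → ((w, Z) ∈ K ↔ w ∈ S) := by
    intro w Z hZ1 hZ2
    refine ⟨hcyl w Z hZ1 hZ2, fun h => ?_⟩
    have := hc (show (w, (1:ℝ)) ∈ K from h) ((hs w).1 h) (a := (1 + Z) / 2) (b := (1 - Z) / 2) (by linarith) (by linarith) (by ring)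
    convert this using 1
    ext
    · simp only [Prod.fst_add, Prod.smul_fst]; rw [← add_smul]
      rw [show (1 + Z) / 2 + (1 - Z) / 2 = 1 by ring, one_smul]
    · simp; ring
  have hScl : IsClosed S := hK.isClosed.preimage (by fun_prop : Continuous fun w : E => (w, (1:ℝ)))
  have hScpt : IsCompact S := by
    have : S ⊆ Prod.fst '' K := fun Z hZ => ⟨_, hZ, rfl⟩
    exact (hK.image continuous_fst).of_isClosed_subset hScl this
  obtain ⟨x, hx⟩ := hScpt.extremePoints_nonempty ⟨0, (interior_subset h1 : ((0:E), (1:ℝ)) ∈ K)⟩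
  obtain ⟨n, hn, hxn⟩ := exists_perp hE x
  rw [real_inner_comm] at hxn
  have hTr : ∀ m : ℝ, ∃ t : E × ℝ, Tr K n m t := by
    intro m
    obtain ⟨c, hcc⟩ := htr (m • (innerₛₗ ℝ n : E →ₗ[ℝ] ℝ))
    exact ⟨_, tr_of_htr hcc⟩
  choose t ht using fun j : ℕ => hTr (j + 1)
  have h0 := VT hT hn abs_tend ht
  have h3 : Tendsto (fun j => (t j).2) atTop (𝓝 0) := by
    have := (continuous_snd.tendsto (0 : E × ℝ)).comp h0
    exact this
  obtain ⟨j, hj⟩ := (h3.eventually (gt_mem_nhds (show (0:ℝ) < 2 by norm_num))).exists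
  have hpos := delta_pos hc (S := S) (fun w => Iff.rfl) (fun w => (hs w).symm) hx (ht j) hxn
  exact cyl_contra hcyl' hx (ht j) hxn hpos hj

theorem TN2 (hE : 2 ≤ finrank ℝ E) {K : Set (E × ℝ)} (hc : Convex ℝ K) (hK : IsCompact K)
    (h1 : ((0:E), (1:ℝ)) ∈ interior K) (h2 : ((0:E), (-1:ℝ)) ∈ interior K)
    (htr : ∀ η : E →ₗ[ℝ] ℝ, ∃ c, ∀ w, (w, η w - 1) ∈ K ↔ (w + c, η (w + c) + 1) ∈ K)
    (hs : ∀ w : E, (w, (1:ℝ)) ∈ K ↔ (w, (-1:ℝ)) ∈ K) :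
    ∃ (L : E ≃ₗ[ℝ] E) (κ : ℝ), 0 < κ ∧ ∀ w Z, (w, Z) ∈ K ↔ ‖L w‖ ^ 2 + κ * Z ^ 2 ≤ 1 + κ := by
  have key : ∃ L : E ≃ₗ[ℝ] E, ∀ x, (x, (-1:ℝ)) ∈ K ↔ ‖L x‖ ≤ 1 := by
    let τ : ℝ → (E × ℝ) ≃ₜ (E × ℝ) := fun s => Homeomorph.addRight ((0:E), s)
    have hτ : ∀ s x t, τ s (x, t) = (x, t + s) := by intro s x t; simp [τ]
    have cv : ∀ s, Convex ℝ (τ s ⁻¹' K) := fun s => hc.translate_preimage_left _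
    have cl : ∀ s, IsClosed (τ s ⁻¹' K) := fun s => hK.isClosed.preimage (τ s).continuous
    have ci : ∀ s, ((0:E), s) ∈ interior K → τ s ⁻¹' K ∈ 𝓝 (0 : E × ℝ) := by
      intro s hs
      refine (τ s).continuous.continuousAt.preimage_mem_nhds ?_
      have : τ s 0 = ((0:E), s) := by simp [τ]
      rw [this]; exact mem_interior_iff_mem_nhds.1 hs
    obtain ⟨R, hR⟩ := hK.isBounded.exists_norm_le
    obtain ⟨L, hL⟩ := ELL (A := τ (-1) ⁻¹' K) (B := τ 1 ⁻¹' K) hE (cv _) (cl _) (ci _ h2) (cv _) (cl _) (ci _ h1)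
      (by intro x; simp only [mem_preimage, hτ, zero_add]; exact (hs x).symm) (R := R)
      (by intro x hx; simp only [mem_preimage, hτ, zero_add] at hx
          exact (norm_fst_le _).trans (hR _ hx)) (T := 2) (by norm_num)
      (by intro x; simp only [mem_preimage, hτ, zero_add]; norm_num; exact (hs x).2)
      (by intro x; simp only [mem_preimage, hτ, zero_add]; norm_num; exact (hs x).1)
      (by intro η
          refine ⟨1, one_pos, fun ε _ _ => ?_⟩
          obtain ⟨c, hcc⟩ := htr (ε • η)
          refine ⟨c, fun w => ?_⟩
          have := hcc w
          simpa only [mem_preimage, hτ, LinearMap.smul_apply, smul_eq_mul, sub_eq_add_neg] using this)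
      (by rintro η hη ⟨ha, hb⟩
          simp only [mem_preimage, hτ, zero_add] at ha hb
          have hp : ∀ w Z, 0 < η w → -1 ≤ Z → (w, Z) ∈ K → (w, (1:ℝ)) ∈ K := by
            intro w Z h hZ hK
            refine (hs w).2 (ha w (Z + 1) (by linarith) h ?_)
            convert hK using 2; ring
          have hcl : ∀ w Z, -1 ≤ Z → Z ≤ 1 → (w, Z) ∈ K → (w, (1:ℝ)) ∈ K := by
            intro w Z hZ1 hZ2 hw
            rcases lt_trichotomy (η w) 0 with h | h | h
            · refine hb w (1 - Z) (by linarith) h ?_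
              convert hw using 2; ring
            · obtain ⟨v, hv⟩ : ∃ v, η v ≠ 0 := by
                by_contra hcon; push Not at hcon
                exact hη (LinearMap.ext hcon)
              obtain ⟨v, hv⟩ : ∃ v, 0 < η v := by
                rcases hv.lt_or_gt with h | h
                · exact ⟨-v, by simpa using h⟩
                · exact ⟨v, h⟩
              have ht : Tendsto (fun s : ℝ => (s • v, (1:ℝ))) (𝓝[>] 0) (𝓝 ((0:E), (1:ℝ))) := by
                have : Continuous (fun s : ℝ => (s • v, (1:ℝ))) := by fun_prop
                have := this.tendsto 0
                rw [zero_smul] at this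
                exact this.mono_left nhdsWithin_le_nhds
              obtain ⟨s, hs1, hs2⟩ := ((ht.eventually (mem_interior_iff_mem_nhds.1 h1)).and self_mem_nhdsWithin).exists
              have hs2 : 0 < s := hs2
              have hcont : Tendsto (fun θ : ℝ => ((1 - θ) • w + θ • (s • v), (1:ℝ))) (𝓝[>] 0) (𝓝 (w, (1:ℝ))) := by
                have : Continuous (fun θ : ℝ => ((1 - θ) • w + θ • (s • v), (1:ℝ))) := by fun_prop
                have := this.tendsto 0
                simp only [sub_zero, one_smul, zero_smul, add_zero] at this
                exact this.mono_left nhdsWithin_le_nhds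
              refine hK.isClosed.mem_of_tendsto hcont ?_
              have h01 : ∀ᶠ θ : ℝ in 𝓝[>] 0, θ < 1 := nhdsWithin_le_nhds (gt_mem_nhds one_pos)
              filter_upwards [self_mem_nhdsWithin, h01] with θ h0 h3
              have h0 : 0 < θ := h0
              refine hp _ ((1 - θ) * Z + θ) ?_ (by nlinarith) ?_
              · simp only [map_add, map_smul, h, smul_eq_mul]; positivity
              · have := hc hw hs1 (a := 1 - θ) (b := θ) (by linarith) h0.le (by ring)
                convert this using 1
                ext <;> simp
            · exact hp w Z h hZ1 hw
          exact cyl_noncut hE hc hK h1 htr hs hcl)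
    refine ⟨L, fun x => ?_⟩
    have := hL x
    simpa only [mem_preimage, hτ, zero_add] using this
  obtain ⟨L, hL⟩ := key
  have hL' : ∀ x, (x, (1:ℝ)) ∈ K ↔ ‖L x‖ ≤ 1 := fun x => (hs x).trans (hL x)
  set g := gH L.symm (0 : E →ₗ[ℝ] ℝ) with hg
  have hga : ∀ w Z, g (w, Z) = (L.symm w, Z) := by intro w Z; rw [hg, gH_apply]; simp
  obtain ⟨κ, hκ, hk⟩ := TN3 hE (K := g ⁻¹' K) (gH_convex _ _ hc) (gH_compact _ _ hK)
    (gH_interior _ _ (by rw [← hg, hga]; simpa using h1)) (gH_interior _ _ (by rw [← hg, hga]; simpa using h2))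
    (by intro η
        obtain ⟨c, hcc⟩ := htr ((η + 0) ∘ₗ L.symm.symm.toLinearMap)
        exact ⟨_, gH_tr L.symm 0 hcc⟩)
    (by intro w; rw [mem_preimage, hga, hL']; simp) (by intro w; rw [mem_preimage, hga, hL]; simp)
  refine ⟨L, κ, hκ, fun w Z => ?_⟩
  have := hk (L w) Z
  rw [mem_preimage, hga] at this
  simpa using this

theorem TN (hE : 2 ≤ finrank ℝ E) {K : Set (E × ℝ)} (hc : Convex ℝ K) (hK : IsCompact K)
    (h1 : ((0:E), (1:ℝ)) ∈ interior K) (h2 : ((0:E), (-1:ℝ)) ∈ interior K)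
    (htr : ∀ η : E →ₗ[ℝ] ℝ, ∃ c, ∀ w, (w, η w - 1) ∈ K ↔ (w + c, η (w + c) + 1) ∈ K) :
    ∃ (L : E ≃ₗ[ℝ] E) (η0 : E →ₗ[ℝ] ℝ) (κ : ℝ), 0 < κ ∧
      ∀ w Z, (w, Z) ∈ K ↔ ‖L w‖ ^ 2 + κ * (Z - η0 w) ^ 2 ≤ 1 + κ := by
  obtain ⟨η0, h0⟩ := step_noncut hc hK h1 h2
  obtain ⟨c, hcc⟩ := htr η0
  have hc0 : -c = 0 := by
    refine h0 (-c) fun w => ?_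
    have := hcc (w + -c)
    rw [neg_add_cancel_right] at this
    exact this.symm
  have hc0 : c = 0 := neg_eq_zero.1 hc0
  subst hc0
  set g := gH (LinearEquiv.refl ℝ E) η0 with hg
  have hga : ∀ w Z, g (w, Z) = (w, Z + η0 w) := by intro w Z; rw [hg, gH_apply]; simp
  obtain ⟨L, κ, hκ, hk⟩ := TN2 hE (K := g ⁻¹' K) (gH_convex _ _ hc) (gH_compact _ _ hK)
    (gH_interior _ _ (by rw [← hg, hga]; simpa using h1)) (gH_interior _ _ (by rw [← hg, hga]; simpa using h2))
    (by intro η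
        obtain ⟨c, hcc⟩ := htr ((η + η0) ∘ₗ (LinearEquiv.refl ℝ E).symm.toLinearMap)
        exact ⟨_, gH_tr _ _ hcc⟩)
    (by intro w; rw [mem_preimage, hga, mem_preimage, hga]
        have := (hcc w).symm
        rw [add_zero] at this
        convert this using 3 <;> ring)
  refine ⟨L, η0, κ, hκ, fun w Z => ?_⟩
  have := hk w (Z - η0 w)
  rw [mem_preimage, hga] at this
  simpa using this

end
end

section
open Set Module Filter Topology
open scoped RealInnerProductSpace
set_option linter.unusedSectionVars false

section
variable {E : Type*} [NormedAddCommGroup E] [InnerProductSpace ℝ E] [FiniteDimensional ℝ E]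

structure Cut (A B R : Set (E × ℝ)) : Prop where
  Ac : Convex ℝ A
  Acl : IsClosed A
  Bc : Convex ℝ B
  Bcl : IsClosed B
  Rcl : IsClosed R
  Rs : ∀ r ∈ R, ∀ t : ℝ, 0 ≤ t → t • r ∈ R
  Rp : ∀ r ∈ R, r ≠ 0 → 0 < r.2
  R1 : ((0:E), (1:ℝ)) ∈ interior R
  BR : ∀ b ∈ B, ∀ r ∈ R, b + r ∈ B
  AR : ∀ a ∈ A, ∀ r ∈ R, a - r ∈ A
  AB : ∀ a ∈ A, ∀ b ∈ B, b - a ∈ R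
  disj : ∀ x ∈ A, x ∉ B
  b1 : ((0:E), (1:ℝ)) ∈ interior B
  a1 : ((0:E), (-1:ℝ)) ∈ interior A
  tr : ∀ η : E →ₗ[ℝ] ℝ, ∃ c : E,
    ((∀ w, (w, η w - 1) ∈ A ↔ (w + c, η (w + c) + 1) ∈ A) ∧ (∀ w, (w, η w - 1) ∈ B ↔ (w + c, η (w + c) + 1) ∈ B)) ∨
    ((∀ w, (w, η w - 1) ∈ A ↔ (w + c, η (w + c) + 1) ∈ B) ∧ (∀ w, (w, η w - 1) ∈ B ↔ (w + c, η (w + c) + 1) ∈ A))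

theorem Cut.transport {A B R : Set (E × ℝ)} (h : Cut A B R) (L : E ≃ₗ[ℝ] E) (η0 : E →ₗ[ℝ] ℝ)
    (hη : ∀ r ∈ R, r ≠ 0 → η0 (L.symm r.1) < r.2) :
    Cut (gH L η0 ⁻¹' A) (gH L η0 ⁻¹' B) (gH L η0 ⁻¹' R) where
  Ac := gH_convex _ _ h.Ac
  Acl := gH_closed _ _ h.Acl
  Bc := gH_convex _ _ h.Bc
  Bcl := gH_closed _ _ h.Bcl
  Rcl := gH_closed _ _ h.Rcl
  Rs r hr t ht := by
    rw [mem_preimage, gH_coe, map_smul]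
    exact h.Rs _ hr t ht
  Rp r hr h0 := by
    have h1 : gE L η0 r ≠ 0 := by simpa using h0
    have := hη _ hr h1
    rw [show gH L η0 r = (L r.1, r.2 + η0 r.1) from rfl] at this
    simp at this
    exact this
  R1 := gH_interior _ _ (by rw [gH_apply]; simpa using h.R1)
  BR b hb r hr := by
    rw [mem_preimage, gH_coe, map_add]
    exact h.BR _ hb _ hr
  AR b hb r hr := by
    rw [mem_preimage, gH_coe, map_sub]
    exact h.AR _ hb _ hr
  AB b hb r hr := by
    rw [mem_preimage, gH_coe, map_sub]
    exact h.AB _ hb _ hr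
  disj x hx hx' := h.disj _ hx hx'
  b1 := gH_interior _ _ (by rw [gH_apply]; simpa using h.b1)
  a1 := gH_interior _ _ (by rw [gH_apply]; simpa using h.a1)
  tr η := by
    obtain ⟨c, hc⟩ := h.tr ((η + η0) ∘ₗ L.symm.toLinearMap)
    refine ⟨L.symm c, ?_⟩
    rcases hc with ⟨h1, h2⟩ | ⟨h1, h2⟩
    · exact Or.inl ⟨gH_tr _ _ h1, gH_tr _ _ h2⟩
    · exact Or.inr ⟨gH_tr _ _ h1, gH_tr _ _ h2⟩

theorem Cut.alt2 {A B R : Set (E × ℝ)} (h : Cut A B R) {η : E →ₗ[ℝ] ℝ} (hη : ∀ r ∈ R, r ≠ 0 → η r.1 < r.2) :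
    ∃ c : E, (∀ w, (w, η w - 1) ∈ A ↔ (w + c, η (w + c) + 1) ∈ B) := by
  obtain ⟨c, ⟨h1, h2⟩ | ⟨h1, h2⟩⟩ := h.tr η
  · exfalso
    have e1 := (h1 0).1 (by simpa using interior_subset h.a1)
    have e2 := h.AB _ e1 _ (interior_subset h.b1)
    have e3 : c = 0 := by
      by_contra hcon
      have := hη _ e2 (by intro h; apply hcon; simpa using congrArg Prod.fst h)
      simp at this
    subst e3
    refine h.disj _ e1 ?_
    simpa using interior_subset h.b1
  · exact ⟨c, h1⟩

theorem Cut.rho {A B R : Set (E × ℝ)} (h : Cut A B R) : ∃ ρ > 0, ∀ r ∈ R, ρ * ‖r‖ ≤ r.2 :=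
  cone_bound h.Rcl h.Rs (u := fun r => r.2) (by fun_prop) (by intro t r; simp) h.Rp

theorem nhd_R {R : Set (E × ℝ)} (h : ((0:E), (1:ℝ)) ∈ interior R) (v : E) : ∃ s : ℝ, 0 < s ∧ ∀ s', |s'| ≤ s → (s' • v, (1:ℝ)) ∈ R := by
  have ht : Tendsto (fun s : ℝ => (s • v, (1:ℝ))) (𝓝 0) (𝓝 ((0:E), (1:ℝ))) := by
    have : Continuous (fun s : ℝ => (s • v, (1:ℝ))) := by fun_prop
    have := this.tendsto 0
    rwa [zero_smul] at this
  obtain ⟨ε, hε, hb⟩ := Metric.eventually_nhds_iff.1 (ht.eventually (mem_interior_iff_mem_nhds.1 h))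
  refine ⟨ε / 2, by linarith, fun s' hs' => hb ?_⟩
  rw [Real.dist_eq, sub_zero]; linarith

theorem perp_half (hE : 2 ≤ finrank ℝ E) {T R : Set (E × ℝ)} {M : ℝ} (hT : Good T M)
    (hRs : ∀ r ∈ R, ∀ t : ℝ, 0 ≤ t → t • r ∈ R) (hR1 : ((0:E), (1:ℝ)) ∈ interior R)
    (hTR : ∀ b ∈ T, ∀ r ∈ R, b + r ∈ T)
    (hb : ∀ w : E, (w, (1:ℝ)) ∈ T ↔ ‖w‖ ≤ 1)
    (htr : ∀ n : E, ‖n‖ = 1 → ∃ m : ℕ → ℝ, ∃ t : ℕ → E × ℝ, Tendsto (fun j => |m j|) atTop atTop ∧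
      ∀ j, Tr T n (m j) (t j)) : Perp T := by
  refine S3_cut hE hT hb one_ne_zero ?_ ?_ htr
  · intro w hw l hl _
    have h1 : (w, (1:ℝ)) ∈ interior T := by
      by_cases h : w = 0
      · rw [h]; exact hT.o_int
      have hp : 0 < ‖w‖ := norm_pos_iff.2 h
      have h3 : (‖w‖⁻¹ • w, (1:ℝ)) ∈ T := (hb _).2 (by simp [norm_smul, hp.ne'])
      have := hT.conv.combo_interior_self_mem_interior hT.o_int h3 (a := 1 - ‖w‖) (b := ‖w‖) (by linarith) hp.le (by ring)
      convert this using 1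
      ext
      · simp [smul_smul, hp.ne']
      · simp
    let τ : (E × ℝ) ≃ₜ (E × ℝ) := Homeomorph.addRight ((0:E), l)
    have hsub : τ '' interior T ⊆ interior T := by
      refine interior_maximal ?_ (τ.isOpenMap _ isOpen_interior)
      rintro _ ⟨p, hp, rfl⟩
      have := hTR p (interior_subset hp) (l • ((0:E), (1:ℝ))) (hRs _ (interior_subset hR1) l hl)
      simpa [τ] using this
    have := hsub ⟨_, h1, rfl⟩
    simpa [τ] using this
  · intro z hz
    obtain ⟨s, hs, hs'⟩ := nhd_R hR1 z
    have h1 := hs' s (abs_of_pos hs).le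
    have h2 := hTR _ (interior_subset hT.o_int) _ (hRs _ h1 (2 / s) (by positivity))
    refine ⟨_, h2, ?_⟩
    simp [smul_smul, hs.ne', inner_smul_right, hz]

theorem TC3 (hE : 2 ≤ finrank ℝ E) {A B R : Set (E × ℝ)} (h : Cut A B R)
    (hb1 : ∀ w : E, (w, (1:ℝ)) ∈ B ↔ ‖w‖ ≤ 1) (hb2 : ∀ w : E, (w, (-1:ℝ)) ∈ A ↔ ‖w‖ ≤ 1) :
    ∃ κ : ℝ, κ < 0 ∧ 1 + κ < 0 ∧ ∀ w Z, ((w, Z) ∈ A ∨ (w, Z) ∈ B) ↔ ‖w‖ ^ 2 + κ * Z ^ 2 ≤ 1 + κ := by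
  borelize E
  obtain ⟨ρ, hρ, hr⟩ := h.rho
  have hBb : ∀ p ∈ B, ρ * ‖p.1‖ ≤ p.2 + 1 := by
    intro p hp
    have h1 := hr _ (h.AB _ (interior_subset h.a1) p hp)
    have h2 := norm_fst_le (p - ((0:E), (-1:ℝ)))
    simp only [Prod.fst_sub, Prod.snd_sub, sub_zero] at h1 h2
    nlinarith
  have hAb : ∀ p ∈ A, ρ * ‖p.1‖ ≤ 1 - p.2 := by
    intro p hp
    have h1 := hr _ (h.AB _ hp _ (interior_subset h.b1))
    have h2 := norm_fst_le (((0:E), (1:ℝ)) - p)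
    simp only [Prod.fst_sub, Prod.snd_sub, zero_sub, norm_neg] at h1 h2
    nlinarith
  have hM : ∀ x y : ℝ, 0 ≤ x → ρ * x ≤ y + 1 → x ≤ (1 / ρ + 1) * (y + (1 / ρ + 1)) := by
    intro x y hx hxy
    have h0 : 0 < 1 / ρ := by positivity
    have h1 : 0 ≤ ρ * x := by positivity
    have h2 : x = (1 / ρ) * (ρ * x) := by field_simp
    have h3 : (1 / ρ) * (ρ * x) ≤ (1 / ρ) * (y + 1) := by gcongr
    nlinarith
  have hGB : Good B (1 / ρ + 1) := ⟨h.Bcl, h.Bc, h.b1, by positivity, fun p hp => hM _ _ (norm_nonneg _) (hBb p hp)⟩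
  set A' : Set (E × ℝ) := flipE ⁻¹' A with hA'
  have hfl : ∀ w Z, (w, Z) ∈ A' ↔ (w, -Z) ∈ A := fun w Z => Iff.rfl
  have hGA : Good A' (1 / ρ + 1) := by
    refine ⟨h.Acl.preimage flip_cont, flip_convex h.Ac, flip_interior h.a1, by positivity, fun p hp => hM _ _ (norm_nonneg _) ?_⟩
    have := hAb _ hp
    simpa [flipE, add_comm] using this
  have hb3 : ∀ w : E, (w, (1:ℝ)) ∈ A' ↔ ‖w‖ ≤ 1 := fun w => (hfl w 1).trans (hb2 w)
  have htr : ∀ n : E, ‖n‖ = 1 → ∃ m : ℕ → ℝ, ∃ c : ℕ → E, Tendsto (fun j => |m j|) atTop atTop ∧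
      ∀ j, Tr B n (m j) (c j, 2 + m j * ⟪n, c j⟫) ∧ Tr A' n (-(m j)) (-c j, 2 + m j * ⟪n, c j⟫) := by
    intro n hn
    obtain ⟨s, hs, hs'⟩ := nhd_R h.R1 n
    have : ∀ m : ℝ, 1 / s ≤ m → ∃ c : E, Tr B n m (c, 2 + m * ⟪n, c⟫) ∧ Tr A' n (-m) (-c, 2 + m * ⟪n, c⟫) := by
      intro m hm
      have hm0 : 0 < m := lt_of_lt_of_le (by positivity) hm
      have hrm : (m⁻¹ • n, (1:ℝ)) ∈ R := by
        apply hs'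
        rw [abs_of_pos (by positivity)]
        exact (inv_le_comm₀ hm0 hs).2 (by rwa [one_div] at hm)
      obtain ⟨c, ⟨h1, h2⟩ | ⟨h1, -⟩⟩ := h.tr (m • (innerₛₗ ℝ n : E →ₗ[ℝ] ℝ))
      · refine ⟨c, tr_of_htr h2, ?_, fun p hp => ?_⟩
        · simp
        have := h1 (p.1 - c)
        rw [sub_add_cancel] at this
        obtain ⟨p1, p2⟩ := p
        simp only at hp this
        rw [Prod.mk_add_mk, hfl, hfl]
        simp only [LinearMap.smul_apply, innerₛₗ_apply_apply, smul_eq_mul, inner_sub_right] at this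
        subst hp
        have := this.symm
        convert this using 2
        · ext <;> simp; ring
        · ext <;> simp [sub_eq_add_neg]; ring
      · exfalso
        have hk : ∀ k : ℕ, (k:ℝ) ≤ m * ⟪n, c⟫ + 2 := by
          intro k
          have e1 := h.AR _ (interior_subset h.a1) _ (h.Rs _ hrm k (Nat.cast_nonneg k))
          have e2 : ((0:E), (-1:ℝ)) - (k:ℝ) • (m⁻¹ • n, (1:ℝ)) = (-((k:ℝ) • m⁻¹ • n),
              (m • (innerₛₗ ℝ n : E →ₗ[ℝ] ℝ)) (-((k:ℝ) • m⁻¹ • n)) - 1) := by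
            ext
            · simp
            · simp [inner_smul_right, hn]; field_simp; ring
          rw [e2] at e1
          have e3 := hBb _ ((h1 _).1 e1)
          have e4 : 0 ≤ ρ * ‖-((k:ℝ) • m⁻¹ • n) + c‖ := by positivity
          have e5 := e4.trans e3
          simp [inner_smul_right, hn, inner_add_right] at e5
          have e6 : m * (-(k * m⁻¹)  + ⟪n, c⟫) = -k + m * ⟪n, c⟫ := by field_simp
          rw [e6] at e5
          linarith
        obtain ⟨k, hk'⟩ := exists_nat_gt (m * ⟪n, c⟫ + 2)
        linarith [hk k]
    choose! c hc using this
    refine ⟨fun j => 1 / s + j, fun j => c (1 / s + j), ?_, fun j => hc _ (by simp)⟩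
    exact tendsto_abs_atTop_atTop.comp (tendsto_atTop_add_const_left _ _ tendsto_natCast_atTop_atTop)
  have hPB : Perp B := perp_half hE hGB h.Rs h.R1 h.BR hb1 (by
    intro n hn
    obtain ⟨m, c, hm, hc⟩ := htr n hn
    exact ⟨m, _, hm, fun j => (hc j).1⟩)
  have hPA : Perp A' := by
    refine perp_half (R := {r | (-r.1, r.2) ∈ R}) hE hGA ?_ ?_ ?_ hb3 (by
      intro n hn
      obtain ⟨m, c, hm, hc⟩ := htr n hn
      exact ⟨fun j => -(m j), _, by simpa using hm, fun j => (hc j).2⟩)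
    · intro r hr t ht
      have := h.Rs _ hr t ht
      simpa using this
    · have hcont : Continuous (fun r : E × ℝ => (-r.1, r.2)) := by fun_prop
      refine preimage_interior_subset_interior_preimage hcont ?_
      simpa using h.R1
    · intro b hb r hr
      have := h.AR _ hb _ hr
      have e : flipE (b + r) = flipE b - (-r.1, r.2) := by ext <;> simp [flipE]; ring
      change flipE (b + r) ∈ A
      rw [e]; exact this
  have hRB := S4 hE hGB hPB
  have hRA := S4 hE hGA hPA
  obtain ⟨n, hn, -⟩ := exists_perp hE 0
  obtain ⟨m, c, hm, hc⟩ := htr n hn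
  obtain ⟨κ, hl1, hκ, hfr⟩ := S5 hE hGB hRB hb1 hn hm (fun j => (hc j).1)
  obtain ⟨κ', hl2, hκ', hfr'⟩ := S5 hE hGA hRA hb3 hn (m := fun j => -(m j)) (by simpa using hm) (fun j => (hc j).2)
  have hkk : κ' = κ := by
    refine tendsto_nhds_unique hl2 ?_
    simpa using hl1
  subst hkk
  have half : ∀ T : Set (E × ℝ), IsClosed T → ((0:E), (1:ℝ)) ∈ interior T → (∀ Z, ((0:E), Z) ∈ T → -1 ≤ Z) →
      (∀ Z l, ((0:E), Z) ∈ T → 0 ≤ l → ((0:E), Z + l) ∈ T) →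
      ∃ b ∈ frontier {Z : ℝ | ((0:E), Z) ∈ T}, b < 1 ∧ ∀ Z, ((0:E), Z) ∈ T ↔ b ≤ Z := by
    intro T hcl h1 hbd hup
    set I : Set ℝ := {Z : ℝ | ((0:E), Z) ∈ T} with hI
    have hIemb : Continuous (fun Z : ℝ => ((0:E), Z)) := by fun_prop
    have hIc : IsClosed I := hcl.preimage hIemb
    have hi1 : (1:ℝ) ∈ interior I := preimage_interior_subset_interior_preimage hIemb h1
    have hne : I.Nonempty := ⟨1, interior_subset hi1⟩
    have hbb : BddBelow I := ⟨-1, hbd⟩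
    have hbI := hIc.csInf_mem hne hbb
    set b := sInf I with hb
    have hge : ∀ x ∈ I, b ≤ x := fun x hx => csInf_le hbb hx
    have nint : ∀ x ∈ interior I, b < x := by
      intro x hx
      obtain ⟨ε, hε, hball⟩ := Metric.mem_nhds_iff.1 (mem_interior_iff_mem_nhds.1 hx)
      have e2 := hge _ (hball (show x - ε / 2 ∈ Metric.ball x ε by simp [Real.dist_eq, abs_of_pos hε]; linarith))
      linarith
    refine ⟨b, ⟨subset_closure hbI, fun h => lt_irrefl _ (nint _ h)⟩, nint _ hi1, fun Z => ⟨hge Z, fun hZ => ?_⟩⟩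
    have := hup b (Z - b) hbI (by linarith)
    simpa using this
  obtain ⟨b, hbf, hb, hbI⟩ := half B h.Bcl h.b1
    (fun Z hZ => by have := hBb _ hZ; simp at this; linarith)
    (fun Z l hZ hl => by
      have := h.BR _ hZ _ (h.Rs _ (interior_subset h.R1) l hl)
      simpa using this)
  obtain ⟨b', hbf', hb', hbI'⟩ := half A' hGA.cl hGA.o_int
    (fun Z hZ => by have := hAb _ ((hfl _ _).1 hZ); simp at this; linarith)
    (fun Z l hZ hl => by
      have := h.AR _ ((hfl _ _).1 hZ) _ (h.Rs _ (interior_subset h.R1) l hl)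
      rw [hfl]
      convert this using 1
      ext <;> simp; ring)
  have e1 := hfr b hbf
  have e2 := hfr' b' hbf'
  have hpos : 0 < b + b' := by
    by_contra hcon
    push Not at hcon
    refine h.disj ((0:E), -b') ((hfl _ _).1 ((hbI' b').2 le_rfl)) ((hbI _).2 (by linarith))
  have hk0 : κ' ≠ 0 := by rintro rfl; simp at e1
  have hbb : b' = b := by
    have : κ' * ((b' - b) * (b' + b)) = 0 := by linarith
    rcases mul_eq_zero.1 this with h | h
    · exact absurd h hk0
    · rcases mul_eq_zero.1 h with h | h <;> linarith
  subst hbb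
  have hb0 : 0 < b' := by linarith
  have hb2' : b' ^ 2 < 1 := by nlinarith
  have hkneg : κ' < 0 := by
    by_contra hcon
    push Not at hcon
    nlinarith
  refine ⟨κ', hkneg, ?_, fun w Z => ?_⟩
  · rw [← e1]; nlinarith [sq_pos_of_pos hb0]
  have hAx : (w, Z) ∈ A ↔ ((0:E), -Z) ∈ A' ∧ ‖w‖ ^ 2 ≤ 1 + κ' - κ' * Z ^ 2 := by
    have := hκ' w (-Z)
    rw [hfl, neg_neg, neg_sq] at this
    exact this
  rw [hAx, hκ w Z, hbI, hbI']
  constructor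
  · rintro (⟨-, h⟩ | ⟨-, h⟩) <;> linarith
  · intro hq
    have h4 : κ' * Z ^ 2 ≤ κ' * b' ^ 2 := by nlinarith [sq_nonneg ‖w‖]
    have h5 : b' ^ 2 ≤ Z ^ 2 := (mul_le_mul_left_of_neg hkneg).1 h4
    have h6 := (sq_le_sq.1 h5)
    rw [abs_of_pos hb0] at h6
    rcases le_abs.1 h6 with h | h
    · exact Or.inr ⟨h, by linarith⟩
    · exact Or.inl ⟨h, by linarith⟩

theorem TC2 (hE : 2 ≤ finrank ℝ E) {A B R : Set (E × ℝ)} (h : Cut A B R)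
    (hs : ∀ w : E, (w, (1:ℝ)) ∈ B ↔ (w, (-1:ℝ)) ∈ A) :
    ∃ (L : E ≃ₗ[ℝ] E) (κ : ℝ), κ < 0 ∧ 1 + κ < 0 ∧
      ∀ w Z, ((w, Z) ∈ A ∨ (w, Z) ∈ B) ↔ ‖L w‖ ^ 2 + κ * Z ^ 2 ≤ 1 + κ := by
  obtain ⟨ρ, hρ, hr⟩ := h.rho
  have key : ∃ L : E ≃ₗ[ℝ] E, ∀ x, (x, (1:ℝ)) ∈ B ↔ ‖L x‖ ≤ 1 := by
    let τ : ℝ → (E × ℝ) ≃ₜ (E × ℝ) := fun s => Homeomorph.addRight ((0:E), s)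
    have hτ : ∀ s x t, τ s (x, t) = (x, t + s) := by intro s x t; simp [τ]
    have cv : ∀ s {K : Set (E × ℝ)}, Convex ℝ K → Convex ℝ (τ s ⁻¹' K) := fun s K hc => hc.translate_preimage_left _
    have cl : ∀ s {K : Set (E × ℝ)}, IsClosed K → IsClosed (τ s ⁻¹' K) := fun s K hK => hK.preimage (τ s).continuous
    have ci : ∀ s {K : Set (E × ℝ)}, ((0:E), s) ∈ interior K → τ s ⁻¹' K ∈ 𝓝 (0 : E × ℝ) := by
      intro s K hs
      refine (τ s).continuous.continuousAt.preimage_mem_nhds ?_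
      have : τ s 0 = ((0:E), s) := by simp [τ]
      rw [this]; exact mem_interior_iff_mem_nhds.1 hs
    have hbd : ∀ x, (x, (1:ℝ)) ∈ B → ‖x‖ ≤ 2 / ρ := by
      intro x hx
      have h1 := hr _ (h.AB _ (interior_subset h.a1) _ hx)
      have h2 := norm_fst_le ((x, (1:ℝ)) - ((0:E), (-1:ℝ)))
      simp only [Prod.fst_sub, Prod.snd_sub, sub_zero] at h1 h2
      rw [le_div_iff₀ hρ]
      nlinarith
    obtain ⟨L, hL⟩ := ELL (A := τ 1 ⁻¹' B) (B := τ (-1) ⁻¹' A) hE (cv _ h.Bc) (cl _ h.Bcl) (ci _ h.b1)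
      (cv _ h.Ac) (cl _ h.Acl) (ci _ h.a1)
      (by intro x; simp only [mem_preimage, hτ, zero_add]; exact (hs x)) (R := 2 / ρ)
      (by intro x hx; simp only [mem_preimage, hτ, zero_add] at hx
          exact hbd x hx) (T := 1) (by norm_num)
      (by intro x; simp only [mem_preimage, hτ, zero_add]; intro hx
          have := h.BR _ hx _ (interior_subset h.R1)
          simpa using this)
      (by intro x; simp only [mem_preimage, hτ, zero_add]; intro hx
          have := h.AR _ hx _ (interior_subset h.R1)
          simpa [sub_eq_add_neg] using this)
      (by intro η
          set C := ‖LinearMap.toContinuousLinearMap η‖ with hC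
          have hC0 : 0 ≤ C := norm_nonneg _
          refine ⟨ρ / (C + 1), by positivity, fun ε he he' => ?_⟩
          rw [lt_div_iff₀ (by positivity)] at he'
          obtain ⟨c, hcc⟩ := h.alt2 (η := ε • η) (by
            intro r hR h0
            have f1 := (LinearMap.toContinuousLinearMap η).le_opNorm r.1
            have f2 : η r.1 ≤ C * ‖r.1‖ := (le_abs_self _).trans f1
            have f3 := norm_fst_le r
            have f4 := hr r hR
            have f5 : 0 < ‖r‖ := norm_pos_iff.2 h0
            have f6 : η r.1 ≤ C * ‖r‖ := f2.trans (by gcongr)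
            have f7 : ε * η r.1 ≤ ε * (C * ‖r‖) := by gcongr
            simp only [LinearMap.smul_apply, smul_eq_mul]
            nlinarith)
          refine ⟨-c, fun w => ?_⟩
          have := (hcc (w + -c)).symm
          rw [neg_add_cancel_right] at this
          simpa only [mem_preimage, hτ, LinearMap.smul_apply, smul_eq_mul, sub_eq_add_neg] using this)
      (by rintro η hη ⟨ha, -⟩
          simp only [mem_preimage, hτ, zero_add] at ha
          obtain ⟨v, hv⟩ : ∃ v, η v ≠ 0 := by
            by_contra hcon; push Not at hcon
            exact hη (LinearMap.ext hcon)
          obtain ⟨v, hv⟩ : ∃ v, 0 < η v := by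
            rcases hv.lt_or_gt with h | h
            · exact ⟨-v, by simpa using h⟩
            · exact ⟨v, h⟩
          have hv0 : v ≠ 0 := by rintro rfl; simp at hv
          have hvn := norm_pos_iff.2 hv0
          obtain ⟨s, hs, hs'⟩ := nhd_R h.R1 v
          have h1 := hs' s (abs_of_pos hs).le
          have h2 : ∀ l : ℝ, 0 < l → l * (s * ‖v‖) ≤ 2 / ρ := by
            intro l hl
            have h3 := h.BR _ (interior_subset h.b1) _ (h.Rs _ h1 l hl.le)
            have h4 : (l • s • v, (1:ℝ)) ∈ B := by
              refine ha _ l hl.le (by simp; positivity) ?_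
              convert h3 using 1
              ext <;> simp; ring
            have := hbd _ h4
            simpa [norm_smul, abs_of_pos hl, abs_of_pos hs] using this
          have h5 := h2 ((2 / ρ + 1) / (s * ‖v‖)) (by positivity)
          rw [div_mul_cancel₀ _ (by positivity)] at h5
          linarith)
    refine ⟨L, fun x => ?_⟩
    have := hL x
    simpa only [mem_preimage, hτ, zero_add] using this
  obtain ⟨L, hL⟩ := key
  have hL' : ∀ x, (x, (-1:ℝ)) ∈ A ↔ ‖L x‖ ≤ 1 := fun x => (hs x).symm.trans (hL x)
  have hcut := h.transport L.symm 0 (by intro r hr h0; simpa using h.Rp r hr h0)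
  set g := gH L.symm (0 : E →ₗ[ℝ] ℝ) with hg
  have hga : ∀ w Z, g (w, Z) = (L.symm w, Z) := by intro w Z; rw [hg, gH_apply]; simp
  obtain ⟨κ, hκ, hκ1, hk⟩ := TC3 hE hcut
    (by intro w; rw [mem_preimage, hga, hL]; simp) (by intro w; rw [mem_preimage, hga, hL']; simp)
  refine ⟨L, κ, hκ, hκ1, fun w Z => ?_⟩
  have := hk (L w) Z
  rw [mem_preimage, mem_preimage, hga] at this
  simpa using this

theorem TC (hE : 2 ≤ finrank ℝ E) {A B R : Set (E × ℝ)} (h : Cut A B R) :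
    ∃ (L : E ≃ₗ[ℝ] E) (η0 : E →ₗ[ℝ] ℝ) (κ : ℝ), κ < 0 ∧ 1 + κ < 0 ∧
      ∀ w Z, ((w, Z) ∈ A ∨ (w, Z) ∈ B) ↔ ‖L w‖ ^ 2 + κ * (Z - η0 w) ^ 2 ≤ 1 + κ := by
  obtain ⟨η0, hη, h0⟩ := step_cut h.Ac h.Acl h.Bc h.Bcl h.Rcl h.Rs h.Rp (interior_subset h.R1) h.BR h.AR h.AB h.b1 h.a1
  obtain ⟨c, hcc⟩ := h.alt2 hη
  have hc0 : c = 0 := h0 c hcc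
  subst hc0
  have hcut := h.transport (LinearEquiv.refl ℝ E) η0 (by simpa using hη)
  set g := gH (LinearEquiv.refl ℝ E) η0 with hg
  have hga : ∀ w Z, g (w, Z) = (w, Z + η0 w) := by intro w Z; rw [hg, gH_apply]; simp
  obtain ⟨L, κ, hκ, hκ1, hk⟩ := TC2 hE hcut
    (by intro w; rw [mem_preimage, hga, mem_preimage, hga]
        have := (hcc w).symm
        rw [add_zero] at this
        convert this using 3 <;> ring)
  refine ⟨L, η0, κ, hκ, hκ1, fun w Z => ?_⟩
  have := hk w (Z - η0 w)
  rw [mem_preimage, mem_preimage, hga] at this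
  simpa using this

end
end

section
open Set Module Filter Topology
open scoped RealInnerProductSpace
set_option linter.unusedSectionVars false

section
variable {V : Type*} [NormedAddCommGroup V] [NormedSpace ℝ V] [FiniteDimensional ℝ V]

structure PCone (C : Set V) : Prop where
  conv : Convex ℝ C
  smul : ∀ v ∈ C, ∀ t : ℝ, 0 < t → t • v ∈ C
  zero : (0:V) ∉ C
  cl : IsClosed (insert 0 C)

theorem PCone.add {C : Set V} (h : PCone C) {v w : V} (hv : v ∈ C) (hw : w ∈ C) : v + w ∈ C := by
  have := h.smul _ (h.conv hv hw (a := 1/2) (b := 1/2) (by norm_num) (by norm_num) (by norm_num)) 2 (by norm_num)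
  simpa [smul_smul] using this

theorem PCone.neg {C : Set V} (h : PCone C) {v : V} (hv : v ∈ C) : -v ∉ C := fun h' => by
  have := h.add hv h'
  rw [add_neg_cancel] at this
  exact h.zero this

theorem PCone.smul_iff {C : Set V} (h : PCone C) {v : V} {t : ℝ} (ht : 0 < t) : t • v ∈ C ↔ v ∈ C := by
  refine ⟨fun hv => ?_, fun hv => h.smul v hv t ht⟩
  have := h.smul _ hv t⁻¹ (by positivity)
  rwa [smul_smul, inv_mul_cancel₀ ht.ne', one_smul] at this

theorem PCone.bound {C : Set V} (h : PCone C) {u : V →ₗ[ℝ] ℝ} (hp : ∀ v ∈ C, 0 < u v) :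
    ∃ ρ > 0, ∀ v ∈ C, ρ * ‖v‖ ≤ u v := by
  have hu : Continuous u := u.continuous_of_finiteDimensional
  by_cases hne : (insert 0 C ∩ Metric.sphere 0 1).Nonempty
  · obtain ⟨r0, hr0, hmin⟩ := ((isCompact_sphere (0:V) 1).inter_left h.cl).exists_isMinOn hne hu.continuousOn
    have hr00 : r0 ≠ 0 := by
      rintro rfl
      simpa using hr0.2
    have hrC : r0 ∈ C := hr0.1.resolve_left hr00
    refine ⟨u r0, hp r0 hrC, fun r hr => ?_⟩
    have hr1 : r ≠ 0 := by rintro rfl; exact h.zero hr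
    have hrn : 0 < ‖r‖ := norm_pos_iff.2 hr1
    have h1 := hmin (show ‖r‖⁻¹ • r ∈ insert 0 C ∩ Metric.sphere 0 1 from
      ⟨Or.inr (h.smul r hr _ (by positivity)), by simp [norm_smul, hrn.ne']⟩)
    simp only [mem_ofPred_eq, map_smul, smul_eq_mul] at h1
    rw [inv_mul_eq_div, le_div_iff₀ hrn] at h1
    exact h1
  · refine ⟨1, one_pos, fun r hr => ?_⟩
    exfalso
    have hr1 : r ≠ 0 := by rintro rfl; exact h.zero hr
    have hrn : 0 < ‖r‖ := norm_pos_iff.2 hr1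
    exact hne ⟨‖r‖⁻¹ • r, Or.inr (h.smul r hr _ (by positivity)), by simp [norm_smul, hrn.ne']⟩

/-- sign lemma -/
theorem PCone.sign {C : Set V} (h : PCone C) {X : Type*} [AddCommGroup X] [Module ℝ X] (lam : V →ₗ[ℝ] ℝ)
    (hlam : ∀ v ∈ C, 0 < lam v) (F G : X →ₗ[ℝ] V)
    (hFG : ∀ x, (F x ∈ C ∨ -F x ∈ C) ↔ (G x ∈ C ∨ -G x ∈ C)) :
    (∀ x, F x ∈ C ↔ G x ∈ C) ∨ (∀ x, F x ∈ C ↔ -G x ∈ C) := by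
  by_cases hex : ∃ x, F x ∈ C ∧ -G x ∈ C
  · right
    obtain ⟨x, hx, hx'⟩ := hex
    have key : ∀ y, F y ∈ C → -G y ∈ C := by
      intro y hy
      rcases (hFG y).1 (Or.inl hy) with h1 | h1
      · exfalso
        have l1 := hlam _ h1
        have l2 := hlam _ hx'
        rw [map_neg] at l2
        have hz : F (lam (G y) • x + (-lam (G x)) • y) ∈ C := by
          rw [map_add, map_smul, map_smul]
          exact h.add (h.smul _ hx _ l1) (h.smul _ hy _ l2)
        have h0 : lam (G (lam (G y) • x + (-lam (G x)) • y)) = 0 := by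
          simp; ring
        rcases (hFG _).1 (Or.inl hz) with h2 | h2
        · exact (hlam _ h2).ne' h0
        · have := hlam _ h2
          rw [map_neg, h0, neg_zero] at this
          exact lt_irrefl _ this
      · exact h1
    refine fun y => ⟨key y, fun hy => ?_⟩
    rcases (hFG y).2 (Or.inr hy) with h1 | h1
    · exact h1
    · have := key (-y) (by rwa [map_neg])
      rw [map_neg, neg_neg] at this
      exact absurd hy (h.neg this)
  · left
    push Not at hex
    have key : ∀ y, F y ∈ C → G y ∈ C := fun y hy =>
      ((hFG y).1 (Or.inl hy)).resolve_right (hex y hy)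
    refine fun y => ⟨key y, fun hy => ?_⟩
    rcases (hFG y).2 (Or.inl hy) with h1 | h1
    · exact h1
    · have := key (-y) (by rwa [map_neg])
      rw [map_neg] at this
      exact absurd this (h.neg hy)

end

section
variable {E : Type*} [NormedAddCommGroup E] [InnerProductSpace ℝ E] [FiniteDimensional ℝ E]

/-- dichotomy for the translation property -/
def DTr (C : Set (E × ℝ × ℝ)) : Prop := ∀ η : E →ₗ[ℝ] ℝ, ∃ c : E,
  ((∀ w, (w, η w - 1, (1:ℝ)) ∈ C ↔ (w + c, η (w + c) + 1, (1:ℝ)) ∈ C) ∧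
    (∀ w, -(w, η w - 1, (1:ℝ)) ∈ C ↔ -(w + c, η (w + c) + 1, (1:ℝ)) ∈ C)) ∨
  ((∀ w, (w, η w - 1, (1:ℝ)) ∈ C ↔ -(w + c, η (w + c) + 1, (1:ℝ)) ∈ C) ∧
    (∀ w, -(w, η w - 1, (1:ℝ)) ∈ C ↔ (w + c, η (w + c) + 1, (1:ℝ)) ∈ C))

theorem scale_k {C : Set (E × ℝ × ℝ)} (hC : PCone C) (w : E) (Z : ℝ) {k : ℝ} (hk : k ≠ 0) :
    ((w, Z, k) ∈ C ∨ -(w, Z, k) ∈ C) ↔ ((k⁻¹ • w, k⁻¹ * Z, (1:ℝ)) ∈ C ∨ -(k⁻¹ • w, k⁻¹ * Z, (1:ℝ)) ∈ C) := by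
  rcases hk.lt_or_gt with h | h
  · have e : (w, Z, k) = (-k) • -((k⁻¹ • w, k⁻¹ * Z, (1:ℝ)) : E × ℝ × ℝ) := by
      ext <;> simp [smul_smul, hk]
    rw [e, ← smul_neg, hC.smul_iff (by linarith), hC.smul_iff (by linarith), neg_neg, or_comm]
  · have e : (w, Z, k) = k • ((k⁻¹ • w, k⁻¹ * Z, (1:ℝ)) : E × ℝ × ℝ) := by
      ext <;> simp [smul_smul, hk]
    rw [e, ← smul_neg, hC.smul_iff h, hC.smul_iff h]

theorem q_scale (L : E ≃ₗ[ℝ] E) (η0 : E →ₗ[ℝ] ℝ) (κ : ℝ) (w : E) (Z : ℝ) {k : ℝ} (hk : k ≠ 0) :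
    ‖L (k⁻¹ • w)‖ ^ 2 + κ * (k⁻¹ * Z - η0 (k⁻¹ • w)) ^ 2 ≤ 1 + κ ↔
      ‖L w‖ ^ 2 + κ * (Z - η0 w) ^ 2 ≤ (1 + κ) * k ^ 2 := by
  have e : ‖L (k⁻¹ • w)‖ ^ 2 + κ * (k⁻¹ * Z - η0 (k⁻¹ • w)) ^ 2 =
      (‖L w‖ ^ 2 + κ * (Z - η0 w) ^ 2) / k ^ 2 := by
    simp only [map_smul, norm_smul, norm_inv, Real.norm_eq_abs, smul_eq_mul, mul_pow, inv_pow, sq_abs]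
    field_simp
  rw [e, div_le_iff₀ (by positivity)]

theorem cone_noncut (hE : 2 ≤ finrank ℝ E) {C : Set (E × ℝ × ℝ)} (hC : PCone C) (hk : ∀ v ∈ C, 0 < v.2.2)
    (h1 : ((0:E), (1:ℝ), (1:ℝ)) ∈ interior C) (h2 : ((0:E), (-1:ℝ), (1:ℝ)) ∈ interior C) (htr : DTr C) :
    ∃ (L : E ≃ₗ[ℝ] E) (η0 : E →ₗ[ℝ] ℝ) (κ : ℝ), 0 < κ ∧ ∀ w Z k, (w, Z, k) ≠ (0 : E × ℝ × ℝ) →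
      (((w, Z, k) ∈ C ∨ -(w, Z, k) ∈ C) ↔ ‖L w‖ ^ 2 + κ * (Z - η0 w) ^ 2 ≤ (1 + κ) * k ^ 2) := by
  set em : E × ℝ → E × ℝ × ℝ := fun p => (p.1, p.2, 1) with hem
  have hemc : Continuous em := by fun_prop
  set K : Set (E × ℝ) := em ⁻¹' C with hK
  have hKc : Convex ℝ K := by
    intro p hp q hq a b ha hb hab
    have := hC.conv hp hq ha hb hab
    change em _ ∈ C
    convert this using 1
    simp [hem, hab]
  have hKcl : IsClosed K := by
    have : K = em ⁻¹' (insert 0 C) := by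
      ext p
      simp only [hK, mem_preimage, mem_insert_iff]
      refine ⟨Or.inr, fun h => h.resolve_left fun h => ?_⟩
      have := congrArg (fun x : E × ℝ × ℝ => x.2.2) h
      simp [hem] at this
    rw [this]
    exact hC.cl.preimage hemc
  obtain ⟨ρ, hρ, hb⟩ := hC.bound (u := LinearMap.snd ℝ ℝ ℝ ∘ₗ LinearMap.snd ℝ E (ℝ × ℝ)) (by simpa using hk)
  have hKcpt : IsCompact K := by
    refine Metric.isCompact_of_isClosed_isBounded hKcl (isBounded_iff_forall_norm_le.2 ⟨1 / ρ, fun p hp => ?_⟩)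
    have h3 := hb _ hp
    have h4 : ‖p‖ ≤ ‖em p‖ := by
      simp only [hem, Prod.norm_def]
      exact max_le_max le_rfl (le_max_left _ _)
    have h5 : ρ * ‖em p‖ ≤ 1 := h3
    rw [le_div_iff₀ hρ]
    nlinarith
  obtain ⟨L, η0, κ, hκ, h⟩ := TN hE hKc hKcpt (preimage_interior_subset_interior_preimage hemc h1)
    (preimage_interior_subset_interior_preimage hemc h2) (by
      intro η
      obtain ⟨c, ⟨h3, -⟩ | ⟨h3, -⟩⟩ := htr η
      · exact ⟨c, h3⟩
      · exfalso
        have := (h3 0).1 (by simpa using interior_subset h2)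
        have := hk _ this
        simp at this
        linarith)
  refine ⟨L, η0, κ, hκ, fun w Z k hne => ?_⟩
  by_cases hk0 : k = 0
  · subst hk0
    constructor
    · rintro (h | h) <;> simpa using hk _ h
    · intro hq
      exfalso
      have e0 : 0 ≤ κ * (Z - η0 w) ^ 2 := by positivity
      have e1 : ‖L w‖ ^ 2 = 0 := by nlinarith [sq_nonneg ‖L w‖]
      have e2 : w = 0 := by simpa using e1
      subst e2
      have e3 : κ * Z ^ 2 = 0 := le_antisymm (by simpa using hq) (by positivity)
      have e4 : Z = 0 := by simpa [hκ.ne'] using e3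
      subst e4
      exact hne rfl
  · rw [scale_k hC _ _ hk0, ← q_scale L η0 κ w Z hk0, ← h]
    refine ⟨fun h => h.resolve_right fun h => ?_, Or.inl⟩
    have := hk _ h
    simp at this
    linarith

theorem cone_cut (hE : 2 ≤ finrank ℝ E) {C : Set (E × ℝ × ℝ)} (hC : PCone C) (hZ : ∀ w Z, (w, Z, (0:ℝ)) ∈ C → Z < 0)
    (h1 : -((0:E), (1:ℝ), (1:ℝ)) ∈ interior C) (h2 : ((0:E), (-1:ℝ), (1:ℝ)) ∈ interior C) (htr : DTr C) :
    ∃ (L : E ≃ₗ[ℝ] E) (η0 : E →ₗ[ℝ] ℝ) (κ : ℝ), κ < 0 ∧ 1 + κ < 0 ∧ ∀ w Z k, (w, Z, k) ≠ (0 : E × ℝ × ℝ) →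
      (((w, Z, k) ∈ C ∨ -(w, Z, k) ∈ C) ↔ ‖L w‖ ^ 2 + κ * (Z - η0 w) ^ 2 ≤ (1 + κ) * k ^ 2) := by
  set em : E × ℝ → E × ℝ × ℝ := fun p => (p.1, p.2, 1) with hem
  have hemc : Continuous em := by fun_prop
  set en : E × ℝ → E × ℝ × ℝ := fun p => -(p.1, p.2, 1) with hen
  have henc : Continuous en := by fun_prop
  set er : E × ℝ → E × ℝ × ℝ := fun p => -(p.1, p.2, 0) with her
  have herc : Continuous er := by fun_prop
  have hcut : Cut (em ⁻¹' C) (en ⁻¹' C) (er ⁻¹' (insert 0 C)) := by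
    refine ⟨?_, ?_, ?_, ?_, hC.cl.preimage herc, ?_, ?_, ?_, ?_, ?_, ?_, ?_, ?_, ?_, htr⟩
    · intro p hp q hq a b ha hb hab
      have := hC.conv hp hq ha hb hab
      change em _ ∈ C
      convert this using 1
      simp [hem, hab]
    · have : em ⁻¹' C = em ⁻¹' (insert 0 C) := by
        ext p
        simp only [mem_preimage, mem_insert_iff]
        refine ⟨Or.inr, fun h => h.resolve_left fun h => ?_⟩
        have := congrArg (fun x : E × ℝ × ℝ => x.2.2) h
        simp [hem] at this
      rw [this]
      exact hC.cl.preimage hemc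
    · intro p hp q hq a b ha hb hab
      have := hC.conv hp hq ha hb hab
      change en _ ∈ C
      convert this using 1
      ext <;> simp [hen]
      · abel
      · ring
      · linarith
    · have : en ⁻¹' C = en ⁻¹' (insert 0 C) := by
        ext p
        simp only [mem_preimage, mem_insert_iff]
        refine ⟨Or.inr, fun h => h.resolve_left fun h => ?_⟩
        have := congrArg (fun x : E × ℝ × ℝ => x.2.2) h
        simp [hen] at this
      rw [this]
      exact hC.cl.preimage henc
    · intro r hr t ht
      have e : er (t • r) = t • er r := by simp [her]
      rw [mem_preimage, e]
      rcases hr with hr | hr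
      · rw [hr, smul_zero]; exact mem_insert _ _
      · rcases ht.eq_or_lt with h | h
        · rw [← h, zero_smul]; exact mem_insert _ _
        · exact Or.inr (hC.smul _ hr t h)
    · intro r hr h0
      rcases hr with hr | hr
      · exact absurd (by simpa [her, Prod.ext_iff] using hr) h0
      · have := hZ (-r.1) (-r.2) (by simpa [her] using hr)
        linarith
    · refine preimage_interior_subset_interior_preimage herc ?_
      refine interior_mono (subset_insert _ _) ?_
      have := hC.conv.interior h1 h2 (a := 1/2) (b := 1/2) (by norm_num) (by norm_num) (by norm_num)
      convert this using 1
      ext <;> simp [her]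
      norm_num
    · intro b hb r hr
      rcases hr with hr | hr
      · have : r = 0 := by simpa [her, Prod.ext_iff] using hr
        rw [this, add_zero]; exact hb
      · have := hC.add hb hr
        rw [mem_preimage]
        convert this using 1
        ext <;> simp [hen, her] <;> abel
    · intro b hb r hr
      rcases hr with hr | hr
      · have : r = 0 := by simpa [her, Prod.ext_iff] using hr
        rw [this, sub_zero]; exact hb
      · have := hC.add hb hr
        rw [mem_preimage]
        convert this using 1
        ext <;> simp [hem, her] <;> abel
    · intro a ha b hb
      have := hC.add ha hb
      refine Or.inr ?_
      convert this using 1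
      ext <;> simp [hem, hen, her] <;> abel
    · intro x hx hx'
      exact hC.neg hx hx'
    · exact preimage_interior_subset_interior_preimage henc h1
    · exact preimage_interior_subset_interior_preimage hemc h2
  obtain ⟨L, η0, κ, hκ, hκ1, h⟩ := TC hE hcut
  have hgen : ∀ w Z k, k ≠ 0 → 
      (((w, Z, k) ∈ C ∨ -(w, Z, k) ∈ C) ↔ ‖L w‖ ^ 2 + κ * (Z - η0 w) ^ 2 ≤ (1 + κ) * k ^ 2) := by
    intro w Z k hk0
    rw [scale_k hC _ _ hk0, ← q_scale L η0 κ w Z hk0, ← h]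
    rfl
  refine ⟨L, η0, κ, hκ, hκ1, fun w Z k hne => ?_⟩
  by_cases hk0 : k = 0
  swap
  · exact hgen w Z k hk0
  subst hk0
  have hLc : Continuous L := L.toLinearMap.continuous_of_finiteDimensional
  have hηc : Continuous η0 := η0.continuous_of_finiteDimensional
  constructor
  · have key : ∀ w Z, (w, Z, (0:ℝ)) ∈ C → ‖L w‖ ^ 2 + κ * (Z - η0 w) ^ 2 ≤ (1 + κ) * 0 ^ 2 := by
      intro w Z hC'
      have hc : Continuous (fun ε : ℝ => ‖L w‖ ^ 2 + κ * (Z - ε - η0 w) ^ 2 - (1 + κ) * ε ^ 2) := by fun_prop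
      have ht := (hc.tendsto 0).mono_left (nhdsWithin_le_nhds (s := Ioi 0))
      have := le_of_tendsto ht (b := 0) (by
        filter_upwards [self_mem_nhdsWithin] with ε hε
        have hε : 0 < ε := hε
        have h5 := hC.add hC' (hC.smul _ (interior_subset h2) ε hε)
        have h6 := (hgen w (Z - ε) ε hε.ne').1 (Or.inl (by
          convert h5 using 1
          ext <;> simp [sub_eq_add_neg]))
        linarith)
      simp only [sub_zero] at this
      linarith
    rintro (h | h)
    · exact key _ _ h
    · have := key (-w) (-Z) (by simpa using h)
      rw [map_neg, norm_neg, map_neg] at this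
      convert this using 3
      ring
  · intro hq
    set y := Z - η0 w with hy
    have hmain : (w, Z, (0:ℝ)) ∈ (insert 0 C) ∪ -(insert 0 C) := by
      have hcl : IsClosed ((insert 0 C) ∪ -(insert 0 C)) := hC.cl.union hC.cl.neg
      have hc : Continuous (fun s : ℝ => (w, Z + s * y, √(κ * y ^ 2 * ((1 + s) ^ 2 - 1) / (1 + κ)))) := by fun_prop
      have ht := (hc.tendsto 0).mono_left (nhdsWithin_le_nhds (s := Ioi 0))
      simp only [zero_mul, add_zero, one_pow, sub_self, mul_zero, zero_div, Real.sqrt_zero] at ht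
      refine hcl.mem_of_tendsto ht ?_
      filter_upwards [self_mem_nhdsWithin] with s hs
      have hs : 0 < s := hs
      have hy0 : y ≠ 0 := by
        intro h0
        rw [h0] at hq
        have e1 : ‖L w‖ ^ 2 = 0 := by nlinarith [sq_nonneg ‖L w‖]
        have e2 : w = 0 := by simpa using e1
        subst e2
        apply hne
        have : Z = 0 := by simpa [h0] using hy.symm
        rw [this]; rfl
      have hpos : 0 < κ * y ^ 2 * ((1 + s) ^ 2 - 1) / (1 + κ) := by
        apply div_pos_of_neg_of_neg _ hκ1
        have : 0 < y ^ 2 := by positivity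
        have : 0 < (1 + s) ^ 2 - 1 := by nlinarith
        have := mul_neg_of_neg_of_pos hκ ‹0 < y ^ 2›
        exact mul_neg_of_neg_of_pos this ‹_›
      have h7 := (hgen w (Z + s * y) _ (Real.sqrt_pos.2 hpos).ne').2 (by
        rw [Real.sq_sqrt hpos.le, mul_div_cancel₀ _ hκ1.ne]
        have : Z + s * y - η0 w = (1 + s) * y := by rw [hy]; ring
        rw [this]
        nlinarith)
      rcases h7 with h7 | h7
      · exact Or.inl (Or.inr h7)
      · exact Or.inr (Or.inr h7)
    rcases hmain with (h | h) | (h | h)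
    · exact absurd h hne
    · exact Or.inl h
    · exact absurd (neg_eq_zero.1 h) hne
    · exact Or.inr h

end
end

section
open Set Module Filter Topology
open scoped RealInnerProductSpace
set_option linter.unusedSectionVars false

section
variable {V : Type*} [NormedAddCommGroup V] [NormedSpace ℝ V] [FiniteDimensional ℝ V]

theorem ker_fin {n : ℕ} (hV : finrank ℝ V = n + 2) {h u : V →ₗ[ℝ] ℝ} {P q : V} (hP : h P = 1) (hq : h q = 0)
    (hu : u q ≠ 0) : finrank ℝ (LinearMap.ker (h.prod u)) = n := by
  have hs : LinearMap.range (h.prod u) = ⊤ := by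
    rw [LinearMap.range_eq_top]
    rintro ⟨a, b⟩
    refine ⟨a • P + ((b - a * u P) / u q) • q, ?_⟩
    ext
    · simp [hP, hq]
    · simp; field_simp; ring
  have := LinearMap.finrank_range_add_finrank_ker (h.prod u)
  rw [hs, finrank_top, hV] at this
  simp at this
  omega

def PsiHyp (n : ℕ) (C : Set V) (h : V →ₗ[ℝ] ℝ) (P1 P2 : V) : Prop :=
  ∀ Wl : Submodule ℝ V, finrank ℝ Wl = n → Wl ≤ LinearMap.ker h → ∃ c ∈ Wl, ∀ l ∈ Wl, ∀ k : ℝ,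
    (l + k • P1 ∈ C ∨ -(l + k • P1) ∈ C) ↔ (l + k • (P2 + c) ∈ C ∨ -(l + k • (P2 + c)) ∈ C)

theorem coords {n : ℕ} (hV : finrank ℝ V = n + 2) {C : Set V} (hC : PCone C) {lam : V →ₗ[ℝ] ℝ}
    (hlam : ∀ v ∈ C, 0 < lam v) {h u : V →ₗ[ℝ] ℝ} {P1 P2 : V} (h1 : h P1 = 1) (h2 : h P2 = 1)
    (hu : u (P2 - P1) ≠ 0) (hΨ : PsiHyp n C h P1 P2) :
    ∃ Θ : (EuclideanSpace ℝ (Fin n) × ℝ × ℝ) ≃ₗ[ℝ] V, (∀ w, u (Θ (w, 0, 0)) = 0) ∧ (∀ w Z k, h (Θ (w, Z, k)) = k) ∧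
      Θ (0, 1, 1) = P2 ∧ Θ (0, -1, 1) = P1 ∧ DTr (Θ ⁻¹' C) := by
  have hq : h (P2 - P1) = 0 := by rw [map_sub, h1, h2, sub_self]
  have hfin := ker_fin hV h1 hq hu
  let ι0 : EuclideanSpace ℝ (Fin n) ≃ₗ[ℝ] LinearMap.ker (h.prod u) :=
    LinearEquiv.ofFinrankEq _ _ (by rw [hfin]; simp)
  let ι : EuclideanSpace ℝ (Fin n) →ₗ[ℝ] V := (LinearMap.ker (h.prod u)).subtype ∘ₗ ι0.toLinearMap
  have hιinj : Function.Injective ι := (Submodule.injective_subtype _).comp ι0.injective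
  have hι : ∀ w, h (ι w) = 0 ∧ u (ι w) = 0 := by
    intro w
    have : (h.prod u) (ι w) = 0 := LinearMap.mem_ker.1 (ι0 w).2
    exact ⟨congrArg Prod.fst this, congrArg Prod.snd this⟩
  set e : V := (1/2 : ℝ) • (P2 - P1) with he
  set o : V := (1/2 : ℝ) • (P2 + P1) with ho
  have hhe : h e = 0 := by rw [he, map_smul, hq, smul_zero]
  have hho : h o = 1 := by rw [ho, map_smul, map_add, h1, h2]; norm_num
  have hue : u e ≠ 0 := by rw [he, map_smul, smul_eq_mul]; simpa using hu
  have hP1 : P1 = o - e := by rw [ho, he]; module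
  have hP2 : P2 = o + e := by rw [ho, he]; module
  let Θ0 : (EuclideanSpace ℝ (Fin n) × ℝ × ℝ) →ₗ[ℝ] V :=
    ι.coprod ((LinearMap.toSpanSingleton ℝ V e).coprod (LinearMap.toSpanSingleton ℝ V o))
  have hΘ0 : ∀ w Z k, Θ0 (w, Z, k) = ι w + (Z • e + k • o) := by intro w Z k; simp [Θ0]
  have hh : ∀ w Z k, h (Θ0 (w, Z, k)) = k := by
    intro w Z k; rw [hΘ0]; simp [hι, hhe, hho]
  have hinj : Function.Injective Θ0 := by
    rw [injective_iff_map_eq_zero]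
    rintro ⟨w, Z, k⟩ h0
    have e1 := hh w Z k
    rw [h0, map_zero] at e1
    subst e1
    rw [hΘ0] at h0
    have e2 := congrArg u h0
    simp [hι, hue] at e2
    subst e2
    simp at h0
    have : w = 0 := hιinj (by simpa using h0)
    rw [this]; rfl
  let Θ := LinearMap.linearEquivOfInjective Θ0 hinj (by rw [hV]; simp)
  have hΘ : ∀ w Z k, Θ (w, Z, k) = ι w + (Z • e + k • o) := fun w Z k => by
    rw [← hΘ0]; rfl
  refine ⟨Θ, ?_, hh, ?_, ?_, ?_⟩
  · intro w; rw [hΘ]; simp [hι]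
  · rw [hΘ, hP2]; simp [add_comm]
  · rw [hΘ, hP1]; simp; abel
  intro η
  let g : EuclideanSpace ℝ (Fin n) →ₗ[ℝ] V := ι + (LinearMap.toSpanSingleton ℝ V e) ∘ₗ η
  have hg : ∀ w, g w = ι w + η w • e := by intro w; simp [g]
  have hginj : Function.Injective g := by
    rw [injective_iff_map_eq_zero]
    intro w h0
    rw [hg] at h0
    have e2 := congrArg u h0
    simp [hι, hue] at e2
    rw [e2] at h0
    exact hιinj (by simpa using h0)
  obtain ⟨c, ⟨c0, rfl⟩, hc⟩ := hΨ (LinearMap.range g) (by rw [LinearMap.finrank_range_of_inj hginj]; simp) (by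
    rintro _ ⟨w, rfl⟩
    rw [LinearMap.mem_ker, hg]; simp [hι, hhe])
  let F : (EuclideanSpace ℝ (Fin n) × ℝ) →ₗ[ℝ] V := g.coprod (LinearMap.toSpanSingleton ℝ V P1)
  let G : (EuclideanSpace ℝ (Fin n) × ℝ) →ₗ[ℝ] V := g.coprod (LinearMap.toSpanSingleton ℝ V (P2 + g c0))
  have hF : ∀ w k, F (w, k) = g w + k • P1 := by intro w k; simp [F]
  have hG : ∀ w k, G (w, k) = g w + k • (P2 + g c0) := by intro w k; simp [G]
  have hs := hC.sign lam hlam F G (by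
    rintro ⟨w, k⟩
    rw [hF, hG]
    exact hc _ ⟨w, rfl⟩ k)
  have f1 : ∀ w, Θ (w, η w - 1, 1) = F (w, 1) := by
    intro w; rw [hΘ, hF, hg, hP1]; module
  have g1 : ∀ w, Θ (w + c0, η (w + c0) + 1, 1) = G (w, 1) := by
    intro w; rw [hΘ, hG, hg, hg, hP2, map_add, map_add]; module
  have nf : ∀ w, -F (w, 1) = F (-w, -1) := by intro w; rw [← map_neg]; rfl
  have ng : ∀ w, -G (w, 1) = G (-w, -1) := by intro w; rw [← map_neg]; rfl
  refine ⟨c0, ?_⟩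
  simp only [mem_preimage, map_neg, f1, g1]
  rcases hs with hs | hs
  · left
    refine ⟨fun w => hs _, fun w => ?_⟩
    rw [nf, ng]; exact hs _
  · right
    refine ⟨fun w => hs _, fun w => ?_⟩
    rw [nf, hs, ← ng, neg_neg]

theorem PCone.exists_u {C : Set V} (hC : PCone C) {lam : V →ₗ[ℝ] ℝ} (hlam : ∀ v ∈ C, 0 < lam v) {q : V} (hq : q ≠ 0) :
    ∃ u : V →ₗ[ℝ] ℝ, (∀ v ∈ C, 0 < u v) ∧ u q ≠ 0 := by
  by_cases h0 : lam q = 0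
  swap
  · exact ⟨lam, hlam, h0⟩
  obtain ⟨φ, hφ⟩ := Module.Projective.exists_dual_ne_zero ℝ hq
  obtain ⟨ρ, hρ, hb⟩ := hC.bound hlam
  set M := ‖LinearMap.toContinuousLinearMap φ‖ with hM
  have hM0 : 0 ≤ M := norm_nonneg _
  have hε : 0 < ρ / (M + 1) := by positivity
  refine ⟨lam + (ρ / (M + 1)) • φ, fun v hv => ?_, ?_⟩
  · have hv0 : v ≠ 0 := by rintro rfl; exact hC.zero hv
    have hvn : 0 < ‖v‖ := norm_pos_iff.2 hv0
    have e1 : |φ v| ≤ M * ‖v‖ := (LinearMap.toContinuousLinearMap φ).le_opNorm v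
    have e2 := hb v hv
    have e3 := neg_abs_le (φ v)
    have e4 : ρ / (M + 1) * (M * ‖v‖) < ρ * ‖v‖ := by
      rw [div_mul_eq_mul_div, div_lt_iff₀ (by positivity)]
      nlinarith [mul_pos hρ hvn]
    have e5 : ρ / (M + 1) * (-(M * ‖v‖)) ≤ ρ / (M + 1) * φ v :=
      mul_le_mul_of_nonneg_left (by linarith) hε.le
    simp only [LinearMap.add_apply, LinearMap.smul_apply, smul_eq_mul]
    linarith
  · simp only [LinearMap.add_apply, LinearMap.smul_apply, smul_eq_mul, h0, zero_add]
    exact mul_ne_zero hε.ne' hφ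

/-- the cut case with both points on the same side is impossible -/
theorem same_side_aux {n : ℕ} (hn : 1 ≤ n) (hV : finrank ℝ V = n + 2) {C : Set V} (hC : PCone C) {u : V →ₗ[ℝ] ℝ}
    (hu : ∀ v ∈ C, 0 < u v) {h : V →ₗ[ℝ] ℝ} {P1 P2 c : V} (h1 : h P1 = 1) (h2 : h P2 = 1) (i1 : P1 ∈ C)
    (hq : 0 < u (P2 - P1)) {r0 : V} (hr0 : r0 ∈ interior C) (hr : h r0 = 0)
    (hc : c ∈ LinearMap.ker (h.prod u))
    (hs : ∀ l ∈ LinearMap.ker (h.prod u), l + P1 ∈ C ↔ l + (P2 + c) ∈ C) : False := by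
  set q := P2 - P1 with hqd
  have hhq : h q = 0 := by rw [hqd, map_sub, h1, h2, sub_self]
  obtain ⟨ρ, hρ, hb⟩ := hC.bound hu
  have hmem : ∀ v, v ∈ LinearMap.ker (h.prod u) ↔ h v = 0 ∧ u v = 0 := by
    intro v; rw [LinearMap.mem_ker]; simp
  obtain ⟨hc1, hc2⟩ := (hmem c).1 hc
  have key : ∀ r ∈ C, h r = 0 → u r = u q → r = q + c := by
    intro r hr hhr hur
    set x := r - q - c with hx
    have hx1 : h x = 0 := by rw [hx]; simp [hhr, hhq, hc1]
    have hx2 : u x = 0 := by rw [hx]; simp [hur, hc2]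
    have hk : ∀ k : ℕ, (k:ℝ) • x + P1 ∈ C := by
      intro k
      induction k with
      | zero => simpa using i1
      | succ k ih =>
        have e1 := hC.add ih hr
        refine (hs _ ((hmem _).2 ⟨by simp [hx1], by simp [hx2]⟩)).2 ?_
        convert e1 using 1
        rw [hx, hqd]; push_cast; module
    have hbd : ∀ k : ℕ, k * ‖x‖ ≤ u P1 / ρ + ‖P1‖ := by
      intro k
      have e1 := hb _ (hk k)
      rw [map_add, map_smul, hx2, smul_zero, zero_add] at e1
      have e2 : ‖(k:ℝ) • x‖ ≤ ‖(k:ℝ) • x + P1‖ + ‖P1‖ := by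
        have := norm_sub_le ((k:ℝ) • x + P1) P1
        rwa [add_sub_cancel_right] at this
      rw [norm_smul, Real.norm_of_nonneg (Nat.cast_nonneg k)] at e2
      have e3 : ‖(k:ℝ) • x + P1‖ ≤ u P1 / ρ := by rw [le_div_iff₀ hρ]; linarith
      linarith
    have hx0 : x = 0 := by
      by_contra hcon
      have hxn := norm_pos_iff.2 hcon
      obtain ⟨k, hk'⟩ := exists_nat_gt ((u P1 / ρ + ‖P1‖) / ‖x‖)
      rw [div_lt_iff₀ hxn] at hk'
      linarith [hbd k]
    have : r = x + (q + c) := by rw [hx]; abel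
    rw [this, hx0, zero_add]
  have hfin := ker_fin hV h1 hhq hq.ne'
  have hpos : 0 < finrank ℝ (LinearMap.ker (h.prod u)) := by omega
  obtain ⟨⟨l, hl⟩, hl0⟩ := Module.finrank_pos_iff_exists_ne_zero.1 hpos
  have hl0 : l ≠ 0 := fun h => hl0 (by simpa using h)
  obtain ⟨hl1, hl2⟩ := (hmem l).1 hl
  have hc0 : Continuous (fun s : ℝ => r0 + s • l) := by fun_prop
  have ht := (hc0.tendsto 0).mono_left (nhdsWithin_le_nhds (s := Ioi 0))
  rw [zero_smul, add_zero] at ht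
  obtain ⟨s, hs1, hs2⟩ := ((ht.eventually (mem_interior_iff_mem_nhds.1 hr0)).and self_mem_nhdsWithin).exists
  have hs2 : 0 < s := hs2
  have hur := hu _ (interior_subset hr0)
  have ha : 0 < u q / u r0 := by positivity
  have k1 := key _ (hC.smul _ (interior_subset hr0) _ ha) (by simp [hr]) (by simp; field_simp)
  have k2 := key _ (hC.smul _ hs1 _ ha) (by simp [hr, hl1]) (by simp [hl2]; field_simp)
  rw [← k1, smul_add] at k2
  have : (u q / u r0) • s • l = 0 := by simpa using k2
  simp [ha.ne', hs2.ne', hl0] at this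

theorem same_side {n : ℕ} (hn : 1 ≤ n) (hV : finrank ℝ V = n + 2) {C : Set V} (hC : PCone C) {lam : V →ₗ[ℝ] ℝ}
    (hlam : ∀ v ∈ C, 0 < lam v) {h : V →ₗ[ℝ] ℝ} {P1 P2 : V} (h1 : h P1 = 1) (h2 : h P2 = 1)
    (hne : P1 ≠ P2) (i1 : P1 ∈ C) (i2 : P2 ∈ C) {r0 : V} (hr0 : r0 ∈ interior C) (hr : h r0 = 0)
    (hΨ : PsiHyp n C h P1 P2) : False := by
  obtain ⟨u, hu, huq⟩ := hC.exists_u hlam (sub_ne_zero.2 hne.symm)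
  have hhq : h (P2 - P1) = 0 := by rw [map_sub, h1, h2, sub_self]
  have hmem : ∀ v, v ∈ LinearMap.ker (h.prod u) ↔ h v = 0 ∧ u v = 0 := by
    intro v; rw [LinearMap.mem_ker]; simp
  obtain ⟨c, hc, hc'⟩ := hΨ (LinearMap.ker (h.prod u)) (ker_fin hV h1 hhq huq) (fun v hv => ((hmem v).1 hv).1)
  let F : (LinearMap.ker (h.prod u) × ℝ) →ₗ[ℝ] V :=
    (LinearMap.ker (h.prod u)).subtype.coprod (LinearMap.toSpanSingleton ℝ V P1)
  let G : (LinearMap.ker (h.prod u) × ℝ) →ₗ[ℝ] V :=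
    (LinearMap.ker (h.prod u)).subtype.coprod (LinearMap.toSpanSingleton ℝ V (P2 + c))
  have hF : ∀ w k, F (w, k) = w + k • P1 := by intro w k; simp [F]
  have hG : ∀ w k, G (w, k) = w + k • (P2 + c) := by intro w k; simp [G]
  rcases hC.sign lam hlam F G (by
    rintro ⟨w, k⟩
    rw [hF, hG]
    exact hc' _ w.2 k) with hs | hs
  · have hs' : ∀ l ∈ LinearMap.ker (h.prod u), l + P1 ∈ C ↔ l + (P2 + c) ∈ C := by
      intro l hl
      have := hs (⟨l, hl⟩, 1)
      rw [hF, hG] at this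
      simpa using this
    rcases huq.lt_or_gt with hq | hq
    · have hq' : 0 < u (P1 - P2) := by rw [map_sub] at *; linarith
      refine same_side_aux hn hV hC hu h2 h1 i2 hq' hr0 hr (neg_mem hc) fun l hl => ?_
      have := hs' (l + -c) (add_mem hl (neg_mem hc))
      rw [show l + -c + (P2 + c) = l + P2 by abel] at this
      rw [← this]
      rw [show l + -c + P1 = l + (P1 + -c) by abel]
    · exact same_side_aux hn hV hC hu h1 h2 i1 hq hr0 hr hc hs'
  · have := (hs (0, 1)).1 (by rw [hF]; simpa using i1)
    rw [hG] at this
    have h3 := hC.add i2 this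
    have h4 := hu _ h3
    simp [((hmem c).1 hc).2] at h4

end
end

section
open Set Module Filter Topology
open scoped RealInnerProductSpace
set_option linter.unusedSectionVars false

section
variable {E : Type*} [NormedAddCommGroup E] [InnerProductSpace ℝ E] [FiniteDimensional ℝ E]

theorem exists_N0 (L : E ≃ₗ[ℝ] E) (η0 : E →ₗ[ℝ] ℝ) {a b : ℝ} (ha : a ≠ 0) (hb : b ≠ 0) :
    ∃ N : (E × ℝ × ℝ) ≃ₗ[ℝ] (E × ℝ × ℝ), ∀ w Z k, N (w, Z, k) = (L w, a * (Z - η0 w), b * k) := by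
  let N0 : (E × ℝ × ℝ) →ₗ[ℝ] (E × ℝ × ℝ) :=
    { toFun := fun v => (L v.1, a * (v.2.1 - η0 v.1), b * v.2.2)
      map_add' := by intro x y; ext <;> simp <;> ring
      map_smul' := by intro c x; ext <;> simp <;> ring }
  have hN0 : ∀ w Z k, N0 (w, Z, k) = (L w, a * (Z - η0 w), b * k) := fun _ _ _ => rfl
  have hinj : Function.Injective N0 := by
    rw [injective_iff_map_eq_zero]
    rintro ⟨w, Z, k⟩ h0
    rw [hN0] at h0
    have e1 : L w = 0 := congrArg Prod.fst h0
    have e2 : a * (Z - η0 w) = 0 := congrArg (fun p => p.2.1) h0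
    have e3 : b * k = 0 := congrArg (fun p => p.2.2) h0
    have e1 : w = 0 := by simpa using e1
    subst e1
    simp [ha] at e2
    simp [hb] at e3
    rw [e2, e3]; rfl
  exact ⟨LinearMap.linearEquivOfInjective N0 hinj rfl, hN0⟩

theorem exists_N1 (L : E ≃ₗ[ℝ] E) (η0 : E →ₗ[ℝ] ℝ) {a b : ℝ} (ha : a ≠ 0) (hb : b ≠ 0) :
    ∃ N : (E × ℝ × ℝ) ≃ₗ[ℝ] (E × ℝ × ℝ), ∀ w Z k, N (w, Z, k) = (L w, b * k, a * (Z - η0 w)) := by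
  obtain ⟨N, hN⟩ := exists_N0 L η0 ha hb
  refine ⟨N.trans ((LinearEquiv.refl ℝ E).prodCongr (LinearEquiv.prodComm ℝ ℝ ℝ)), fun w Z k => ?_⟩
  simp [hN]

end

section
variable {V : Type*} [NormedAddCommGroup V] [NormedSpace ℝ V] [FiniteDimensional ℝ V]

theorem PCone.preimage {X : Type*} [NormedAddCommGroup X] [NormedSpace ℝ X] [FiniteDimensional ℝ X]
    {C : Set V} (hC : PCone C) (Θ : X ≃ₗ[ℝ] V) : PCone (Θ ⁻¹' C) where
  conv := hC.conv.linear_preimage Θ.toLinearMap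
  smul := by
    intro v hv t ht
    rw [mem_preimage, map_smul]
    exact hC.smul _ hv t ht
  zero := by
    rw [mem_preimage, map_zero]; exact hC.zero
  cl := by
    have : insert 0 (Θ ⁻¹' C) = Θ ⁻¹' (insert 0 C) := by
      ext v; simp
    rw [this]
    exact hC.cl.preimage (Θ.toLinearMap.continuous_of_finiteDimensional)

theorem interior_pre {X : Type*} [NormedAddCommGroup X] [NormedSpace ℝ X] [FiniteDimensional ℝ X]
    {C : Set V} (Θ : X ≃ₗ[ℝ] V) {x : X} (hx : Θ x ∈ interior C) : x ∈ interior (Θ ⁻¹' C) :=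
  preimage_interior_subset_interior_preimage (Θ.toLinearMap.continuous_of_finiteDimensional) hx

theorem cone_main {n : ℕ} (hn : 2 ≤ n) (hV : finrank ℝ V = n + 2) {C : Set V} (hC : PCone C) {lam : V →ₗ[ℝ] ℝ}
    (hlam : ∀ v ∈ C, 0 < lam v) {h : V →ₗ[ℝ] ℝ} {P1 P2 : V} (h1 : h P1 = 1) (h2 : h P2 = 1)
    (i1 : P1 ∈ interior C) (i2 : P2 ∈ interior C ∨ -P2 ∈ interior C) (hne : P1 ≠ P2)
    (hcase : (∀ v ∈ C, h v ≠ 0) ∨ ∃ r ∈ interior C, h r = 0) (hΨ : PsiHyp n C h P1 P2) :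
    ∃ N : V ≃ₗ[ℝ] (EuclideanSpace ℝ (Fin n) × ℝ × ℝ), ∀ v ≠ 0, (v ∈ C ∨ -v ∈ C) ↔
      ‖(N v).1‖ ^ 2 + (N v).2.1 ^ 2 ≤ (N v).2.2 ^ 2 := by
  have hE : 2 ≤ finrank ℝ (EuclideanSpace ℝ (Fin n)) := by simpa using hn
  rcases hcase with hcase | ⟨r, hr, hr0⟩
  · have hpos : ∀ v ∈ C, 0 < h v := by
      intro v hv
      by_contra hcon
      have hlt : h v < 0 := lt_of_le_of_ne (not_lt.1 hcon) (hcase v hv)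
      refine hcase _ (hC.add hv (hC.smul _ (interior_subset i1) (-h v) (by linarith))) ?_
      simp [h1]
    have i2' : P2 ∈ interior C := by
      refine i2.resolve_right fun hcon => ?_
      have := hpos _ (interior_subset hcon)
      rw [map_neg, h2] at this
      linarith
    obtain ⟨u, hu, huq⟩ := hC.exists_u hlam (sub_ne_zero.2 hne.symm)
    obtain ⟨Θ, -, hh, t2, t1, hD⟩ := coords hV hC hlam h1 h2 huq hΨ
    obtain ⟨L, η0, κ, hκ, hq⟩ := cone_noncut hE (hC.preimage Θ) (by
      rintro ⟨w, Z, k⟩ hv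
      have := hpos _ hv
      rwa [hh] at this) (interior_pre Θ (by rwa [t2])) (interior_pre Θ (by rwa [t1])) hD
    obtain ⟨N, hN⟩ := exists_N0 L η0 (Real.sqrt_pos.2 hκ).ne' (Real.sqrt_pos.2 (show 0 < 1 + κ by linarith)).ne'
    refine ⟨Θ.symm.trans N, fun v hv => ?_⟩
    obtain ⟨⟨w, Z, k⟩, rfl⟩ := Θ.surjective v
    have hv' : (w, Z, k) ≠ (0 : EuclideanSpace ℝ (Fin n) × ℝ × ℝ) := by rintro h0; rw [h0] at hv; simp at hv
    have := hq w Z k hv'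
    rw [mem_preimage, mem_preimage, map_neg] at this
    rw [this]
    simp only [LinearEquiv.trans_apply, LinearEquiv.symm_apply_apply, hN, mul_pow]
    rw [Real.sq_sqrt hκ.le, Real.sq_sqrt (by linarith)]
  · rcases i2 with i2 | i2
    · exact (same_side (by omega) hV hC hlam h1 h2 hne (interior_subset i1) (interior_subset i2) hr hr0 hΨ).elim
    · have l1 := hlam _ (interior_subset i1)
      have l2 := hlam _ (interior_subset i2)
      rw [map_neg] at l2
      have hlq : lam (P2 - P1) < 0 := by rw [map_sub]; linarith
      obtain ⟨Θ, hu, hh, t2, t1, hD⟩ := coords hV hC hlam h1 h2 hlq.ne hΨ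
      have he : lam (Θ (0, 1, 0)) * 2 = lam (P2 - P1) := by
        rw [← t2, ← t1, ← map_sub]
        have : ((0, 1, 1) - (0, -1, 1) : EuclideanSpace ℝ (Fin n) × ℝ × ℝ) = (2:ℝ) • (0, 1, 0) := by
          ext <;> simp; norm_num
        rw [this, map_smul, map_smul, smul_eq_mul, mul_comm]
      obtain ⟨L, η0, κ, hκ, hκ', hq⟩ := cone_cut hE (hC.preimage Θ) (by
        intro w Z hv
        have := hlam _ hv
        have e : ((w, Z, 0) : EuclideanSpace ℝ (Fin n) × ℝ × ℝ) = (w, 0, 0) + Z • (0, 1, 0) := by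
          ext <;> simp
        rw [e, map_add, map_add, hu, map_smul, map_smul, smul_eq_mul, zero_add] at this
        by_contra hcon
        nlinarith) (interior_pre Θ (by rwa [map_neg, t2])) (interior_pre Θ (by rwa [t1])) hD
      obtain ⟨N, hN⟩ := exists_N1 L η0 (Real.sqrt_pos.2 (show 0 < -κ by linarith)).ne' (Real.sqrt_pos.2 (show 0 < -(1 + κ) by linarith)).ne'
      refine ⟨Θ.symm.trans N, fun v hv => ?_⟩
      obtain ⟨⟨w, Z, k⟩, rfl⟩ := Θ.surjective v
      have hv' : (w, Z, k) ≠ (0 : EuclideanSpace ℝ (Fin n) × ℝ × ℝ) := by rintro h0; rw [h0] at hv; simp at hv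
      have := hq w Z k hv'
      rw [mem_preimage, mem_preimage, map_neg] at this
      rw [this]
      simp only [LinearEquiv.trans_apply, LinearEquiv.symm_apply_apply, hN, mul_pow]
      rw [Real.sq_sqrt (by linarith), Real.sq_sqrt (by linarith)]
      constructor <;> intro h <;> linarith

end
end

section
open Set Module Filter Topology
set_option linter.unusedSectionVars false

section

/-- last coordinate in the chart `e` -/
def lastE {d : ℕ} (e : PV d ≃ₗ[ℝ] PV d) : PV d →ₗ[ℝ] ℝ := LinearMap.proj (Fin.last d) ∘ₗ e.symm.toLinearMap

/-- initial coordinates in the chart `e` -/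
def initE {d : ℕ} (e : PV d ≃ₗ[ℝ] PV d) : PV d →ₗ[ℝ] (Fin d → ℝ) :=
  LinearMap.funLeft ℝ ℝ Fin.castSucc ∘ₗ e.symm.toLinearMap

theorem ext_E {d : ℕ} (e : PV d ≃ₗ[ℝ] PV d) {v w : PV d} (h1 : lastE e v = lastE e w) (h2 : initE e v = initE e w) :
    v = w := by
  apply e.symm.injective
  ext i
  refine Fin.lastCases ?_ (fun i => ?_) i
  · exact h1
  · exact congrFun h2 i

theorem lastE_snoc {d : ℕ} (e : PV d ≃ₗ[ℝ] PV d) (x : Fin d → ℝ) : lastE e (e (Fin.snoc x 1)) = 1 := by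
  simp [lastE]

theorem initE_snoc {d : ℕ} (e : PV d ≃ₗ[ℝ] PV d) (x : Fin d → ℝ) : initE e (e (Fin.snoc x 1)) = x := by
  ext i
  simp [initE, LinearMap.funLeft_apply]

/-- cone over `S` -/
def cn {d : ℕ} (e : PV d ≃ₗ[ℝ] PV d) (S : Set (Fin d → ℝ)) : Set (PV d) :=
  {v | 0 < lastE e v ∧ (lastE e v)⁻¹ • initE e v ∈ S}

theorem cn_snoc {d : ℕ} (e : PV d ≃ₗ[ℝ] PV d) (S : Set (Fin d → ℝ)) (x : Fin d → ℝ) :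
    e (Fin.snoc x 1) ∈ cn e S ↔ x ∈ S := by
  simp [cn, lastE_snoc, initE_snoc]

theorem cn_smul {d : ℕ} (e : PV d ≃ₗ[ℝ] PV d) (S : Set (Fin d → ℝ)) {v : PV d} (hv : v ∈ cn e S) {t : ℝ} (ht : 0 < t) :
    t • v ∈ cn e S := by
  obtain ⟨h1, h2⟩ := hv
  refine ⟨by rw [map_smul, smul_eq_mul]; positivity, ?_⟩
  rw [map_smul, map_smul, smul_smul, smul_eq_mul]
  convert h2 using 2
  field_simp

theorem mem_chart_iff {d : ℕ} (e : PV d ≃ₗ[ℝ] PV d) (S : Set (Fin d → ℝ)) (v : PV d) (hv : v ≠ 0) :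
    Projectivization.mk ℝ v hv ∈ chartMap e '' S ↔ v ∈ cn e S ∨ -v ∈ cn e S := by
  constructor
  · rintro ⟨x, hx, he⟩
    rw [chartMap, Projectivization.mk_eq_mk_iff'] at he
    obtain ⟨a, ha⟩ := he
    have hxx := (cn_snoc e S x).2 hx
    have ha0 : a ≠ 0 := by
      rintro rfl
      rw [← ha, zero_smul] at hxx
      have := hxx.1
      simp at this
    have hv' : v = a⁻¹ • e (Fin.snoc x 1) := by rw [← ha, smul_smul, inv_mul_cancel₀ ha0, one_smul]
    rcases ha0.lt_or_gt with h | h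
    · right
      have : -v = (-a⁻¹) • e (Fin.snoc x 1) := by rw [hv', neg_smul]
      rw [this]
      exact cn_smul e S hxx (by simpa using h)
    · left
      rw [hv']
      exact cn_smul e S hxx (by simpa using h)
  · have key : ∀ w : PV d, w ∈ cn e S → ∃ x ∈ S, lastE e w • e (Fin.snoc x 1) = w := by
      intro w hw
      refine ⟨_, hw.2, ext_E e ?_ ?_⟩
      · rw [map_smul, lastE_snoc]; simp
      · rw [map_smul, initE_snoc, smul_smul, mul_inv_cancel₀ hw.1.ne', one_smul]
    rintro (h | h)
    · obtain ⟨x, hx, he⟩ := key v h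
      refine ⟨x, hx, ?_⟩
      rw [chartMap, Projectivization.mk_eq_mk_iff']
      refine ⟨(lastE e v)⁻¹, ?_⟩
      conv_lhs => rw [← he]
      rw [he]
      nth_rewrite 2 [← he]
      rw [smul_smul, inv_mul_cancel₀ h.1.ne', one_smul]
    · obtain ⟨x, hx, he⟩ := key _ h
      refine ⟨x, hx, ?_⟩
      rw [chartMap, Projectivization.mk_eq_mk_iff']
      refine ⟨-(lastE e (-v))⁻¹, ?_⟩
      have : v = - (lastE e (-v) • e (Fin.snoc x 1)) := by rw [he, neg_neg]
      nth_rewrite 2 [this]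
      rw [smul_neg, neg_smul, neg_neg, smul_smul, inv_mul_cancel₀ h.1.ne', one_smul]

theorem lastE_cont {d : ℕ} (e : PV d ≃ₗ[ℝ] PV d) : Continuous (lastE e) := (lastE e).continuous_of_finiteDimensional
theorem initE_cont {d : ℕ} (e : PV d ≃ₗ[ℝ] PV d) : Continuous (initE e) := (initE e).continuous_of_finiteDimensional

theorem cn_open {d : ℕ} (e : PV d ≃ₗ[ℝ] PV d) {U : Set (Fin d → ℝ)} (hU : IsOpen U) : IsOpen (cn e U) := by
  have h1 : IsOpen {v | 0 < lastE e v} := isOpen_lt continuous_const (lastE_cont e)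
  have h2 : ContinuousOn (fun v => (lastE e v)⁻¹ • initE e v) {v | 0 < lastE e v} := by
    refine ContinuousOn.smul (ContinuousOn.inv₀ (lastE_cont e).continuousOn ?_) (initE_cont e).continuousOn
    intro x hx
    exact ne_of_gt hx
  exact h2.isOpen_inter_preimage h1 hU

theorem cn_mono {d : ℕ} (e : PV d ≃ₗ[ℝ] PV d) {S T : Set (Fin d → ℝ)} (h : S ⊆ T) : cn e S ⊆ cn e T :=
  fun _ hv => ⟨hv.1, h hv.2⟩

theorem cn_int {d : ℕ} (e : PV d ≃ₗ[ℝ] PV d) (S : Set (Fin d → ℝ)) : cn e (interior S) ⊆ interior (cn e S) :=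
  interior_maximal (cn_mono e interior_subset) (cn_open e isOpen_interior)

theorem cn_pcone {d : ℕ} (e : PV d ≃ₗ[ℝ] PV d) {K : Set (Fin d → ℝ)} (hconv : Convex ℝ K) (hcpt : IsCompact K)
    (hne : K.Nonempty) : PCone (cn e K) where
  conv := by
    intro v hv w hw a b ha hb hab
    obtain ⟨v1, v2⟩ := hv
    obtain ⟨w1, w2⟩ := hw
    have hpos : 0 < a * lastE e v + b * lastE e w := by
      rcases ha.eq_or_lt with rfl | ha'
      · rw [zero_add] at hab; subst hab; linarith
      · have := mul_pos ha' v1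
        have := mul_nonneg hb w1.le
        linarith
    refine ⟨by simpa using hpos, ?_⟩
    have := hconv v2 w2 (a := a * lastE e v / (a * lastE e v + b * lastE e w))
      (b := b * lastE e w / (a * lastE e v + b * lastE e w)) (by positivity) (by positivity) (by field_simp)
    convert this using 1
    simp only [map_add, map_smul, smul_eq_mul, smul_add, smul_smul]
    congr 2 <;> field_simp
  smul := fun v hv t ht => cn_smul e K hv ht
  zero := fun h => by
    have := h.1
    simp at this
  cl := by
    haveI := isCompact_iff_compactSpace.1 hcpt
    have hcl : IsClosed {p : PV d × K | 0 ≤ lastE e p.1 ∧ initE e p.1 = lastE e p.1 • (p.2 : Fin d → ℝ)} := by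
      have c1 : Continuous fun p : PV d × K => lastE e p.1 := (lastE_cont e).comp continuous_fst
      have c2 : Continuous fun p : PV d × K => initE e p.1 := (initE_cont e).comp continuous_fst
      have c3 : Continuous fun p : PV d × K => (p.2 : Fin d → ℝ) := continuous_subtype_val.comp continuous_snd
      exact IsClosed.inter (isClosed_le continuous_const c1) (isClosed_eq c2 (c1.smul c3))
    have him := isClosedMap_fst_of_compactSpace _ hcl
    refine (congrArg IsClosed (?_ : insert 0 (cn e K) = _)).mpr him
    ext v
    constructor
    · rintro (rfl | hv)
      · obtain ⟨x, hx⟩ := hne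
        exact ⟨(0, ⟨x, hx⟩), by simp, rfl⟩
      · refine ⟨(v, ⟨_, hv.2⟩), ⟨hv.1.le, ?_⟩, rfl⟩
        simp only [smul_smul]
        rw [mul_inv_cancel₀ hv.1.ne', one_smul]
    · rintro ⟨⟨v', x, hx⟩, ⟨h1, h2⟩, rfl⟩
      simp only at h1 h2 ⊢
      rcases h1.eq_or_lt with h0 | h0
      · left
        refine ext_E e (by rw [map_zero, h0]) ?_
        rw [h2, ← h0]; simp
      · right
        refine ⟨h0, ?_⟩
        rw [h2, smul_smul, inv_mul_cancel₀ h0.ne', one_smul]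
        exact hx

theorem mk_mem_projSet {d : ℕ} (W : Submodule ℝ (PV d)) (v : PV d) (hv : v ≠ 0) :
    Projectivization.mk ℝ v hv ∈ projSet W ↔ v ∈ W := by
  simp [projSet, Projectivization.submodule_mk]

theorem mk_mem_projSpan {d : ℕ} (W : Submodule ℝ (PV d)) (p v : PV d) (hp : p ≠ 0) (hv : v ≠ 0) :
    Projectivization.mk ℝ v hv ∈ projSpan (Projectivization.mk ℝ p hp) W ↔ ∃ l ∈ W, ∃ k : ℝ, v = l + k • p := by
  simp only [projSpan, Projectivization.submodule_mk, mem_ofPred_eq, Submodule.span_singleton_le_iff_mem,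
    Submodule.mem_sup, Submodule.mem_span_singleton]
  constructor
  · rintro ⟨l, hl, _, ⟨k, rfl⟩, h⟩
    exact ⟨l, hl, k, h.symm⟩
  · rintro ⟨l, hl, k, h⟩
    exact ⟨l, hl, _, ⟨k, rfl⟩, h.symm⟩

theorem projSet_le {d : ℕ} {W W' : Submodule ℝ (PV d)} (h : projSet W ⊆ projSet W') : W ≤ W' := by
  intro v hv
  by_cases h0 : v = 0
  · rw [h0]; exact zero_mem _
  · exact (mk_mem_projSet W' v h0).1 (h ((mk_mem_projSet W v h0).2 hv))

theorem psi_of_hyp {n : ℕ} {K : Set (RP (n+1))} {C : Set (PV (n+1))} (h0C : (0 : PV (n+1)) ∉ C)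
    (hKC : ∀ v hv, Projectivization.mk ℝ v hv ∈ K ↔ v ∈ C ∨ -v ∈ C) {h : PV (n+1) →ₗ[ℝ] ℝ}
    {P1 P2 : PV (n+1)} (h1 : h P1 = 1) (h2 : h P2 = 1) (hP1 : P1 ≠ 0) (hP2 : P2 ≠ 0) (hPC : P1 ∈ C)
    (hyp : ∀ Wl : Submodule ℝ (PV (n+1)), Module.finrank ℝ Wl = n → projSet Wl ⊆ projSet (LinearMap.ker h) →
      ∃ (Φ : RP (n+1) → RP (n+1)) (G : Set (RP (n+1))) (τ : RP (n+1)),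
        IsHarmonicHomology Φ G τ ∧ projSet Wl ⊆ G ∧ τ ∈ projSet (LinearMap.ker h) ∧
          Φ '' (projSpan (Projectivization.mk ℝ P1 hP1) Wl ∩ K) = projSpan (Projectivization.mk ℝ P2 hP2) Wl ∩ K) :
    PsiHyp n C h P1 P2 := by
  intro Wl hfin hle
  obtain ⟨Φ, G, τ, ⟨σ, W, t, ht, hW, rfl, rfl, htW, hσW, hσt, hΦ⟩, hG, hτ, him⟩ := hyp Wl hfin (fun x hx => le_trans hx hle)
  rw [mk_mem_projSet, LinearMap.mem_ker] at hτ
  have hWl := projSet_le hG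
  have htop : W ⊔ Submodule.span ℝ {t} = ⊤ := by
    apply Submodule.eq_top_of_finrank_eq
    have hlt : W < W ⊔ Submodule.span ℝ {t} := by
      refine lt_of_le_of_ne le_sup_left fun hcon => htW ?_
      rw [hcon]
      exact Submodule.mem_sup_right (Submodule.mem_span_singleton_self t)
    have e1 := Submodule.finrank_lt_finrank_of_lt hlt
    have e2 := Submodule.finrank_le (W ⊔ Submodule.span ℝ {t})
    have e3 : finrank ℝ (PV (n+1)) = n + 1 + 1 := by simp
    omega
  have hσ : ∀ v, h (σ v) = h v := by
    intro v
    have hv : v ∈ W ⊔ Submodule.span ℝ {t} := by rw [htop]; trivial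
    obtain ⟨w, hw, _, hs, rfl⟩ := Submodule.mem_sup.1 hv
    obtain ⟨k, rfl⟩ := Submodule.mem_span_singleton.1 hs
    simp [hσW w hw, hσt, hτ]
  have hmem : ∀ v (hv : v ≠ 0), Projectivization.mk ℝ v hv ∈ projSpan (Projectivization.mk ℝ P1 hP1) Wl ∩ K →
      ∃ hv' : σ v ≠ 0, Projectivization.mk ℝ (σ v) hv' ∈ projSpan (Projectivization.mk ℝ P2 hP2) Wl ∩ K := by
    intro v hv hm
    obtain ⟨hv', he⟩ := hΦ v hv
    refine ⟨hv', ?_⟩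
    rw [← he, ← him]
    exact ⟨_, hm, rfl⟩
  obtain ⟨hP', hP''⟩ := hmem P1 hP1 ⟨(mk_mem_projSpan _ _ _ _ _).2 ⟨0, zero_mem _, 1, by simp⟩, (hKC _ _).2 (Or.inl hPC)⟩
  obtain ⟨c, hc, k, hk⟩ := (mk_mem_projSpan _ _ _ _ _).1 hP''.1
  have hhl : ∀ l ∈ Wl, h l = 0 := fun l hl => hle hl
  have hk1 : k = 1 := by
    have := congrArg h hk
    rw [hσ, h1, map_add, hhl c hc, map_smul, h2] at this
    simpa using this.symm
  rw [hk1, one_smul, add_comm c P2] at hk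
  refine ⟨c, hc, fun l hl k => ?_⟩
  have hσv : σ (l + k • P1) = l + k • (P2 + c) := by
    rw [map_add, map_smul, hk, hσW l (hWl hl)]
  rw [← hσv]
  by_cases hv : l + k • P1 = 0
  · rw [hv, map_zero]
  rw [← hKC _ hv]
  have hsp : Projectivization.mk ℝ _ hv ∈ projSpan (Projectivization.mk ℝ P1 hP1) Wl :=
    (mk_mem_projSpan _ _ _ _ _).2 ⟨l, hl, k, rfl⟩
  obtain ⟨hv', he⟩ := hΦ _ hv
  rw [← hKC _ hv']
  constructor
  · intro hm
    obtain ⟨_, hx⟩ := hmem _ hv ⟨hsp, hm⟩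
    exact hx.2
  · intro hm
    have hx : Projectivization.mk ℝ _ hv' ∈ projSpan (Projectivization.mk ℝ P2 hP2) Wl ∩ K := by
      refine ⟨(mk_mem_projSpan _ _ _ _ _).2 ⟨l + k • c, add_mem hl (Submodule.smul_mem _ _ hc), k, ?_⟩, hm⟩
      rw [hσv]; module
    rw [← him] at hx
    obtain ⟨y, ⟨hy1, hy2⟩, hy3⟩ := hx
    induction y using Projectivization.ind with
    | h y hy =>
    obtain ⟨hy', hye⟩ := hΦ y hy
    rw [hye, Projectivization.mk_eq_mk_iff'] at hy3
    obtain ⟨a, ha⟩ := hy3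
    rw [← map_smul] at ha
    have ha := σ.injective ha
    convert hy2 using 1
    rw [eq_comm, Projectivization.mk_eq_mk_iff']
    exact ⟨a, ha⟩

end
end

section
open Set Module Filter Topology
set_option linter.unusedSectionVars false

section

theorem exists_form {d : ℕ} (WH : Submodule ℝ (PV d)) (hWH : finrank ℝ WH = d) {P : PV d} (hP : P ∉ WH) :
    ∃ h : PV d →ₗ[ℝ] ℝ, h P = 1 ∧ WH = LinearMap.ker h := by
  obtain ⟨f, hf, hf'⟩ := Submodule.exists_dual_map_eq_bot_of_notMem hP inferInstance
  refine ⟨(f P)⁻¹ • f, by simp [hf], ?_⟩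
  have hle : WH ≤ LinearMap.ker ((f P)⁻¹ • f) := by
    intro v hv
    have : f v ∈ WH.map f := ⟨v, hv, rfl⟩
    rw [hf'] at this
    have : f v = 0 := by simpa using this
    simp [this]
  apply Submodule.eq_of_le_of_finrank_le hle
  have hlt : LinearMap.ker ((f P)⁻¹ • f) < ⊤ := by
    rw [lt_top_iff_ne_top]
    intro hcon
    have : P ∈ LinearMap.ker ((f P)⁻¹ • f) := by rw [hcon]; trivial
    rw [LinearMap.mem_ker] at this
    simp [hf] at this
  have e1 := Submodule.finrank_lt_finrank_of_lt hlt
  have e3 : finrank ℝ (PV d) = d + 1 := by simp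
  rw [finrank_top] at e1
  omega

/-- splitting off the last two coordinates -/
def splitJ (n : ℕ) : PV (n+1) ≃ₗ[ℝ] (EuclideanSpace ℝ (Fin n) × ℝ × ℝ) :=
  LinearMap.linearEquivOfInjective
    { toFun := fun x => (WithLp.toLp 2 (fun i => x (i.castSucc.castSucc)), x (Fin.last n).castSucc, x (Fin.last (n+1)))
      map_add' := by intro x y; rfl
      map_smul' := by intro c x; rfl }
    (by
      rw [injective_iff_map_eq_zero]
      intro x hx
      have e1 := congrArg Prod.fst hx
      have e2 := congrArg (fun p => p.2.1) hx
      have e3 := congrArg (fun p => p.2.2) hx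
      ext i
      refine Fin.lastCases e3 (fun i => ?_) i
      refine Fin.lastCases e2 (fun i => ?_) i
      exact congrArg (fun y : EuclideanSpace ℝ (Fin n) => y i) e1)
    (by simp)

theorem splitJ_apply (n : ℕ) (x : PV (n+1)) : splitJ n x =
    (WithLp.toLp 2 (fun i => x (i.castSucc.castSucc)), x (Fin.last n).castSucc, x (Fin.last (n+1))) := rfl

theorem ball_cn {n : ℕ} (e : PV (n+1) ≃ₗ[ℝ] PV (n+1)) (v : PV (n+1)) (hv : v ≠ 0) :
    (v ∈ cn e (euclUnitBall (n+1)) ∨ -v ∈ cn e (euclUnitBall (n+1))) ↔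
      ‖(splitJ n (e.symm v)).1‖ ^ 2 + (splitJ n (e.symm v)).2.1 ^ 2 ≤ (splitJ n (e.symm v)).2.2 ^ 2 := by
  have hs : ‖(splitJ n (e.symm v)).1‖ ^ 2 + (splitJ n (e.symm v)).2.1 ^ 2 = ∑ i, initE e v i ^ 2 := by
    rw [splitJ_apply, EuclideanSpace.norm_sq_eq, Fin.sum_univ_castSucc]
    simp [initE, LinearMap.funLeft_apply]
  have hl : (splitJ n (e.symm v)).2.2 = lastE e v := rfl
  rw [hs, hl]
  have hq : ∀ a : ℝ, a ≠ 0 → ∀ y : Fin (n+1) → ℝ, a⁻¹ • y ∈ euclUnitBall (n+1) ↔ ∑ i, y i ^ 2 ≤ a ^ 2 := by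
    intro a ha y
    simp only [euclUnitBall, mem_ofPred_eq, Pi.smul_apply, smul_eq_mul, mul_pow, ← Finset.mul_sum]
    rw [inv_pow, inv_mul_le_iff₀ (by positivity), mul_one]
  simp only [cn, mem_ofPred_eq, map_neg]
  constructor
  · rintro (⟨h1, h2⟩ | ⟨h1, h2⟩)
    · exact (hq _ h1.ne' _).1 h2
    · have := (hq _ h1.ne' _).1 h2
      simpa using this
  · intro h
    rcases lt_trichotomy (lastE e v) 0 with h0 | h0 | h0
    · right
      refine ⟨by linarith, (hq _ (by linarith) _).2 ?_⟩
      simpa using h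
    · exfalso
      refine hv (ext_E e (by rw [h0, map_zero]) ?_)
      rw [h0] at h
      have h3 : ∑ i, initE e v i ^ 2 = 0 :=
        le_antisymm (by simpa using h) (Finset.sum_nonneg fun i _ => sq_nonneg _)
      rw [Finset.sum_eq_zero_iff_of_nonneg (fun i _ => sq_nonneg _)] at h3
      ext i
      simpa using h3 i (Finset.mem_univ i)
    · left
      exact ⟨h0, (hq _ h0.ne' _).2 h⟩

theorem main_aux {n : ℕ} (hn : 2 ≤ n) (e : PV (n+1) ≃ₗ[ℝ] PV (n+1)) (K₀ : Set (Fin (n+1) → ℝ))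
    (hconv : Convex ℝ K₀) (hcpt : IsCompact K₀) (hint : (interior K₀).Nonempty)
    (WH : Submodule ℝ (PV (n+1))) (hWH : Module.finrank ℝ WH = n+1)
    (hsupp : ¬ IsSupportHyperplane e K₀ (projSet WH))
    (p₁ p₂ : RP (n+1)) (hp₁ : p₁ ∈ chartMap e '' interior K₀)
    (hp₂ : p₂ ∈ chartMap e '' interior K₀) (hne : p₁ ≠ p₂)
    (hp₁H : p₁ ∉ projSet WH) (hp₂H : p₂ ∉ projSet WH)
    (hyp : ∀ Wl : Submodule ℝ (PV (n+1)), Module.finrank ℝ Wl = n → projSet Wl ⊆ projSet WH →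
      ∃ (Φ : RP (n+1) → RP (n+1)) (G : Set (RP (n+1))) (τ : RP (n+1)),
        IsHarmonicHomology Φ G τ ∧ projSet Wl ⊆ G ∧ τ ∈ projSet WH ∧
          Φ '' (projSpan p₁ Wl ∩ (chartMap e '' K₀)) = projSpan p₂ Wl ∩ (chartMap e '' K₀)) :
    IsProjEllipsoid (chartMap e '' K₀) := by
  have hC : PCone (cn e K₀) := cn_pcone e hconv hcpt (hint.mono interior_subset)
  obtain ⟨x1, hx1, rfl⟩ := hp₁
  have i1 : e (Fin.snoc x1 1) ∈ interior (cn e K₀) := cn_int e K₀ ((cn_snoc e _ x1).2 hx1)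
  have hP1 : e (Fin.snoc x1 1) ≠ 0 := fun h => hC.zero (h ▸ interior_subset i1)
  set P1 := e (Fin.snoc x1 1) with hP1d
  change Projectivization.mk ℝ P1 hP1 ∉ _ at hp₁H
  rw [mk_mem_projSet] at hp₁H
  obtain ⟨h, h1, rfl⟩ := exists_form WH hWH hp₁H
  induction p₂ using Projectivization.ind with
  | h v2 hv2 =>
  rw [mk_mem_projSet, LinearMap.mem_ker] at hp₂H
  set P2 := (h v2)⁻¹ • v2 with hP2d
  have h2 : h P2 = 1 := by rw [hP2d, map_smul, smul_eq_mul, inv_mul_cancel₀ hp₂H]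
  have hP2 : P2 ≠ 0 := smul_ne_zero (inv_ne_zero hp₂H) hv2
  have hmk : Projectivization.mk ℝ v2 hv2 = Projectivization.mk ℝ P2 hP2 := by
    rw [Projectivization.mk_eq_mk_iff']
    exact ⟨h v2, by rw [hP2d, smul_smul, mul_inv_cancel₀ hp₂H, one_smul]⟩
  rw [hmk] at hp₂ hne hyp
  have i2 : P2 ∈ interior (cn e K₀) ∨ -P2 ∈ interior (cn e K₀) :=
    ((mem_chart_iff e _ P2 hP2).1 hp₂).imp (fun h => cn_int e K₀ h) (fun h => cn_int e K₀ h)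
  have hne' : P1 ≠ P2 := by
    intro hcon
    apply hne
    change Projectivization.mk ℝ P1 hP1 = _
    rw [Projectivization.mk_eq_mk_iff']
    exact ⟨1, by rw [one_smul, hcon]⟩
  have hΨ : PsiHyp n (cn e K₀) h P1 P2 :=
    psi_of_hyp hC.zero (mem_chart_iff e K₀) h1 h2 hP1 hP2 (interior_subset i1) hyp
  have hcase : (∀ v ∈ cn e K₀, h v ≠ 0) ∨ ∃ r ∈ interior (cn e K₀), h r = 0 := by
    by_contra hcon
    push Not at hcon
    obtain ⟨⟨v, hv, hv0⟩, hr⟩ := hcon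
    apply hsupp
    constructor
    · have hvn : v ≠ 0 := by rintro rfl; exact hC.zero hv
      exact ⟨Projectivization.mk ℝ v hvn, (mk_mem_projSet _ _ _).2 hv0, (mem_chart_iff e _ _ _).2 (Or.inl hv)⟩
    · rw [Set.eq_empty_iff_forall_notMem]
      rintro y ⟨hy1, x, hx, rfl⟩
      refine hr _ (cn_int e K₀ ((cn_snoc e _ x).2 hx)) ?_
      exact (mk_mem_projSet _ _ _).1 hy1
  obtain ⟨N, hN⟩ := cone_main hn (by simp) hC (lam := lastE e) (fun v hv => hv.1) h1 h2 i1 i2 hne' hcase hΨ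
  refine ⟨(splitJ n).trans N.symm, euclUnitBall (n+1), ⟨AffineEquiv.refl ℝ _, by simp⟩, ?_⟩
  ext y
  induction y using Projectivization.ind with
  | h v hv =>
  rw [mem_chart_iff, mem_chart_iff, hN v hv, ball_cn _ v hv]
  simp

end
end

theorem ellipsoid_of_harmonic_homologies {d : ℕ} (hd : 3 ≤ d)
    -- `K` is a convex body lying in an affine chart of `ℝP^d`
    (e : PV d ≃ₗ[ℝ] PV d) (K₀ : Set (Fin d → ℝ))
    (hconv : Convex ℝ K₀) (hcpt : IsCompact K₀) (hint : (interior K₀).Nonempty)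
    (K : Set (RP d)) (hK : K = chartMap e '' K₀)
    -- `H` is a hyperplane of `ℝP^d` which is not a support hyperplane of `K`
    (H : Set (RP d)) (WH : Submodule ℝ (PV d)) (hWH : Module.finrank ℝ WH = d)
    (hH : H = projSet WH) (hsupp : ¬ IsSupportHyperplane e K₀ H)
    -- `p₁ ≠ p₂` are interior points of `K` not lying on `H`
    (p₁ p₂ : RP d) (hp₁ : p₁ ∈ chartMap e '' interior K₀)
    (hp₂ : p₂ ∈ chartMap e '' interior K₀) (hne : p₁ ≠ p₂)
    (hp₁H : p₁ ∉ H) (hp₂H : p₂ ∉ H)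
    -- for every `(d-2)`-dimensional projective plane `l ⊆ H` there is a harmonic
    -- homology with hyperplane `G ⊇ l` and center `τ ∈ H` mapping `aff{p₁,l} ∩ K`
    -- onto `aff{p₂,l} ∩ K`
    (hyp : ∀ Wl : Submodule ℝ (PV d), Module.finrank ℝ Wl = d - 1 → projSet Wl ⊆ H →
      ∃ (Φ : RP d → RP d) (G : Set (RP d)) (τ : RP d),
        IsHarmonicHomology Φ G τ ∧ projSet Wl ⊆ G ∧ τ ∈ H ∧
          Φ '' (projSpan p₁ Wl ∩ K) = projSpan p₂ Wl ∩ K) :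
    IsProjEllipsoid K := by
  obtain ⟨n, rfl⟩ : ∃ n, d = n + 1 := ⟨d - 1, by omega⟩
  subst hK hH
  exact main_aux (by omega) e K₀ hconv hcpt hint WH hWH hsupp p₁ p₂ hp₁ hp₂ hne hp₁H hp₂H hyp
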